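/- arXiv:2102.08313 — 2 statements merged into one kernel-verified Lean document; each statement's English description precedes it below -/
import Mathlib

section
/- (Voronin's universality theorem.) Let 0 < r < 1/4 and let F : ℂ → ℂ be analytic on the open disk {s : |s| < r}, continuous on the closed disk {s : |s| ≤ r}, and satisfy F(s) ≠ 0 for all |s| < r. Then for every ε > 0 there exists a real number T = T(ε,F) such that max_{|s| ≤ r} |F(s) − ζ(s + 3/4 + iT)| < ε. -/
open Complex Metric

namespace Voronin
open MeasureTheory Set Filter Topology

/-- tail integral of the fractional part -/
noncomputable def zG (N : ℝ) (s : ℂ) : ℂ :=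
  ∫ t in Ioi N, ((Int.fract t : ℝ) : ℂ) * (t : ℂ) ^ (-(s + 1))

lemma zG_norm_le (s : ℂ) {t : ℝ} (ht : 0 < t) :
    ‖((Int.fract t : ℝ) : ℂ) * (t : ℂ) ^ (-(s + 1))‖ ≤ t ^ (-(s.re + 1)) := by
  rw [norm_mul, Complex.norm_cpow_eq_rpow_re_of_pos ht]
  simp only [norm_real, Real.norm_eq_abs, abs_of_nonneg (Int.fract_nonneg t), neg_re, add_re, one_re]
  have := (Int.fract_lt_one t).le
  have h2 : 0 ≤ t ^ (-(s.re + 1)) := by positivity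
  nlinarith [Int.fract_nonneg t]

lemma zG_meas (s : ℂ) : Measurable fun t : ℝ => ((Int.fract t : ℝ) : ℂ) * (t : ℂ) ^ (-(s + 1)) := by
  have : Measurable fun t : ℝ => (Int.fract t : ℝ) := measurable_fract
  exact (Complex.measurable_ofReal.comp this).mul (Complex.measurable_ofReal.pow_const _)

lemma zG_integrable {s : ℂ} (hs : 0 < s.re) {N : ℝ} (hN : 0 < N) :
    IntegrableOn (fun t : ℝ => ((Int.fract t : ℝ) : ℂ) * (t : ℂ) ^ (-(s + 1))) (Ioi N) := by
  refine Integrable.mono' (integrableOn_Ioi_rpow_of_lt (a := -(s.re + 1)) (by linarith) hN)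
    (zG_meas s).aestronglyMeasurable ?_
  filter_upwards [ae_restrict_mem measurableSet_Ioi] with t ht
  exact zG_norm_le s (hN.trans ht)

lemma zG_one_norm {s : ℂ} (hs : 0 < s.re) : ‖zG 1 s‖ ≤ 1 / s.re := by
  have h1 := integral_Ioi_rpow_of_lt (a := -(s.re + 1)) (by linarith) (c := 1) one_pos
  have h2 : ‖zG 1 s‖ ≤ ∫ t in Ioi (1:ℝ), t ^ (-(s.re + 1)) := by
    refine norm_integral_le_of_norm_le
      (integrableOn_Ioi_rpow_of_lt (a := -(s.re + 1)) (by linarith) one_pos) ?_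
    filter_upwards [ae_restrict_mem measurableSet_Ioi] with t ht
    exact zG_norm_le s (one_pos.trans ht)
  rw [h1] at h2
  refine h2.trans (le_of_eq ?_)
  rw [Real.one_rpow, show -(s.re + 1) + 1 = -s.re by ring]
  field_simp

lemma zG_one_diff {s : ℂ} (hs : 0 < s.re) : DifferentiableAt ℂ (zG 1) s := by
  set f : ℝ → ℂ := (Ioi (1:ℝ)).indicator (fun t => ((Int.fract t : ℝ) : ℂ)) with hf
  have hfm : Measurable f := by
    refine Measurable.indicator ?_ measurableSet_Ioi
    exact Complex.measurable_ofReal.comp measurable_fract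
  have hb : ∀ t, ‖f t‖ ≤ 1 := by
    intro t
    refine (norm_indicator_le_norm_self _ _).trans ?_
    simp only [norm_real, Real.norm_eq_abs, abs_of_nonneg (Int.fract_nonneg t)]
    exact (Int.fract_lt_one t).le
  have key : zG 1 = fun s => mellin f (-s) := by
    funext s
    rw [zG, mellin, hf, ← integral_indicator measurableSet_Ioi, ← integral_indicator measurableSet_Ioi]
    congr 1
    funext t
    by_cases h : 1 < t
    · have h0 : 0 < t := by linarith
      simp only [indicator, mem_Ioi, h, h0, if_true, smul_eq_mul]
      rw [mul_comm]; congr 2; ring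
    · simp [indicator, mem_Ioi, h]
  rw [key]
  have : DifferentiableAt ℂ (mellin f) (-s) := by
    refine mellin_differentiableAt_of_isBigO_rpow (a := 0) (b := -s.re - 1) ?_ ?_ (by simpa using hs)
      ?_ (by simp)
    · have hli : LocallyIntegrable f := by
        refine (locallyIntegrable_const (1:ℝ)).mono hfm.aestronglyMeasurable ?_
        filter_upwards with t
        simpa using hb t
      exact hli.locallyIntegrableOn _
    · refine Asymptotics.IsBigO.of_bound 1 (Eventually.of_forall fun t => ?_)
      simpa using hb t
    · refine Asymptotics.IsBigO.of_bound 1 ?_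
      have : ∀ᶠ t : ℝ in 𝓝[>] 0, t < 1 := by
        have := (eventually_lt_nhds (show (0:ℝ) < 1 by norm_num))
        exact nhdsWithin_le_nhds this
      filter_upwards [this] with t ht
      have : f t = 0 := by simp [hf, indicator, not_lt.2 ht.le]
      rw [this, norm_zero]; positivity
  exact this.comp s differentiableAt_id.neg

lemma zeta_one_lt {s : ℂ} (hs : 1 < s.re) :
    riemannZeta₁ s = s - (s - 1) * s * zG 1 s := by
  have hs1 : s ≠ 1 := by rintro rfl; simp at hs
  have h0 : s - 1 ≠ 0 := sub_ne_zero.2 hs1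
  have hL := LSeries_eq_mul_integral' (1 : ℕ → ℂ) (r := 1) zero_le_one hs (by
    refine Asymptotics.IsBigO.of_bound 1 (Eventually.of_forall fun n => ?_)
    simp)
  rw [LSeries_one_eq_riemannZeta hs] at hL
  have hi1 : IntegrableOn (fun t : ℝ => (t:ℂ) ^ (-s)) (Ioi (1:ℝ)) :=
    integrableOn_Ioi_cpow_of_lt (by simpa using hs) one_pos
  have hcongr : ∫ t in Ioi (1 : ℝ), (∑ k ∈ Finset.Icc 1 ⌊t⌋₊, (1 : ℕ → ℂ) k) * (t:ℂ) ^ (-(s + 1))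
      = ∫ t in Ioi (1 : ℝ), ((t:ℂ) ^ (-s) - ((Int.fract t : ℝ) : ℂ) * (t : ℂ) ^ (-(s + 1))) := by
    refine setIntegral_congr_fun measurableSet_Ioi fun t ht => ?_
    have ht0 : (0:ℝ) < t := lt_trans one_pos ht
    have e1 : ((⌊t⌋₊ : ℝ)) = t - Int.fract t := by
      rw [Int.self_sub_fract, natCast_floor_eq_intCast_floor ht0.le]
    have e2 : ((⌊t⌋₊ : ℂ)) = t - (Int.fract t : ℝ) := by
      rw [← ofReal_natCast, e1]; push_cast; ring
    have e3 : (t:ℂ) ^ (-s) = t * (t:ℂ) ^ (-(s+1)) := by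
      have : (t:ℂ) ≠ 0 := by exact_mod_cast ht0.ne'
      rw [show -s = 1 + -(s+1) by ring, Complex.cpow_add _ _ this, Complex.cpow_one]
    simp only [Pi.one_apply, Finset.sum_const, Nat.card_Icc, add_tsub_cancel_right, nsmul_eq_mul, mul_one]
    rw [e2, e3]; ring
  rw [hcongr, integral_sub hi1 (zG_integrable (by linarith) one_pos), integral_Ioi_cpow_of_lt (by simpa using hs) one_pos,
    riemannZeta_eq_inv_sub_mul hs1] at hL
  simp only [ofReal_one, one_cpow] at hL
  have h0' : -s + 1 ≠ 0 := by intro h; apply h0; linear_combination -h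
  change _ = s * (_ - zG 1 s) at hL
  field_simp at hL
  apply mul_right_cancel₀ h0'
  linear_combination hL

lemma zeta_one_pos {s : ℂ} (hs : 0 < s.re) :
    riemannZeta₁ s = s - (s - 1) * s * zG 1 s := by
  have hopen : IsOpen {z : ℂ | 0 < z.re} := isOpen_lt continuous_const Complex.continuous_re
  have hA : AnalyticOnNhd ℂ riemannZeta₁ {z : ℂ | 0 < z.re} :=
    differentiable_riemannZeta₁.differentiableOn.analyticOnNhd hopen
  have hB : AnalyticOnNhd ℂ (fun s => s - (s - 1) * s * zG 1 s) {z : ℂ | 0 < z.re} := by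
    refine DifferentiableOn.analyticOnNhd (fun z hz => DifferentiableAt.differentiableWithinAt ?_) hopen
    have := zG_one_diff hz
    fun_prop
  have hc : IsPreconnected {z : ℂ | 0 < z.re} := (convex_halfSpace_re_gt 0).isPreconnected
  refine hA.eqOn_of_preconnected_of_eventuallyEq hB hc (z₀ := 2) (by simp) ?_ hs
  have h2 : {z : ℂ | 1 < z.re} ∈ 𝓝 (2:ℂ) :=
    (isOpen_lt continuous_const Complex.continuous_re).mem_nhds (by simp)
  filter_upwards [h2] with z hz using zeta_one_lt hz

lemma zeta1_ne_zero {z : ℂ} (hz : ‖z - 1‖ < 1 / 2) : riemannZeta₁ z ≠ 0 := by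
  have hre : 1 / 2 < z.re := by
    have := (abs_le.1 ((Complex.abs_re_le_norm (z-1)))).1
    simp at this; linarith
  have h0 : z ≠ 0 := by rintro rfl; simp at hre; linarith
  rw [zeta_one_pos (by linarith)]
  intro h
  have h1 : (z - 1) * zG 1 z = 1 := by
    have : z * (1 - (z-1) * zG 1 z) = 0 := by linear_combination h
    rcases mul_eq_zero.1 this with h | h
    · exact absurd h h0
    · linear_combination -h
  have h2 := congrArg norm h1
  rw [norm_mul, norm_one] at h2
  have h3 := zG_one_norm (s := z) (by linarith)
  have h4 : 1 / z.re < 2 := by rw [div_lt_iff₀ (by linarith)]; linarith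
  nlinarith [norm_nonneg (z-1), norm_nonneg (zG 1 z)]

lemma zG_step {s : ℂ} (hs : 0 < s.re) (hs1 : s ≠ 1) {N : ℕ} (hN : 1 ≤ N) :
    s * zG N s = s * zG ((N + 1 : ℕ) : ℝ) s + (s / (1 - s)) * (((N + 1 : ℕ) : ℂ) ^ (1 - s) - (N:ℂ) ^ (1 - s))
      + N * (((N + 1 : ℕ) : ℂ) ^ (- s) - (N:ℂ) ^ (- s)) := by
  have hN0 : (0:ℝ) < N := by exact_mod_cast hN
  have hle : (N:ℝ) ≤ ((N+1 : ℕ):ℝ) := by push_cast; linarith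
  have hs0 : s ≠ 0 := by rintro rfl; simp at hs
  have h10 : 1 - s ≠ 0 := sub_ne_zero.2 hs1.symm
  have hnot : (0:ℝ) ∉ uIcc (N:ℝ) ((N+1 : ℕ):ℝ) := by
    rw [uIcc_of_le hle]; intro h; linarith [h.1]
  have hsplit : zG N s = (∫ t in (N:ℝ)..((N+1 : ℕ):ℝ), ((Int.fract t : ℝ) : ℂ) * (t : ℂ) ^ (-(s + 1)))
      + zG ((N + 1 : ℕ) : ℝ) s := by
    rw [zG, zG, intervalIntegral.integral_of_le hle, ← setIntegral_union _ measurableSet_Ioi, Ioc_union_Ioi_eq_Ioi hle]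
    · exact (zG_integrable hs hN0).mono_set Ioc_subset_Ioi_self
    · exact zG_integrable hs (hN0.trans_le hle)
    · exact Ioc_disjoint_Ioi le_rfl
  have hint : (∫ t in (N:ℝ)..((N+1 : ℕ):ℝ), ((Int.fract t : ℝ) : ℂ) * (t : ℂ) ^ (-(s + 1)))
      = ∫ t in (N:ℝ)..((N+1 : ℕ):ℝ), ((t : ℂ) ^ (-s) - N * (t : ℂ) ^ (-(s + 1))) := by
    refine intervalIntegral.integral_congr_ae ?_
    have : ∀ᵐ t : ℝ, t ≠ ((N+1:ℕ):ℝ) := by simp [ae_iff]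
    filter_upwards [this] with t ht1 ht
    rw [uIoc_of_le hle] at ht
    have ht0 : (0:ℝ) < t := hN0.trans ht.1
    have ht2 : t < (N:ℝ) + 1 := by
      have := lt_of_le_of_ne ht.2 ht1
      push_cast at this; exact this
    have hf : ⌊t⌋ = (N:ℤ) := by
      rw [Int.floor_eq_iff]; push_cast; exact ⟨ht.1.le, ht2⟩
    have e3 : (t:ℂ) ^ (-s) = t * (t:ℂ) ^ (-(s+1)) := by
      have : (t:ℂ) ≠ 0 := by exact_mod_cast ht0.ne'
      rw [show -s = 1 + -(s+1) by ring, Complex.cpow_add _ _ this, Complex.cpow_one]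
    rw [e3, Int.fract, hf]; push_cast; ring
  have hi : ∀ a : ℂ, IntervalIntegrable (fun t : ℝ => (t:ℂ) ^ a) volume (N:ℝ) ((N+1 : ℕ):ℝ) := fun a =>
    intervalIntegral.intervalIntegrable_cpow (Or.inr hnot)
  rw [hsplit, hint, intervalIntegral.integral_sub (hi _) ((hi _).const_mul _),
    intervalIntegral.integral_const_mul, integral_cpow, integral_cpow]
  · rw [show -s + 1 = 1 - s by ring, show -(s+1) + 1 = -s by ring]
    simp only [ofReal_natCast]
    field_simp
    ring
  · right; refine ⟨fun h => hs0 (by linear_combination -h), hnot⟩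
  · right; refine ⟨fun h => hs1 (by linear_combination -h), hnot⟩

lemma zeta_eq {s : ℂ} (hs : 0 < s.re) (hs1 : s ≠ 1) {N : ℕ} (hN : 1 ≤ N) :
    riemannZeta s = (∑ n ∈ Finset.Icc 1 N, (n:ℂ) ^ (-s)) + (N:ℂ) ^ (1 - s) / (s - 1) - s * zG N s := by
  have h10 : s - 1 ≠ 0 := sub_ne_zero.2 hs1
  have h10' : 1 - s ≠ 0 := sub_ne_zero.2 hs1.symm
  induction N, hN using Nat.le_induction with
  | base =>
    rw [riemannZeta_eq_inv_sub_mul hs1, zeta_one_pos hs]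
    simp
    field_simp
    ring
  | succ N hN ih =>
    rw [ih, zG_step hs hs1 hN, Finset.sum_Icc_succ_top (by omega)]
    have e1 : ((N + 1 : ℕ) : ℂ) ^ (1 - s) = ((N + 1 : ℕ) : ℂ) * ((N + 1 : ℕ) : ℂ) ^ (- s) := by
      have : ((N + 1 : ℕ) : ℂ) ≠ 0 := by exact_mod_cast Nat.succ_ne_zero N
      rw [show 1 - s = 1 + -s by ring, Complex.cpow_add _ _ this, Complex.cpow_one]
    have e2 : (N : ℂ) ^ (1 - s) = N * (N : ℂ) ^ (- s) := by
      have : (N : ℂ) ≠ 0 := by exact_mod_cast (by omega : N ≠ 0)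
      rw [show 1 - s = 1 + -s by ring, Complex.cpow_add _ _ this, Complex.cpow_one]
    rw [e1, e2]
    have e3 : s / (1 - s) = - (s / (s - 1)) := by rw [← neg_sub s 1, div_neg]
    rw [e3]
    push_cast
    field_simp
    ring

end Voronin

namespace Voronin
open MeasureTheory Set Filter Topology ProbabilityTheory

/-- centred Gaussian measure with standard deviation `T` -/
noncomputable def gT (T : ℝ) : Measure ℝ := gaussianReal 0 (Real.toNNReal (T ^ 2))

instance (T : ℝ) : IsProbabilityMeasure (gT T) := by unfold gT; infer_instance

lemma gT_char (T u : ℝ) : ∫ t, cexp (-(I * t * u)) ∂(gT T) = (Real.exp (-(T ^ 2 * u ^ 2 / 2)) : ℝ) := by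
  have h := charFun_gaussianReal (μ := 0) (v := Real.toNNReal (T ^ 2)) (-u)
  rw [charFun_apply_real] at h
  have e : ∀ t : ℝ, cexp (-(I * t * u)) = cexp (((-u : ℝ) : ℂ) * t * I) := by
    intro t; congr 1; push_cast; ring
  simp_rw [e]
  rw [gT, h, ofReal_exp, Real.coe_toNNReal _ (sq_nonneg T)]
  congr 1; push_cast; ring

lemma norm_exp_I (t u : ℝ) : ‖cexp (-(I * t * u))‖ = 1 := by
  rw [Complex.norm_exp]; simp

lemma gauss_fubini (μ : Measure ℝ) [SFinite μ] (T : ℝ) (g : ℝ → ℂ) (hg : Integrable g μ) :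
    ∫ t, ‖∫ u, g u * cexp (-(I * t * u)) ∂μ‖ ^ 2 ∂(gT T) ≤
      ∫ u, ‖g u‖ * (∫ w, ‖g w‖ * Real.exp (-(T ^ 2 * (u - w) ^ 2 / 2)) ∂μ) ∂μ := by
  let Fn : ℝ → ℝ × ℝ → ℂ := fun t z =>
    (g z.1 * (starRingEnd ℂ) (g z.2)) * cexp (-(I * t * ((z.1 - z.2 : ℝ))))
  have hgg : Integrable (fun z : ℝ × ℝ => g z.1 * (starRingEnd ℂ) (g z.2)) (μ.prod μ) := by
    have hg' : Integrable (fun w => (starRingEnd ℂ) (g w)) μ :=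
      (LinearIsometryEquiv.integrable_comp_iff (conjLIE)).2 hg
    exact hg.mul_prod hg'
  have h1 : ∀ t : ℝ, ((‖∫ u, g u * cexp (-(I * t * u)) ∂μ‖ ^ 2 : ℝ) : ℂ) = ∫ z, Fn t z ∂(μ.prod μ) := by
    intro t
    have e1 : (starRingEnd ℂ) (∫ u, g u * cexp (-(I * t * u)) ∂μ) =
        ∫ u, (starRingEnd ℂ) (g u * cexp (-(I * t * u))) ∂μ := integral_conj.symm
    rw [ofReal_pow, ← Complex.mul_conj', e1, ← integral_prod_mul]
    refine integral_congr_ae (Eventually.of_forall fun z => ?_)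
    simp only [Fn, map_mul, ← Complex.exp_conj, map_neg, conj_I, conj_ofReal]
    rw [mul_mul_mul_comm, ← Complex.exp_add]
    congr 2
    push_cast; ring
  have hFi : Integrable (Function.uncurry Fn) ((gT T).prod (μ.prod μ)) := by
    have : Integrable (fun q : ℝ × (ℝ × ℝ) => (1:ℂ) * (g q.2.1 * (starRingEnd ℂ) (g q.2.2)))
        ((gT T).prod (μ.prod μ)) := (integrable_const (1:ℂ)).mul_prod hgg
    refine this.mono ?_ ?_
    · have h2 := this.aestronglyMeasurable
      simp only [one_mul] at h2
      refine h2.mul ?_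
      have : Continuous fun q : ℝ × (ℝ × ℝ) => cexp (-(I * q.1 * ((q.2.1 - q.2.2 : ℝ)))) := by fun_prop
      exact this.aestronglyMeasurable
    · filter_upwards with q
      simp only [Function.uncurry, Fn]
      rw [norm_mul, norm_exp_I]; simp
  have h2 : ((∫ t, ‖∫ u, g u * cexp (-(I * t * u)) ∂μ‖ ^ 2 ∂(gT T) : ℝ) : ℂ) =
      ∫ z, (g z.1 * (starRingEnd ℂ) (g z.2)) * (Real.exp (-(T ^ 2 * (z.1 - z.2) ^ 2 / 2)) : ℝ) ∂(μ.prod μ) := by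
    rw [← integral_complex_ofReal]
    simp_rw [h1]
    rw [integral_integral_swap hFi]
    refine integral_congr_ae (Eventually.of_forall fun z => ?_)
    simp only [Fn]
    rw [integral_const_mul, gT_char]
  have hEi : Integrable (fun z : ℝ × ℝ => ‖g z.1‖ * (‖g z.2‖ * Real.exp (-(T ^ 2 * (z.1 - z.2) ^ 2 / 2)))) (μ.prod μ) := by
    have h3 : Integrable (fun z : ℝ × ℝ => ‖g z.1‖ * ‖g z.2‖) (μ.prod μ) := hg.norm.mul_prod hg.norm
    refine h3.mono ?_ ?_
    · simp_rw [← mul_assoc]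
      refine h3.aestronglyMeasurable.mul ?_
      have : Continuous fun z : ℝ × ℝ => Real.exp (-(T ^ 2 * (z.1 - z.2) ^ 2 / 2)) := by fun_prop
      exact this.aestronglyMeasurable
    · filter_upwards with z
      have : Real.exp (-(T ^ 2 * (z.1 - z.2) ^ 2 / 2)) ≤ 1 := by
        rw [Real.exp_le_one_iff]; have := mul_nonneg (sq_nonneg T) (sq_nonneg (z.1 - z.2)); linarith
      simp only [norm_mul, norm_norm, Real.norm_eq_abs, Real.abs_exp]
      gcongr
      rw [abs_norm]
      exact mul_le_of_le_one_right (norm_nonneg _) this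
  have h4 : ‖((∫ t, ‖∫ u, g u * cexp (-(I * t * u)) ∂μ‖ ^ 2 ∂(gT T) : ℝ) : ℂ)‖ ≤
      ∫ z, ‖g z.1‖ * (‖g z.2‖ * Real.exp (-(T ^ 2 * (z.1 - z.2) ^ 2 / 2))) ∂(μ.prod μ) := by
    rw [h2]
    refine norm_integral_le_of_norm_le hEi (Eventually.of_forall fun z => ?_)
    simp only [norm_mul, RCLike.norm_conj, norm_real, Real.norm_eq_abs, Real.abs_exp]
    rw [mul_assoc]
  rw [norm_real, Real.norm_eq_abs] at h4
  refine (le_abs_self _).trans (h4.trans (le_of_eq ?_))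
  rw [integral_prod _ hEi]
  refine integral_congr_ae (Eventually.of_forall fun u => ?_)
  simp only
  rw [integral_const_mul]

lemma gauss_tail {T σ a : ℝ} (hT : 0 < T) (hσ : 0 < σ) (g : ℝ → ℂ) (hm : Measurable g)
    (hb : ∀ u, a < u → ‖g u‖ ≤ Real.exp (-σ * u)) :
    ∫ t, ‖∫ u in Ioi a, g u * cexp (-(I * t * u))‖ ^ 2 ∂(gT T) ≤ 3 / (T * σ) * Real.exp (-2 * σ * a) := by
  have hei : IntegrableOn (fun u : ℝ => Real.exp (-σ * u)) (Ioi a) := integrableOn_exp_mul_Ioi (by linarith) a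
  have hgi : IntegrableOn g (Ioi a) := by
    refine Integrable.mono' hei hm.aestronglyMeasurable ?_
    filter_upwards [ae_restrict_mem measurableSet_Ioi] with t ht using hb t ht
  refine (gauss_fubini _ T g hgi).trans ?_
  have hG : ∀ u : ℝ, Integrable (fun w : ℝ => Real.exp (-(T ^ 2 * (u - w) ^ 2 / 2))) ∧
      ∫ w : ℝ, Real.exp (-(T ^ 2 * (u - w) ^ 2 / 2)) ≤ 3 / T := by
    intro u
    have hb : 0 < T ^ 2 / 2 := by positivity
    have e : (fun w : ℝ => Real.exp (-(T ^ 2 * (u - w) ^ 2 / 2))) =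
        fun w : ℝ => (fun x : ℝ => Real.exp (-(T ^ 2 / 2) * x ^ 2)) (u - w) := by
      funext w; simp only; congr 1; ring
    constructor
    · rw [e]
      exact (integrable_exp_neg_mul_sq hb).comp_sub_left u
    · rw [e, integral_sub_left_eq_self (fun x : ℝ => Real.exp (-(T ^ 2 / 2) * x ^ 2)) volume u,
        integral_gaussian]
      rw [show Real.pi / (T ^ 2 / 2) = (2 * Real.pi) / T ^ 2 by field_simp, Real.sqrt_div' _ (by positivity),
        Real.sqrt_sq hT.le]
      gcongr
      rw [Real.sqrt_le_left (by norm_num)]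
      linarith [Real.pi_le_four]
  have hin : ∀ u : ℝ, ∫ w in Ioi a, ‖g w‖ * Real.exp (-(T ^ 2 * (u - w) ^ 2 / 2)) ≤ Real.exp (-σ * a) * (3 / T) := by
    intro u
    calc ∫ w in Ioi a, ‖g w‖ * Real.exp (-(T ^ 2 * (u - w) ^ 2 / 2))
        ≤ ∫ w in Ioi a, Real.exp (-σ * a) * Real.exp (-(T ^ 2 * (u - w) ^ 2 / 2)) := by
          refine integral_mono_of_nonneg (Eventually.of_forall fun w => by positivity)
            (((hG u).1.integrableOn).const_mul _) ?_
          filter_upwards [ae_restrict_mem measurableSet_Ioi] with w hw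
          refine mul_le_mul_of_nonneg_right ((hb w hw).trans ?_) (Real.exp_nonneg _)
          rw [Real.exp_le_exp]
          have : a < w := hw
          nlinarith
      _ = Real.exp (-σ * a) * ∫ w in Ioi a, Real.exp (-(T ^ 2 * (u - w) ^ 2 / 2)) := integral_const_mul _ _
      _ ≤ _ := by
          refine mul_le_mul_of_nonneg_left (le_trans ?_ (hG u).2) (Real.exp_nonneg _)
          exact setIntegral_le_integral (hG u).1 (Eventually.of_forall fun w => Real.exp_nonneg _)
  calc ∫ u in Ioi a, ‖g u‖ * (∫ w in Ioi a, ‖g w‖ * Real.exp (-(T ^ 2 * (u - w) ^ 2 / 2)))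
      ≤ ∫ u in Ioi a, Real.exp (-σ * u) * (Real.exp (-σ * a) * (3 / T)) := by
        refine integral_mono_of_nonneg (Eventually.of_forall fun w => ?_) (hei.mul_const _) ?_
        · exact mul_nonneg (norm_nonneg _) (integral_nonneg fun w => by positivity)
        filter_upwards [ae_restrict_mem measurableSet_Ioi] with u hu
        exact mul_le_mul (hb u hu) (hin u) (integral_nonneg fun w => by positivity) (Real.exp_nonneg _)
    _ = 3 / (T * σ) * Real.exp (-2 * σ * a) := by
        rw [integral_mul_const, integral_exp_mul_Ioi (by linarith)]
        rw [show -2 * σ * a = -σ * a + -σ * a by ring, Real.exp_add]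
        field_simp

lemma gauss_finite {ι : Type*} [Fintype ι] [DecidableEq ι] (T δ : ℝ) (hδ : 0 ≤ δ) (c : ι → ℂ) (l : ι → ℝ)
    (hl : ∀ i j, i ≠ j → δ ≤ |l i - l j|) :
    |(∫ t : ℝ, ‖∑ i, c i * cexp (-(I * t * l i))‖ ^ 2 ∂(gT T)) - ∑ i, ‖c i‖ ^ 2| ≤
      Fintype.card ι * Real.exp (-(T ^ 2 * δ ^ 2 / 2)) * ∑ i, ‖c i‖ ^ 2 := by
  have h1 : ((∫ t : ℝ, ‖∑ i, c i * cexp (-(I * t * l i))‖ ^ 2 ∂(gT T) : ℝ) : ℂ) =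
      ∑ i, ∑ j, c i * (starRingEnd ℂ) (c j) * (Real.exp (-(T ^ 2 * (l i - l j) ^ 2 / 2)) : ℝ) := by
    rw [← integral_complex_ofReal]
    have e : ∀ t : ℝ, ((‖∑ i, c i * cexp (-(I * t * l i))‖ ^ 2 : ℝ) : ℂ) =
        ∑ i, ∑ j, c i * (starRingEnd ℂ) (c j) * cexp (-(I * t * ((l i - l j : ℝ)))) := by
      intro t
      rw [ofReal_pow, ← Complex.mul_conj', map_sum, Finset.sum_mul_sum]
      refine Finset.sum_congr rfl fun i _ => Finset.sum_congr rfl fun j _ => ?_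
      simp only [map_mul, ← Complex.exp_conj, map_neg, conj_I, conj_ofReal]
      rw [mul_mul_mul_comm, ← Complex.exp_add]
      congr 2
      push_cast; ring
    simp_rw [e]
    have hint : ∀ i j, Integrable (fun t : ℝ => c i * (starRingEnd ℂ) (c j) * cexp (-(I * t * ((l i - l j : ℝ))))) (gT T) := by
      intro i j
      refine Integrable.const_mul ?_ _
      refine (integrable_const (1:ℂ)).mono ?_ ?_
      · have : Continuous fun t : ℝ => cexp (-(I * t * ((l i - l j : ℝ)))) := by fun_prop
        exact this.aestronglyMeasurable
      · filter_upwards with t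
        rw [norm_exp_I]; simp
    rw [integral_finsetSum _ fun i _ => integrable_finsetSum _ fun j _ => hint i j]
    refine Finset.sum_congr rfl fun i _ => ?_
    rw [integral_finsetSum _ fun j _ => hint i j]
    refine Finset.sum_congr rfl fun j _ => ?_
    rw [integral_const_mul, gT_char]
  have h2 : ((∑ i, ‖c i‖ ^ 2 : ℝ) : ℂ) = ∑ i, ∑ j, if i = j then c i * (starRingEnd ℂ) (c j) else 0 := by
    simp [Complex.mul_conj']
  have h3 : ‖(((∫ t : ℝ, ‖∑ i, c i * cexp (-(I * t * l i))‖ ^ 2 ∂(gT T)) - ∑ i, ‖c i‖ ^ 2 : ℝ) : ℂ)‖ ≤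
      ∑ i, ∑ j, ‖c i‖ * ‖c j‖ * Real.exp (-(T ^ 2 * δ ^ 2 / 2)) := by
    rw [ofReal_sub, h1, h2, ← Finset.sum_sub_distrib]
    refine (norm_sum_le _ _).trans (Finset.sum_le_sum fun i _ => ?_)
    rw [← Finset.sum_sub_distrib]
    refine (norm_sum_le _ _).trans (Finset.sum_le_sum fun j _ => ?_)
    by_cases hij : i = j
    · subst hij; simp; positivity
    · simp only [hij, if_false, sub_zero, norm_mul, RCLike.norm_conj, norm_real, Real.norm_eq_abs, Real.abs_exp]
      have h9 : δ ^ 2 ≤ (l i - l j) ^ 2 := by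
        rw [← sq_abs (l i - l j)]
        exact pow_le_pow_left₀ hδ (hl i j hij) 2
      gcongr
  rw [norm_real, Real.norm_eq_abs] at h3
  refine h3.trans ?_
  have h4 : ∑ i, ∑ j, ‖c i‖ * ‖c j‖ * Real.exp (-(T ^ 2 * δ ^ 2 / 2)) =
      (∑ i, ‖c i‖) ^ 2 * Real.exp (-(T ^ 2 * δ ^ 2 / 2)) := by
    rw [sq (∑ i, ‖c i‖), Finset.sum_mul_sum, Finset.sum_mul]
    simp_rw [Finset.sum_mul]
  rw [h4]
  have h5 := sq_sum_le_card_mul_sum_sq (s := Finset.univ) (f := fun i => ‖c i‖)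
  rw [Finset.card_univ] at h5
  calc _ ≤ (Fintype.card ι * ∑ i, ‖c i‖ ^ 2) * Real.exp (-(T ^ 2 * δ ^ 2 / 2)) := by gcongr
    _ = _ := by ring

end Voronin

namespace Voronin
open MeasureTheory Set Filter Topology ProbabilityTheory

/-- Gaussian mean square -/
noncomputable def ms (T : ℝ) (f : ℝ → ℂ) : ENNReal := ∫⁻ t, ENNReal.ofReal (‖f t‖ ^ 2) ∂(gT T)

lemma ms_mono {T : ℝ} {f g : ℝ → ℂ} (h : ∀ t, ‖f t‖ ≤ ‖g t‖) : ms T f ≤ ms T g := by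
  refine lintegral_mono fun t => ENNReal.ofReal_le_ofReal ?_
  gcongr; exact h t

lemma sq_add_le (a b : ℂ) : ‖a + b‖ ^ 2 ≤ 2 * ‖a‖ ^ 2 + 2 * ‖b‖ ^ 2 := by
  have h := norm_add_le a b
  have : ‖a + b‖ ^ 2 ≤ (‖a‖ + ‖b‖) ^ 2 := by gcongr
  nlinarith [sq_nonneg (‖a‖ - ‖b‖)]

lemma sq_sub_le (a b : ℂ) : ‖a - b‖ ^ 2 ≤ 2 * ‖a‖ ^ 2 + 2 * ‖b‖ ^ 2 := by
  have := sq_add_le a (-b)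
  rwa [← sub_eq_add_neg, norm_neg] at this

lemma ms_sub {T : ℝ} {f g : ℝ → ℂ} (hg : Measurable g) :
    ms T (fun t => f t - g t) ≤ 2 * ms T f + 2 * ms T g := by
  unfold ms
  rw [← lintegral_const_mul' 2 _ (by norm_num), ← lintegral_const_mul' 2 _ (by norm_num), ← lintegral_add_right]
  · refine lintegral_mono fun t => ?_
    have h2 : (2 : ENNReal) = ENNReal.ofReal 2 := by simp
    simp only [h2]
    rw [← ENNReal.ofReal_mul (by norm_num), ← ENNReal.ofReal_mul (by norm_num), ← ENNReal.ofReal_add (by positivity) (by positivity)]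
    exact ENNReal.ofReal_le_ofReal (sq_sub_le _ _)
  · fun_prop

lemma gT_lintegral {T : ℝ} (hT : 0 < T) (f : ℝ → ENNReal) (hf : Measurable f) :
    ∫⁻ t, f t ∂(gT T) = ∫⁻ t, ENNReal.ofReal ((Real.sqrt (2 * Real.pi * T ^ 2))⁻¹ * Real.exp (-(t ^ 2 / (2 * T ^ 2)))) * f t := by
  have hv : Real.toNNReal (T ^ 2) ≠ 0 := by
    rw [Ne, Real.toNNReal_eq_zero]; simp; positivity
  rw [gT, gaussianReal_of_var_ne_zero _ hv, lintegral_withDensity_eq_lintegral_mul _ (by fun_prop) hf]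
  refine lintegral_congr fun t => ?_
  simp only [Pi.mul_apply, gaussianPDF, gaussianPDFReal, Real.coe_toNNReal _ (sq_nonneg T), sub_zero, neg_div]

lemma gT_le_volume {T : ℝ} (hT : 0 < T) (f : ℝ → ENNReal) (hf : Measurable f) :
    ∫⁻ t, f t ∂(gT T) ≤ ENNReal.ofReal (1 / T) * ∫⁻ t, f t := by
  rw [gT_lintegral hT f hf, ← lintegral_const_mul _ hf]
  refine lintegral_mono fun t => ?_
  simp only
  gcongr
  have h1 : T ≤ Real.sqrt (2 * Real.pi * T ^ 2) := by
    apply Real.le_sqrt_of_sq_le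
    nlinarith [Real.pi_gt_three, sq_nonneg T]
  have h2 : Real.exp (-(t ^ 2 / (2 * T ^ 2))) ≤ 1 := by
    rw [Real.exp_le_one_iff]; have : 0 ≤ t ^ 2 / (2 * T ^ 2) := by positivity
    linarith
  calc _ ≤ T⁻¹ * 1 := by gcongr
    _ = _ := by simp

lemma gT_weight {T : ℝ} (hT : 0 < T) (f : ℝ → ENNReal) (hf : Measurable f) :
    ∫⁻ t, ENNReal.ofReal (1 + t ^ 2) * f t ∂(gT T) ≤ ENNReal.ofReal (2 + 8 * T ^ 2) * ∫⁻ t, f t ∂(gT (2 * T)) := by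
  rw [gT_lintegral hT _ (by fun_prop), gT_lintegral (by linarith) f hf, ← lintegral_const_mul _ (by fun_prop)]
  refine lintegral_mono fun t => ?_
  simp only
  rw [← mul_assoc, ← mul_assoc, ← ENNReal.ofReal_mul (by positivity), ← ENNReal.ofReal_mul (by positivity)]
  gcongr ENNReal.ofReal ?_ * _
  have e0 : (Real.sqrt (2 * Real.pi * (2 * T) ^ 2))⁻¹ = 2⁻¹ * (Real.sqrt (2 * Real.pi * T ^ 2))⁻¹ := by
    rw [show 2 * Real.pi * (2 * T) ^ 2 = 2 ^ 2 * (2 * Real.pi * T ^ 2) by ring, Real.sqrt_mul (by norm_num) (2 * Real.pi * T ^ 2),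
      Real.sqrt_sq (by norm_num), mul_inv]
  rw [e0]
  have e1 : Real.exp (-(t ^ 2 / (2 * T ^ 2))) = Real.exp (-(t ^ 2 / (2 * (2 * T) ^ 2))) * Real.exp (-(3 * t ^ 2 / (8 * T ^ 2))) := by
    rw [← Real.exp_add]; congr 1; field_simp; ring
  rw [e1]
  set S := (Real.sqrt (2 * Real.pi * T ^ 2))⁻¹
  set E := Real.exp (-(t ^ 2 / (2 * (2 * T) ^ 2)))
  have hS : 0 ≤ S := by positivity
  have hE : 0 ≤ E := by positivity
  set x := 3 * t ^ 2 / (8 * T ^ 2) with hx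
  have hx0 : 0 ≤ x := by positivity
  have ht : t ^ 2 = 8 / 3 * T ^ 2 * x := by rw [hx]; field_simp
  have h3 : x * Real.exp (-x) ≤ 1 := by
    rw [Real.exp_neg]
    have := Real.add_one_le_exp x
    rw [← div_eq_mul_inv, div_le_one (Real.exp_pos _)]; linarith
  have h4 : Real.exp (-x) ≤ 1 := by rw [Real.exp_le_one_iff]; linarith
  have h5 : Real.exp (-x) * (1 + t ^ 2) ≤ (2 + 8 * T ^ 2) * 2⁻¹ := by
    rw [ht]
    have : T ^ 2 * (x * Real.exp (-x)) ≤ T ^ 2 * 1 := by gcongr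
    nlinarith
  calc S * (E * Real.exp (-x)) * (1 + t ^ 2) = S * E * (Real.exp (-x) * (1 + t ^ 2)) := by ring
    _ ≤ S * E * ((2 + 8 * T ^ 2) * 2⁻¹) := by gcongr
    _ = _ := by ring

lemma zG_exp {N : ℝ} (hN : 0 < N) (s0 : ℂ) (t : ℝ) :
    zG N (s0 + I * t) = ∫ u in Ioi (Real.log N), (((Int.fract (Real.exp u) : ℝ) : ℂ) * cexp (-(s0 * u))) * cexp (-(I * t * u)) := by
  have h := integral_comp_exp_Ioi (E := ℂ) (fun y : ℝ => ((Int.fract y : ℝ) : ℂ) * (y : ℂ) ^ (-((s0 + I * t) + 1))) (Real.log N)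
  rw [Real.exp_log hN] at h
  rw [zG, ← h]
  refine integral_congr_ae (Eventually.of_forall fun u => ?_)
  simp only
  rw [Complex.cpow_def_of_ne_zero (by exact_mod_cast (Real.exp_pos u).ne'), ← Complex.ofReal_log (Real.exp_pos u).le, Real.log_exp,
    Complex.real_smul, mul_left_comm, Complex.ofReal_exp, ← Complex.exp_add, mul_assoc, ← Complex.exp_add]
  congr 2; ring

lemma ms_zG {T N σ : ℝ} (hT : 0 < T) (hN : 0 < N) (hσ : 0 < σ) (s0 : ℂ) (hs : s0.re = σ) :
    Measurable (fun t : ℝ => zG N (s0 + I * t)) ∧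
    ms T (fun t => zG N (s0 + I * t)) ≤ ENNReal.ofReal (3 / (T * σ) * N ^ (-2 * σ)) := by
  simp_rw [zG_exp hN s0]
  set g : ℝ → ℂ := fun u => ((Int.fract (Real.exp u) : ℝ) : ℂ) * cexp (-(s0 * u)) with hg
  have hgm : Measurable g := by
    have : Measurable (fun u : ℝ => Int.fract (Real.exp u)) := measurable_fract.comp Real.measurable_exp
    have h2 : Measurable (fun u : ℝ => cexp (-(s0 * u))) := by fun_prop
    exact (Complex.measurable_ofReal.comp this).mul h2
  have hgb : ∀ u, ‖g u‖ ≤ Real.exp (-σ * u) := by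
    intro u
    rw [hg]; simp only [norm_mul, norm_real, Complex.norm_exp, Real.norm_eq_abs]
    rw [abs_of_nonneg (Int.fract_nonneg _)]
    have : (-(s0 * (u:ℂ))).re = -σ * u := by simp [hs]
    rw [this]
    exact mul_le_of_le_one_left (Real.exp_nonneg _) (Int.fract_lt_one _).le
  have hei : IntegrableOn (fun u : ℝ => Real.exp (-σ * u)) (Ioi (Real.log N)) := integrableOn_exp_mul_Ioi (by linarith) _
  have hmeas : StronglyMeasurable (fun t : ℝ => ∫ u in Ioi (Real.log N), g u * cexp (-(I * t * u))) := by
    have h1 : StronglyMeasurable (Function.uncurry fun (t u : ℝ) => g u * cexp (-(I * t * u))) := by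
      apply Measurable.stronglyMeasurable
      have : Continuous fun q : ℝ × ℝ => cexp (-(I * q.1 * q.2)) := by fun_prop
      exact (hgm.comp measurable_snd).mul this.measurable
    exact h1.integral_prod_right
  refine ⟨hmeas.measurable, ?_⟩
  have hb : ∀ t : ℝ, ‖∫ u in Ioi (Real.log N), g u * cexp (-(I * t * u))‖ ≤ ∫ u in Ioi (Real.log N), Real.exp (-σ * u) := by
    intro t
    refine norm_integral_le_of_norm_le hei (Eventually.of_forall fun u => ?_)
    rw [norm_mul, norm_exp_I, mul_one]; exact hgb u
  have hint : Integrable (fun t : ℝ => ‖∫ u in Ioi (Real.log N), g u * cexp (-(I * t * u))‖ ^ 2) (gT T) := by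
    refine (integrable_const ((∫ u in Ioi (Real.log N), Real.exp (-σ * u)) ^ 2)).mono' (hmeas.norm.pow 2).aestronglyMeasurable ?_
    filter_upwards with t
    rw [norm_pow, norm_norm]
    have := hb t
    gcongr
  unfold ms
  rw [← ofReal_integral_eq_lintegral_ofReal hint (Eventually.of_forall fun t => by positivity)]
  refine ENNReal.ofReal_le_ofReal ((gauss_tail hT hσ g hgm fun u _ => hgb u).trans (le_of_eq ?_))
  rw [Real.rpow_def_of_pos hN]
  congr 2; ring

/-- admissible abscissae -/
def Adm (c : ℝ) (s : ℂ) : Prop := 1 / 2 + c ≤ s.re ∧ s.re ≤ 1 - c ∧ |s.im| ≤ 1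

lemma ms_base {c : ℝ} (hc : 0 < c) (hc1 : c ≤ 1) (s0 : ℂ) (hs : Adm c s0) {N : ℕ} (hN : 1 ≤ N) {T : ℝ} (hT : 1 ≤ T) :
    ms T (fun t => riemannZeta (s0 + I * t) - ∑ n ∈ Finset.Icc 1 N, (n:ℂ) ^ (-(s0 + I * t))) ≤
      ENNReal.ofReal (8 / c ^ 2 * (N : ℝ) ^ (1 - 2 * c) / T + 240 * T * (N:ℝ) ^ (-1 - 2 * c)) := by
  obtain ⟨h1, h2, h3⟩ := hs
  have hN0 : (0:ℝ) < N := by exact_mod_cast hN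
  have hN1 : (1:ℝ) ≤ N := by exact_mod_cast hN
  have hre : ∀ t : ℝ, (s0 + I * t).re = s0.re := by intro t; simp
  have him : ∀ t : ℝ, (s0 + I * t).im = s0.im + t := by intro t; simp
  have hne : ∀ t : ℝ, s0 + I * t ≠ 1 := by
    intro t h
    have := congrArg Complex.re h
    rw [hre] at this; simp at this; linarith
  have e : ∀ t : ℝ, riemannZeta (s0 + I * t) - ∑ n ∈ Finset.Icc 1 N, (n:ℂ) ^ (-(s0 + I * t)) =
      (N:ℂ) ^ (1 - (s0 + I * t)) / (s0 + I * t - 1) - (s0 + I * t) * zG N (s0 + I * t) := by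
    intro t
    rw [zeta_eq (by rw [hre]; linarith) (hne t) hN]; ring
  simp_rw [e]
  obtain ⟨hm, hz⟩ := ms_zG (T := 2 * T) (N := N) (σ := s0.re) (by linarith) hN0 (by linarith) s0 rfl
  have hm2 : Measurable (fun t : ℝ => (s0 + I * t) * zG N (s0 + I * t)) := by
    refine Measurable.mul (by fun_prop) hm
  refine (ms_sub hm2).trans ?_
  have hA : ms T (fun t : ℝ => (N:ℂ) ^ (1 - (s0 + I * t)) / (s0 + I * t - 1)) ≤
      ENNReal.ofReal (4 / c ^ 2 * (N : ℝ) ^ (1 - 2 * c) / T) := by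
    have hp : ∀ t : ℝ, ‖(N:ℂ) ^ (1 - (s0 + I * t)) / (s0 + I * t - 1)‖ ^ 2 ≤
        (N : ℝ) ^ (1 - 2 * c) / c ^ 2 * (1 + (t + s0.im) ^ 2)⁻¹ := by
      intro t
      rw [norm_div, div_pow, Complex.norm_natCast_cpow_of_pos (by omega), ← Real.rpow_mul_natCast hN0.le]
      have q1 : (N:ℝ) ^ ((1 - (s0 + I * t)).re * ((2:ℕ):ℝ)) ≤ (N : ℝ) ^ (1 - 2 * c) := by
        apply Real.rpow_le_rpow_of_exponent_le hN1
        rw [sub_re, hre]; simp; linarith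
      have q2 : c ^ 2 * (1 + (t + s0.im) ^ 2) ≤ ‖s0 + I * t - 1‖ ^ 2 := by
        rw [← Complex.normSq_eq_norm_sq, Complex.normSq_apply, sub_re, sub_im, hre, him]
        simp only [one_re, one_im]
        have : c ^ 2 ≤ (1 - s0.re) ^ 2 := by gcongr; linarith
        have : c ^ 2 * (t + s0.im) ^ 2 ≤ 1 * (t + s0.im) ^ 2 := by
          gcongr; nlinarith
        nlinarith
      calc _ ≤ (N : ℝ) ^ (1 - 2 * c) / (c ^ 2 * (1 + (t + s0.im) ^ 2)) := by gcongr
        _ = _ := by field_simp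
    calc ms T (fun t : ℝ => (N:ℂ) ^ (1 - (s0 + I * t)) / (s0 + I * t - 1)) 
        ≤ ∫⁻ t, ENNReal.ofReal ((N : ℝ) ^ (1 - 2 * c) / c ^ 2 * (1 + (t + s0.im) ^ 2)⁻¹) ∂(gT T) :=
          lintegral_mono fun t => ENNReal.ofReal_le_ofReal (hp t)
      _ ≤ ENNReal.ofReal (1 / T) * ∫⁻ t, ENNReal.ofReal ((N : ℝ) ^ (1 - 2 * c) / c ^ 2 * (1 + (t + s0.im) ^ 2)⁻¹) :=
          gT_le_volume (by linarith) _ (by fun_prop)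
      _ = ENNReal.ofReal (1 / T) * ∫⁻ t, ENNReal.ofReal ((N : ℝ) ^ (1 - 2 * c) / c ^ 2 * (1 + t ^ 2)⁻¹) := by
          rw [lintegral_add_right_eq_self (fun t : ℝ => ENNReal.ofReal ((N : ℝ) ^ (1 - 2 * c) / c ^ 2 * (1 + t ^ 2)⁻¹))]
      _ = ENNReal.ofReal (1 / T) * ENNReal.ofReal ((N : ℝ) ^ (1 - 2 * c) / c ^ 2 * Real.pi) := by
          rw [← ofReal_integral_eq_lintegral_ofReal (integrable_inv_one_add_sq.const_mul _)
            (Eventually.of_forall fun t => by simp only [Pi.zero_apply]; positivity), integral_const_mul, integral_univ_inv_one_add_sq]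
      _ ≤ _ := by
          rw [← ENNReal.ofReal_mul (by positivity)]
          refine ENNReal.ofReal_le_ofReal ?_
          have := Real.pi_le_four
          calc 1 / T * ((N : ℝ) ^ (1 - 2 * c) / c ^ 2 * Real.pi) ≤ 1 / T * ((N : ℝ) ^ (1 - 2 * c) / c ^ 2 * 4) := by gcongr
            _ = _ := by field_simp
  have hB : ms T (fun t : ℝ => (s0 + I * t) * zG N (s0 + I * t)) ≤ ENNReal.ofReal (120 * T * (N:ℝ) ^ (-1 - 2 * c)) := by
    have hp : ∀ t : ℝ, ENNReal.ofReal (‖(s0 + I * t) * zG N (s0 + I * t)‖ ^ 2) ≤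
        ENNReal.ofReal 4 * (ENNReal.ofReal (1 + t ^ 2) * ENNReal.ofReal (‖zG N (s0 + I * t)‖ ^ 2)) := by
      intro t
      rw [← ENNReal.ofReal_mul (by positivity), ← ENNReal.ofReal_mul (by positivity)]
      refine ENNReal.ofReal_le_ofReal ?_
      rw [norm_mul, mul_pow, ← mul_assoc]
      gcongr
      rw [← Complex.normSq_eq_norm_sq, Complex.normSq_apply, hre, him]
      have := abs_le.1 h3
      nlinarith [sq_nonneg (s0.im - t)]
    calc ms T (fun t : ℝ => (s0 + I * t) * zG N (s0 + I * t)) 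
        ≤ ∫⁻ t, ENNReal.ofReal 4 * (ENNReal.ofReal (1 + t ^ 2) * ENNReal.ofReal (‖zG N (s0 + I * t)‖ ^ 2)) ∂(gT T) :=
          lintegral_mono hp
      _ = ENNReal.ofReal 4 * ∫⁻ t, (ENNReal.ofReal (1 + t ^ 2) * ENNReal.ofReal (‖zG N (s0 + I * t)‖ ^ 2)) ∂(gT T) :=
          lintegral_const_mul' _ _ ENNReal.ofReal_ne_top
      _ ≤ ENNReal.ofReal 4 * (ENNReal.ofReal (2 + 8 * T ^ 2) * ms (2 * T) (fun t => zG N (s0 + I * t))) := by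
          gcongr
          exact gT_weight (by linarith) _ (by fun_prop)
      _ ≤ ENNReal.ofReal 4 * (ENNReal.ofReal (2 + 8 * T ^ 2) * ENNReal.ofReal (3 / ((2 * T) * s0.re) * (N:ℝ) ^ (-2 * s0.re))) := by gcongr
      _ ≤ _ := by
          rw [← ENNReal.ofReal_mul (by positivity), ← ENNReal.ofReal_mul (by positivity)]
          refine ENNReal.ofReal_le_ofReal ?_
          have q1 : (N:ℝ) ^ (-2 * s0.re) ≤ (N : ℝ) ^ (-1 - 2 * c) := by
            apply Real.rpow_le_rpow_of_exponent_le hN1; linarith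
          have q2 : 3 / ((2 * T) * s0.re) ≤ 3 / T := by
            apply div_le_div_of_nonneg_left (by norm_num) (by linarith)
            nlinarith
          have q3 : 2 + 8 * T ^ 2 ≤ 10 * T ^ 2 := by nlinarith
          have q4 : 0 < s0.re := by linarith
          calc 4 * ((2 + 8 * T ^ 2) * (3 / ((2 * T) * s0.re) * (N:ℝ) ^ (-2 * s0.re)))
              ≤ 4 * ((10 * T ^ 2) * (3 / T * (N : ℝ) ^ (-1 - 2 * c))) := by gcongr
            _ = _ := by field_simp; norm_num
  calc _ ≤ 2 * ENNReal.ofReal (4 / c ^ 2 * (N : ℝ) ^ (1 - 2 * c) / T) + 2 * ENNReal.ofReal (120 * T * (N:ℝ) ^ (-1 - 2 * c)) := by gcongr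
    _ = _ := by
      rw [show (2:ENNReal) = ENNReal.ofReal 2 by simp, ← ENNReal.ofReal_mul (by norm_num), ← ENNReal.ofReal_mul (by norm_num),
        ← ENNReal.ofReal_add (by positivity) (by positivity)]
      congr 1; ring

end Voronin

namespace Voronin
open MeasureTheory Set Filter Topology ProbabilityTheory

/-- zeta with the Euler factors in `S` removed -/
noncomputable def zS (S : Finset ℕ) (s : ℂ) : ℂ := riemannZeta s * ∏ p ∈ S, (1 - (p:ℂ) ^ (-s))

/-- partial sum over integers coprime to `S` -/
noncomputable def RS (S : Finset ℕ) (N : ℕ) (s : ℂ) : ℂ :=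
  ∑ n ∈ (Finset.Icc 1 N).filter (fun n => ∀ p ∈ S, ¬ p ∣ n), (n:ℂ) ^ (-s)

lemma RS_insert {S : Finset ℕ} (hS : ∀ p ∈ S, p.Prime) {p : ℕ} (hp : p.Prime) (hpS : p ∉ S) (N : ℕ) (s : ℂ) :
    RS (insert p S) N s = RS S N s - (p:ℂ) ^ (-s) * RS S (N / p) s := by
  unfold RS
  rw [← Finset.sum_filter_add_sum_filter_not ((Finset.Icc 1 N).filter (fun n => ∀ q ∈ S, ¬ q ∣ n)) (fun n => ¬ p ∣ n)]
  have e1 : (Finset.Icc 1 N).filter (fun n => ∀ q ∈ insert p S, ¬ q ∣ n) =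
      ((Finset.Icc 1 N).filter (fun n => ∀ q ∈ S, ¬ q ∣ n)).filter (fun n => ¬ p ∣ n) := by
    ext n; simp only [Finset.mem_filter, Finset.mem_insert, forall_eq_or_imp]; tauto
  rw [e1, eq_sub_iff_add_eq, add_right_inj, Finset.mul_sum]
  refine Finset.sum_bij (fun m _ => p * m) ?_ ?_ ?_ ?_
  · intro m hm
    simp only [Finset.mem_filter, Finset.mem_Icc] at hm ⊢
    refine ⟨⟨⟨Nat.mul_pos hp.pos hm.1.1, ?_⟩, ?_⟩, by simp⟩
    · rw [mul_comm]; exact (Nat.le_div_iff_mul_le hp.pos).1 hm.1.2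
    · intro q hq h
      rcases (hS q hq).dvd_mul.1 h with h | h
      · have := (Nat.prime_dvd_prime_iff_eq (hS q hq) hp).1 h
        exact hpS (this ▸ hq)
      · exact hm.2 q hq h
  · intro a _ b _ h
    exact Nat.eq_of_mul_eq_mul_left hp.pos h
  · intro n hn
    simp only [Finset.mem_filter, Finset.mem_Icc, not_not] at hn
    obtain ⟨⟨⟨h1, h2⟩, h3⟩, m, rfl⟩ := hn
    refine ⟨m, ?_, rfl⟩
    simp only [Finset.mem_filter, Finset.mem_Icc]
    refine ⟨⟨Nat.pos_of_mul_pos_left h1, ?_⟩, fun q hq h => h3 q hq (h.mul_left p)⟩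
    rw [Nat.le_div_iff_mul_le hp.pos, mul_comm]; exact h2
  · intro m hm
    rw [Nat.cast_mul, Complex.natCast_mul_natCast_cpow]

lemma zS_insert {S : Finset ℕ} {p : ℕ} (hpS : p ∉ S) (s : ℂ) :
    zS (insert p S) s = zS S s - (p:ℂ) ^ (-s) * zS S s := by
  unfold zS; rw [Finset.prod_insert hpS]; ring

lemma natpow_cont {n : ℕ} (hn : n ≠ 0) : Continuous fun s : ℂ => (n:ℂ) ^ (-s) := by
  have : NeZero (n:ℂ) := ⟨by exact_mod_cast hn⟩
  have h : Continuous fun s : ℂ => (n:ℂ) ^ s := continuous_const_cpow _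
  exact h.comp continuous_neg

lemma RS_cont (S : Finset ℕ) (N : ℕ) : Continuous (RS S N) := by
  unfold RS
  refine continuous_finsetSum _ fun n hn => natpow_cont ?_
  simp only [Finset.mem_filter, Finset.mem_Icc] at hn; omega

lemma zS_contAt {S : Finset ℕ} (hS : ∀ p ∈ S, p.Prime) {s : ℂ} (hs : s ≠ 1) : ContinuousAt (zS S) s := by
  unfold zS
  refine (differentiableAt_riemannZeta hs).continuousAt.mul ?_
  refine Continuous.continuousAt ?_
  exact continuous_finsetProd _ fun p hp => continuous_const.sub (natpow_cont (hS p hp).ne_zero)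

lemma adm_ne {c : ℝ} (hc : 0 < c) {s0 : ℂ} (hs : Adm c s0) (t : ℝ) : s0 + I * t ≠ 1 := by
  intro h
  have := congrArg Complex.re h
  have h2 := hs.2.1
  simp at this; linarith

lemma zS_line_cont {S : Finset ℕ} (hS : ∀ p ∈ S, p.Prime) {c : ℝ} (hc : 0 < c) {s0 : ℂ} (hs : Adm c s0) :
    Continuous fun t : ℝ => zS S (s0 + I * t) := by
  rw [continuous_iff_continuousAt]
  intro t
  have h1 : ContinuousAt (fun t : ℝ => s0 + I * t) t := by fun_prop
  exact ContinuousAt.comp (f := fun t : ℝ => s0 + I * (t:ℂ)) (g := zS S) (zS_contAt hS (adm_ne hc hs t)) h1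

lemma ms_S {c : ℝ} (hc : 0 < c) (hc1 : c ≤ 1) (S : Finset ℕ) : (∀ p ∈ S, p.Prime) →
    ∀ A : ℝ, 1 ≤ A → ∃ C : ℝ, 0 ≤ C ∧ ∃ N0 : ℕ, 1 ≤ N0 ∧ ∀ N : ℕ, N0 ≤ N → ∀ T : ℝ, N ≤ T → T ≤ A * (N:ℝ) ^ (1 + c) → ∀ s0 : ℂ, Adm c s0 →
      ms T (fun t => zS S (s0 + I * t) - RS S N (s0 + I * t)) ≤ ENNReal.ofReal (C * (N:ℝ) ^ (-c)) := by
  induction S using Finset.induction_on with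
  | empty =>
    intro _ A hA
    refine ⟨8 / c ^ 2 + 240 * A, by positivity, 1, le_rfl, fun N hN T hT1 hT2 s0 hs => ?_⟩
    have hN1 : (1:ℝ) ≤ N := by exact_mod_cast hN
    have hN0 : (0:ℝ) < N := by linarith
    have h := ms_base hc hc1 s0 hs hN (T := T) (by linarith)
    simp only [zS, RS, Finset.prod_empty, mul_one, Finset.notMem_empty, false_imp_iff, implies_true, Finset.filter_true]
    refine h.trans (ENNReal.ofReal_le_ofReal ?_)
    have e1 : (N:ℝ) ^ (1 - 2 * c) ≤ N * (N:ℝ) ^ (-c) := by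
      rw [show (N:ℝ) * (N:ℝ) ^ (-c) = (N:ℝ) ^ (1 + -c) by rw [Real.rpow_add hN0, Real.rpow_one]]
      exact Real.rpow_le_rpow_of_exponent_le hN1 (by linarith)
    have e2 : (N:ℝ) ^ (1 + c) * (N:ℝ) ^ (-1 - 2 * c) = (N:ℝ) ^ (-c) := by
      rw [← Real.rpow_add hN0]; congr 1; ring
    have hp : 0 ≤ (N:ℝ) ^ (-c) := by positivity
    rw [add_mul]
    set X := (N:ℝ) ^ (-c)
    refine add_le_add ?_ ?_
    · rw [div_le_iff₀ (by linarith)]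
      calc _ ≤ 8 / c ^ 2 * (N * X) := by gcongr
        _ = 8 / c ^ 2 * X * N := by ring
        _ ≤ 8 / c ^ 2 * X * T := by gcongr
    · calc _ ≤ 240 * (A * (N:ℝ) ^ (1 + c)) * (N:ℝ) ^ (-1 - 2 * c) := by gcongr
        _ = 240 * A * ((N:ℝ) ^ (1 + c) * (N:ℝ) ^ (-1 - 2 * c)) := by ring
        _ = 240 * A * X := by rw [e2]
  | insert p S hpS ih =>
    intro hS A hA
    have hp : p.Prime := hS p (Finset.mem_insert_self _ _)
    have hS' : ∀ q ∈ S, q.Prime := fun q hq => hS q (Finset.mem_insert_of_mem hq)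
    have hp1 : (1:ℝ) ≤ p := by exact_mod_cast hp.one_le
    obtain ⟨C1, hC1, N1, hN1, H1⟩ := ih hS' A hA
    obtain ⟨C2, hC2, N2, hN2, H2⟩ := ih hS' (A * (2 * p) ^ (1 + c)) (one_le_mul_of_one_le_of_one_le hA (Real.one_le_rpow (by linarith) (by linarith)))
    refine ⟨2 * C1 + 2 * (C2 * (2 * p) ^ c), by positivity, N1 + p * N2, by omega, fun N hN T hT1 hT2 s0 hs => ?_⟩
    have hN' : N2 ≤ N / p := by
      rw [Nat.le_div_iff_mul_le hp.pos, mul_comm]; omega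
    have hNN : (N:ℝ) ≤ 2 * p * ((N / p : ℕ) : ℝ) := by
      have h1 : N < p * (N / p + 1) := by
        rw [mul_comm]; exact Nat.lt_mul_of_div_lt (Nat.lt_succ_self _) hp.pos
      have h2 : N ≤ 2 * p * (N / p) := by
        have : 1 ≤ N / p := hN2.trans hN'
        nlinarith
      exact_mod_cast h2
    have hNN2 : ((N / p : ℕ) : ℝ) ≤ N := by exact_mod_cast Nat.div_le_self N p
    have hNpos : (0:ℝ) < N := by
      have : 0 < N := by omega
      exact_mod_cast this
    have a1 := H1 N (by omega) T hT1 hT2 s0 hs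
    have a2 := H2 (N / p) hN' T (by linarith) (hT2.trans (by
      rw [mul_assoc, ← Real.mul_rpow (by positivity) (by positivity)]; gcongr)) s0 hs
    have e : ∀ t : ℝ, zS (insert p S) (s0 + I * t) - RS (insert p S) N (s0 + I * t) =
        (zS S (s0 + I * t) - RS S N (s0 + I * t)) -
          (p:ℂ) ^ (-(s0 + I * t)) * (zS S (s0 + I * t) - RS S (N / p) (s0 + I * t)) := by
      intro t; rw [zS_insert hpS, RS_insert hS' hp hpS]; ring
    simp_rw [e]
    have hline : Continuous fun t : ℝ => s0 + I * t := by fun_prop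
    have hmeas : Measurable (fun t : ℝ => (p:ℂ) ^ (-(s0 + I * t)) * (zS S (s0 + I * t) - RS S (N / p) (s0 + I * t))) := by
      refine Continuous.measurable ?_
      exact ((natpow_cont hp.ne_zero).comp hline).mul ((zS_line_cont hS' hc hs).sub ((RS_cont S _).comp hline))
    refine (ms_sub hmeas).trans ?_
    have a3 : ms T (fun t : ℝ => (p:ℂ) ^ (-(s0 + I * t)) * (zS S (s0 + I * t) - RS S (N / p) (s0 + I * t))) ≤
        ENNReal.ofReal (C2 * (2 * p) ^ c * (N:ℝ) ^ (-c)) := by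
      refine (ms_mono (g := fun t : ℝ => zS S (s0 + I * t) - RS S (N / p) (s0 + I * t)) fun t => ?_).trans (a2.trans (ENNReal.ofReal_le_ofReal ?_))
      · rw [norm_mul, Complex.norm_natCast_cpow_of_pos hp.pos]
        refine mul_le_of_le_one_left (norm_nonneg _) (Real.rpow_le_one_of_one_le_of_nonpos hp1 ?_)
        have := hs.1
        simp; linarith
      · rw [mul_assoc]
        gcongr
        have : (N:ℝ) / (2 * p) ≤ ((N / p : ℕ) : ℝ) := by
          rw [div_le_iff₀ (by positivity)]; linarith
        calc ((N / p : ℕ) : ℝ) ^ (-c) ≤ ((N:ℝ) / (2 * p)) ^ (-c) :=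
              Real.rpow_le_rpow_of_nonpos (by positivity) this (by linarith)
          _ = (2 * (p:ℝ)) ^ c * (N:ℝ) ^ (-c) := by
              rw [Real.div_rpow (by positivity) (by positivity), Real.rpow_neg (x := 2 * (p:ℝ)) (by positivity)]
              field_simp
    calc _ ≤ 2 * ENNReal.ofReal (C1 * (N:ℝ) ^ (-c)) + 2 * ENNReal.ofReal (C2 * (2 * p) ^ c * (N:ℝ) ^ (-c)) := by gcongr
      _ = _ := by
        rw [show (2:ENNReal) = ENNReal.ofReal 2 by simp, ← ENNReal.ofReal_mul (by norm_num), ← ENNReal.ofReal_mul (by norm_num),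
          ← ENNReal.ofReal_add (by positivity) (by positivity)]
        congr 1; ring

end Voronin

namespace Voronin
open MeasureTheory Set Filter Topology ProbabilityTheory

lemma sup_of_L2 {r R : ℝ} (hr : 0 ≤ r) (hrR : r < R) (f : ℂ → ℂ) (hf : DiffContOnCl ℂ f (ball 0 R)) {s : ℂ} (hs : ‖s‖ ≤ r) :
    ‖f s‖ ^ 2 ≤ R / (R - r) * ∫ θ in (0:ℝ)..2 * Real.pi, ‖f (circleMap 0 R θ)‖ ^ 2 := by
  have hR : 0 < R := by linarith
  have hf2 : DiffContOnCl ℂ (fun z => f z * f z) (ball 0 R) := hf.smul hf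
  have hcc2 := hf2.continuousOn
  rw [closure_ball _ hR.ne'] at hcc2
  have h := two_pi_I_inv_smul_circleIntegral_sub_inv_smul_of_differentiable_on_off_countable
    (c := 0) (R := R) (w := s) (f := fun z => f z * f z) countable_empty (by simp; linarith) hcc2
    (fun x hx => hf2.differentiableAt isOpen_ball hx.1)
  rw [sq, ← norm_mul]
  rw [← h, norm_smul]
  have h1 : ‖(2 * (Real.pi:ℂ) * I)⁻¹‖ ≤ 1 := by
    rw [norm_inv]
    simp only [norm_mul, norm_real, norm_I, Real.norm_eq_abs, abs_of_pos Real.pi_pos]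
    simp
    have := Real.pi_gt_three
    rw [← mul_inv]
    apply inv_le_one_of_one_le₀; linarith
  have hc : ContinuousOn f (closedBall 0 R) := by
    have := hf.continuousOn
    rwa [closure_ball _ hR.ne'] at this
  have hcc : Continuous fun θ : ℝ => f (circleMap 0 R θ) :=
    hc.comp_continuous (continuous_circleMap 0 R) fun θ => circleMap_mem_closedBall 0 hR.le θ
  have h2 : ‖∮ z in C(0, R), (z - s)⁻¹ • (f z * f z)‖ ≤ ∫ θ in (0:ℝ)..2 * Real.pi, R / (R - r) * ‖f (circleMap 0 R θ)‖ ^ 2 := by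
    rw [circleIntegral]
    refine intervalIntegral.norm_integral_le_of_norm_le (by positivity) (Eventually.of_forall fun θ _ => ?_) ?_
    · rw [deriv_circleMap]
      simp only [norm_smul, norm_mul, norm_I, norm_circleMap_zero, abs_of_pos hR, norm_inv, mul_one]
      have : R - r ≤ ‖circleMap 0 R θ - s‖ := by
        have := norm_sub_norm_le (circleMap 0 R θ) s
        rw [norm_circleMap_zero, abs_of_pos hR] at this; linarith
      have h3 : 0 < R - r := by linarith
      calc R * (‖circleMap 0 R θ - s‖⁻¹ * (‖f (circleMap 0 R θ)‖ * ‖f (circleMap 0 R θ)‖))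
          ≤ R * ((R - r)⁻¹ * (‖f (circleMap 0 R θ)‖ * ‖f (circleMap 0 R θ)‖)) := by gcongr
        _ = _ := by ring
    · exact (continuous_const.mul (hcc.norm.pow 2)).intervalIntegrable _ _
  rw [intervalIntegral.integral_const_mul] at h2
  calc _ ≤ 1 * _ := mul_le_mul h1 h2 (norm_nonneg _) zero_le_one
    _ = _ := one_mul _

lemma log_sep {m n : ℕ} (X : ℝ) (hm : 1 ≤ m) (hn : 1 ≤ n) (hmX : m ≤ X) (hnX : n ≤ X) (h : m ≠ n) :
    1 / X ≤ |Real.log m - Real.log n| := by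
  wlog hlt : n < m generalizing m n
  · rw [abs_sub_comm]
    exact this hn hm hnX hmX h.symm (by omega)
  have h1 : (0:ℝ) < m := by exact_mod_cast hm
  have h2 : (0:ℝ) < n := by exact_mod_cast hn
  have h3 : (n:ℝ) + 1 ≤ m := by exact_mod_cast hlt
  refine le_trans ?_ (le_abs_self _)
  rw [← Real.log_div h1.ne' h2.ne']
  have := Real.one_sub_inv_le_log_of_pos (div_pos h1 h2)
  refine le_trans ?_ this
  rw [inv_div, le_sub_iff_add_le]
  calc 1 / X + n / m ≤ 1 / m + n / m := by gcongr
    _ ≤ 1 := by rw [← add_div, div_le_one h1]; linarith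

lemma dir_ms {ι : Type*} [Fintype ι] (c : ι → ℂ) (m : ι → ℕ) (hm : Function.Injective m) (X T ε : ℝ)
    (h1 : ∀ i, 1 ≤ m i) (hX : ∀ i, m i ≤ X) (hε : Fintype.card ι * Real.exp (-(T ^ 2 * (1 / X) ^ 2 / 2)) ≤ ε) :
    ms T (fun t => ∑ i, c i * (m i : ℂ) ^ (-(I * t))) ≤ ENNReal.ofReal ((1 + ε) * ∑ i, ‖c i‖ ^ 2) ∧
    ENNReal.ofReal ((1 - ε) * ∑ i, ‖c i‖ ^ 2) ≤ ms T (fun t => ∑ i, c i * (m i : ℂ) ^ (-(I * t))) := by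
  classical
  rcases isEmpty_or_nonempty ι with he | ⟨⟨i0⟩⟩
  · simp [ms]
  have hX0 : 0 ≤ X := by
    have := hX i0
    have := (m i0).cast_nonneg (α := ℝ)
    linarith
  have e : ∀ t : ℝ, ∑ i, c i * (m i : ℂ) ^ (-(I * t)) = ∑ i, c i * cexp (-(I * t * (Real.log (m i) : ℝ))) := by
    intro t
    refine Finset.sum_congr rfl fun i _ => ?_
    have : (m i : ℂ) ≠ 0 := by
      have := h1 i
      exact_mod_cast (by omega : m i ≠ 0)
    rw [Complex.cpow_def_of_ne_zero this, Complex.natCast_log]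
    congr 2; ring
  simp_rw [e]
  have h := gauss_finite T (1 / X) (by positivity) c (fun i => Real.log (m i)) (fun i j hij =>
    log_sep X (h1 i) (h1 j) (hX i) (hX j) (fun q => hij (hm q)))
  have hcont : Continuous fun t : ℝ => ∑ i, c i * cexp (-(I * t * (Real.log (m i) : ℝ))) := by fun_prop
  have hint : Integrable (fun t : ℝ => ‖∑ i, c i * cexp (-(I * t * (Real.log (m i) : ℝ)))‖ ^ 2) (gT T) := by
    refine (integrable_const ((∑ i, ‖c i‖) ^ 2)).mono' (hcont.norm.pow 2).aestronglyMeasurable ?_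
    filter_upwards with t
    rw [norm_pow, norm_norm]
    have : ‖∑ i, c i * cexp (-(I * t * (Real.log (m i) : ℝ)))‖ ≤ ∑ i, ‖c i‖ := by
      refine (norm_sum_le _ _).trans (Finset.sum_le_sum fun i _ => ?_)
      rw [norm_mul, norm_exp_I, mul_one]
    gcongr
  have hS : 0 ≤ ∑ i, ‖c i‖ ^ 2 := by positivity
  have h' := abs_le.1 (h.trans (mul_le_mul_of_nonneg_right hε hS))
  unfold ms
  rw [← ofReal_integral_eq_lintegral_ofReal hint (Eventually.of_forall fun t => by positivity)]
  constructor
  · refine ENNReal.ofReal_le_ofReal ?_; linarith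
  · refine ENNReal.ofReal_le_ofReal ?_; linarith

/-- the resonating kernel -/
noncomputable def kap (k : ℕ) (b : ℕ → ℂ) (S : Finset ℕ) (t : ℝ) : ℂ :=
  ∏ p ∈ S, ∑ e ∈ Finset.range k, (b p * (p:ℂ) ^ (-(I * t))) ^ e

lemma norm_nat_I {n : ℕ} (hn : 0 < n) (t : ℝ) : ‖(n:ℂ) ^ (-(I * (t:ℂ)))‖ = 1 := by
  rw [Complex.norm_natCast_cpow_of_pos hn]; simp

lemma kap_norm {k : ℕ} {b : ℕ → ℂ} {S : Finset ℕ} (hS : ∀ p ∈ S, p.Prime) (hb : ∀ p, ‖b p‖ = 1) (t : ℝ) :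
    ‖kap k b S t‖ ≤ (k:ℝ) ^ S.card := by
  unfold kap
  rw [norm_prod]
  rw [← Finset.prod_const]
  refine Finset.prod_le_prod (fun _ _ => norm_nonneg _) fun p hp => ?_
  refine (norm_sum_le _ _).trans ?_
  calc _ ≤ ∑ e ∈ Finset.range k, (1:ℝ) := by
        refine Finset.sum_le_sum fun e _ => ?_
        rw [norm_pow, norm_mul, hb, norm_nat_I (hS p hp).pos]; simp
    _ = k := by simp

lemma kap_cont {k : ℕ} {b : ℕ → ℂ} {S : Finset ℕ} (hS : ∀ p ∈ S, p.Prime) : Continuous (kap k b S) := by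
  unfold kap
  refine continuous_finsetProd _ fun p hp => continuous_finsetSum _ fun e _ => ?_
  have : Continuous fun t : ℝ => (p:ℂ) ^ (-(I * (t:ℂ))) := 
    (natpow_cont (hS p hp).ne_zero).comp (by fun_prop : Continuous fun t : ℝ => I * (t:ℂ))
  fun_prop

lemma kap_expand (k : ℕ) (b : ℕ → ℂ) (hb : ∀ p, ‖b p‖ = 1) (S : Finset ℕ) : (∀ p ∈ S, p.Prime) →
    ∃ (ι : Type) (_ : Fintype ι) (m : ι → ℕ) (β : ι → ℂ), Function.Injective m ∧ (∀ i, 1 ≤ m i) ∧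
      (∀ i, ∀ q, q.Prime → q ∣ m i → q ∈ S) ∧ (∀ i, ‖β i‖ = 1) ∧ Fintype.card ι = k ^ S.card ∧
      ∀ t : ℝ, kap k b S t = ∑ i, β i * (m i : ℂ) ^ (-(I * t)) := by
  induction S using Finset.induction_on with
  | empty =>
    intro _
    refine ⟨Unit, inferInstance, fun _ => 1, fun _ => 1, fun _ _ _ => rfl, fun _ => le_rfl, ?_, by simp, by simp, ?_⟩
    · intro i q hq h
      exact absurd (Nat.dvd_one.1 h) hq.one_lt.ne'
    · intro t; simp [kap]
  | insert p S hpS ih =>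
    intro hS
    have hp : p.Prime := hS p (Finset.mem_insert_self _ _)
    have hS' : ∀ q ∈ S, q.Prime := fun q hq => hS q (Finset.mem_insert_of_mem hq)
    obtain ⟨ι, hι, m, β, h1, h2, h3, h4, h5, h6⟩ := ih hS'
    have hpm : ∀ i, ¬ p ∣ m i := fun i h => hpS (h3 i p hp h)
    refine ⟨Fin k × ι, inferInstance, fun x => p ^ (x.1 : ℕ) * m x.2, fun x => (b p) ^ (x.1 : ℕ) * β x.2, ?_, ?_, ?_, ?_, ?_, ?_⟩
    · rintro ⟨e, i⟩ ⟨e', i'⟩ h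
      simp only at h
      have hm0 : ∀ i, m i ≠ 0 := fun i => by have := h2 i; omega
      have hf := congrArg (fun n => n.factorization p) h
      simp only [Nat.factorization_mul (pow_ne_zero _ hp.ne_zero) (hm0 _), Finsupp.add_apply, hp.factorization_pow,
        Finsupp.single_eq_same, Nat.factorization_eq_zero_of_not_dvd (hpm _), add_zero] at hf
      have he : e = e' := Fin.ext hf
      subst he
      have := Nat.eq_of_mul_eq_mul_left (pow_pos hp.pos _) h
      rw [h1 this]
    · rintro ⟨e, i⟩
      exact Nat.mul_pos (pow_pos hp.pos _) (h2 i)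
    · rintro ⟨e, i⟩ q hq h
      rcases hq.dvd_mul.1 h with h | h
      · have := (Nat.prime_dvd_prime_iff_eq hq hp).1 (hq.dvd_of_dvd_pow h)
        exact this ▸ Finset.mem_insert_self _ _
      · exact Finset.mem_insert_of_mem (h3 i q hq h)
    · rintro ⟨e, i⟩
      simp [hb, h4]
    · simp [h5, Finset.card_insert_of_notMem hpS, pow_succ, mul_comm]
    · intro t
      have : kap k b (insert p S) t = (∑ e ∈ Finset.range k, (b p * (p:ℂ) ^ (-(I * t))) ^ e) * kap k b S t := by
        unfold kap; rw [Finset.prod_insert hpS]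
      rw [this, h6, Fintype.sum_prod_type, ← Fin.sum_univ_eq_sum_range, Finset.sum_mul_sum]
      refine Finset.sum_congr rfl fun e _ => Finset.sum_congr rfl fun i _ => ?_
      simp only
      rw [Nat.cast_mul, Complex.natCast_mul_natCast_cpow, Nat.cast_pow, mul_pow]
      rw [show ((p:ℂ) ^ (e:ℕ)) ^ (-(I * (t:ℂ))) = ((p:ℂ) ^ (-(I * (t:ℂ)))) ^ (e:ℕ) by
        rw [← Complex.natCast_cpow_natCast_mul, ← Complex.cpow_nat_mul, mul_comm]]
      ring

end Voronin

namespace Voronin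
open MeasureTheory Set Filter Topology ProbabilityTheory

lemma kap_ms (k : ℕ) (b : ℕ → ℂ) (hb : ∀ p, ‖b p‖ = 1) (S : Finset ℕ) (hS : ∀ p ∈ S, p.Prime) :
    ∀ᶠ T : ℝ in atTop, ENNReal.ofReal (1 / 2 * (k:ℝ) ^ S.card) ≤ ms T (kap k b S) ∧
      ms T (kap k b S) ≤ ENNReal.ofReal (3 / 2 * (k:ℝ) ^ S.card) := by
  obtain ⟨ι, hι, m, β, h1, h2, h3, h4, h5, h6⟩ := kap_expand k b hb S hS
  set X : ℝ := 1 + ∑ i, (m i : ℝ) with hX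
  have hX0 : 0 < X := by positivity
  have hmX : ∀ i, (m i : ℝ) ≤ X := by
    intro i
    have := Finset.single_le_sum (f := fun i => (m i : ℝ)) (fun _ _ => by positivity) (Finset.mem_univ i)
    linarith
  have ht : Tendsto (fun T : ℝ => (Fintype.card ι : ℝ) * Real.exp (-(T ^ 2 * (1 / X) ^ 2 / 2))) atTop (𝓝 0) := by
    rw [← mul_zero ((Fintype.card ι : ℝ))]
    refine Tendsto.const_mul _ (Real.tendsto_exp_atBot.comp ?_)
    rw [tendsto_neg_atBot_iff]
    refine Tendsto.atTop_div_const (by norm_num) ?_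
    exact (tendsto_pow_atTop (by norm_num)).atTop_mul_const (by positivity)
  have hs : ∑ i, ‖β i‖ ^ 2 = (k:ℝ) ^ S.card := by
    simp only [h4, one_pow, Finset.sum_const, Finset.card_univ, h5]; simp
  filter_upwards [ht.eventually (ge_mem_nhds (by norm_num : (0:ℝ) < 1 / 2))] with T hT
  have := dir_ms β m h1 X T (1 / 2) h2 hmX hT
  rw [hs] at this
  have e : kap k b S = fun t : ℝ => ∑ i, β i * (m i : ℂ) ^ (-(I * t)) := funext h6
  rw [e]
  constructor
  · convert this.2 using 3; norm_num
  · convert this.1 using 3; norm_num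

lemma coprime_inj {S : Finset ℕ} {a b m n : ℕ} (ha : ∀ q, q.Prime → q ∣ a → q ∈ S) (hb : ∀ q, q.Prime → q ∣ b → q ∈ S)
    (hm : ∀ p ∈ S, ¬ p ∣ m) (hn : ∀ p ∈ S, ¬ p ∣ n) (hpos : 0 < a) (h : a * m = b * n) : a = b ∧ m = n := by
  have c1 : Nat.Coprime a n := Nat.coprime_of_dvd fun q hq h1 h2 => hn q (ha q hq h1) h2
  have c2 : Nat.Coprime b m := Nat.coprime_of_dvd fun q hq h1 h2 => hm q (hb q hq h1) h2
  have d1 : a ∣ b := c1.dvd_of_dvd_mul_right (h ▸ dvd_mul_right a m)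
  have d2 : b ∣ a := c2.dvd_of_dvd_mul_right (h.symm ▸ dvd_mul_right b n)
  have := Nat.dvd_antisymm d1 d2
  subst this
  exact ⟨rfl, Nat.eq_of_mul_eq_mul_left hpos h⟩

lemma exp_small {c a L : ℝ} (hc : 0 < c) (ha : 0 < a) :
    ∀ᶠ N : ℕ in atTop, L * N * Real.exp (-a * (N:ℝ) ^ (2 * c)) ≤ 1 / 2 := by
  have h1 : Tendsto (fun N : ℕ => (N:ℝ) ^ (2 * c)) atTop atTop :=
    (tendsto_rpow_atTop (by linarith)).comp tendsto_natCast_atTop_atTop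
  have h2 := (tendsto_rpow_mul_exp_neg_mul_atTop_nhds_zero (1 / (2 * c)) a ha).comp h1
  have h3 := h2.const_mul L
  rw [mul_zero] at h3
  filter_upwards [h3.eventually (ge_mem_nhds (by norm_num : (0:ℝ) < 1 / 2))] with N hN
  simp only [Function.comp] at hN
  rw [← Real.rpow_mul N.cast_nonneg, mul_one_div_cancel (by linarith), Real.rpow_one] at hN
  rw [mul_assoc]; exact hN

lemma kap_RS {c : ℝ} (hc : 0 < c) (k : ℕ) (b : ℕ → ℂ) (hb : ∀ p, ‖b p‖ = 1) (S : Finset ℕ) (hS : ∀ p ∈ S, p.Prime)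
    (M : ℕ) (hM : ∀ p : ℕ, p.Prime → p ≤ M → p ∈ S) (τ : ℝ)
    (hτ : ∀ F : Finset ℕ, (∀ n ∈ F, M < n) → ∑ n ∈ F, (n:ℝ) ^ (-1 - 2 * c) ≤ τ) :
    ∀ᶠ N : ℕ in atTop, ∀ s0 : ℂ, Adm c s0 →
      ms ((N:ℝ) ^ (1 + c)) (fun t => kap k b S t * (RS S N (s0 + I * t) - 1)) ≤ ENNReal.ofReal (3 / 2 * ((k:ℝ) ^ S.card * τ)) := by
  obtain ⟨ι, hι, m, β, h1, h2, h3, h4, h5, h6⟩ := kap_expand k b hb S hS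
  set X : ℝ := 1 + ∑ i, (m i : ℝ) with hX
  have hX0 : 0 < X := by positivity
  have hmX : ∀ i, (m i : ℝ) ≤ X := by
    intro i
    have := Finset.single_le_sum (f := fun i => (m i : ℝ)) (fun _ _ => by positivity) (Finset.mem_univ i)
    linarith
  filter_upwards [exp_small (L := (k:ℝ) ^ S.card) hc (show 0 < 1 / (2 * X ^ 2) by positivity), eventually_ge_atTop 1] with N hN hN1 s0 hs
  have hNr : (1:ℝ) ≤ N := by exact_mod_cast hN1
  set F := ((Finset.Icc 1 N).filter (fun n => ∀ p ∈ S, ¬ p ∣ n)).erase 1 with hF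
  have hFmem : ∀ n ∈ F, n ≠ 1 ∧ 1 ≤ n ∧ n ≤ N ∧ ∀ p ∈ S, ¬ p ∣ n := by
    intro n hn; simp only [hF, Finset.mem_erase, Finset.mem_filter, Finset.mem_Icc] at hn; tauto
  have hFM : ∀ n ∈ F, M < n := by
    intro n hn
    obtain ⟨a1, a2, a3, a4⟩ := hFmem n hn
    by_contra hlt
    obtain ⟨p, hp, hpn⟩ := Nat.exists_prime_and_dvd a1
    exact a4 p (hM p hp ((Nat.le_of_dvd a2 hpn).trans (by omega))) hpn
  have hFc : F.card ≤ N := by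
    calc F.card ≤ (Finset.Icc 1 N).card := Finset.card_le_card ((Finset.erase_subset _ _).trans (Finset.filter_subset _ _))
      _ = N := by simp
  have hR1 : ∀ s : ℂ, RS S N s - 1 = ∑ n : F, ((n:ℕ):ℂ) ^ (-s) := by
    intro s
    rw [Finset.sum_coe_sort F (fun n => (n:ℂ) ^ (-s)), RS, sub_eq_iff_eq_add']
    rw [← Finset.add_sum_erase (a := 1)]
    · simp [hF]
    · simp only [Finset.mem_filter, Finset.mem_Icc]
      exact ⟨⟨le_rfl, hN1⟩, fun p hp h => (hS p hp).one_lt.ne' (Nat.dvd_one.1 h)⟩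
  have e : ∀ t : ℝ, kap k b S t * (RS S N (s0 + I * t) - 1) =
      ∑ x : ι × F, (β x.1 * ((x.2:ℕ):ℂ) ^ (-s0)) * ((m x.1 * (x.2:ℕ) : ℕ) : ℂ) ^ (-(I * t)) := by
    intro t
    rw [h6, hR1, Finset.sum_mul_sum, Fintype.sum_prod_type]
    refine Finset.sum_congr rfl fun i _ => Finset.sum_congr rfl fun n _ => ?_
    have hn := hFmem n n.2
    have hn0 : ((n:ℕ):ℂ) ≠ 0 := by
      have : (n:ℕ) ≠ 0 := by omega
      exact_mod_cast this
    simp only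
    rw [Nat.cast_mul, Complex.natCast_mul_natCast_cpow, neg_add, Complex.cpow_add _ _ hn0]
    ring
  simp_rw [e]
  have hd := dir_ms (ι := ι × F) (fun x => β x.1 * ((x.2:ℕ):ℂ) ^ (-s0)) (fun x => m x.1 * (x.2:ℕ)) ?_ (X * N) ((N:ℝ) ^ (1 + c)) (1 / 2) ?_ ?_ ?_
  · refine hd.1.trans (ENNReal.ofReal_le_ofReal ?_)
    rw [show (1:ℝ) + 1 / 2 = 3 / 2 by norm_num]
    gcongr
    rw [Fintype.sum_prod_type]
    simp only [norm_mul, h4, one_mul]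
    rw [Finset.sum_const, Finset.card_univ, h5, nsmul_eq_mul, Nat.cast_pow]
    gcongr
    refine le_trans ?_ (hτ F hFM)
    rw [Finset.sum_coe_sort F (fun n => ‖(n:ℂ) ^ (-s0)‖ ^ 2)]
    refine Finset.sum_le_sum fun n hn => ?_
    have hn := hFmem n hn
    rw [Complex.norm_natCast_cpow_of_pos (by omega), ← Real.rpow_mul_natCast (by positivity)]
    refine Real.rpow_le_rpow_of_exponent_le (by exact_mod_cast hn.2.1) ?_
    have := hs.1
    simp; linarith
  · rintro ⟨i, n⟩ ⟨i', n'⟩ h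
    have := coprime_inj (h3 i) (h3 i') (hFmem n n.2).2.2.2 (hFmem n' n'.2).2.2.2 (h2 i) h
    rw [h1 this.1, Subtype.ext this.2]
  · rintro ⟨i, n⟩
    exact Nat.mul_pos (h2 i) (hFmem n n.2).2.1
  · rintro ⟨i, n⟩
    have : ((n:ℕ):ℝ) ≤ N := by exact_mod_cast (hFmem n n.2).2.2.1
    push_cast
    exact mul_le_mul (hmX i) this (by positivity) hX0.le
  · refine le_trans ?_ hN
    rw [Fintype.card_prod, Fintype.card_coe, h5]
    push_cast
    gcongr
    rw [Real.rpow_add (by linarith), Real.rpow_one, mul_comm (2:ℝ) c, Real.rpow_mul (by linarith)]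
    have : ((N:ℝ) ^ c) ^ (2:ℝ) = ((N:ℝ) ^ c) ^ 2 := by norm_cast
    rw [this]
    have hN0 : (N:ℝ) ≠ 0 := by linarith
    field_simp
    exact le_rfl

end Voronin

namespace Voronin
open MeasureTheory Set Filter Topology ProbabilityTheory

lemma adm_circle {R : ℝ} (hR : 0 < R) (hR4 : R < 1 / 4) {z : ℂ} (hz : ‖z‖ ≤ R) : Adm (1 / 4 - R) (3 / 4 + z) := by
  have h1 := abs_le.1 ((abs_re_le_norm z).trans hz)
  have h2 := (abs_im_le_norm z).trans hz
  have e1 : ((3:ℂ) / 4 + z).re = 3 / 4 + z.re := by norm_num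
  have e2 : ((3:ℂ) / 4 + z).im = z.im := by norm_num
  refine ⟨?_, ?_, ?_⟩
  · rw [e1]; linarith
  · rw [e1]; linarith
  · rw [e2]; linarith

lemma kap_erase {k : ℕ} {b : ℕ → ℂ} {S : Finset ℕ} (hS : ∀ p ∈ S, p.Prime) (hb : ∀ p, ‖b p‖ = 1) {p : ℕ} (hp : p ∈ S) (t : ℝ) :
    ‖kap k b S t‖ * ‖b p * (p:ℂ) ^ (-(I * (t:ℂ))) - 1‖ ≤ 2 * ‖kap k b (S.erase p) t‖ := by
  unfold kap
  rw [← Finset.mul_prod_erase S _ hp, norm_mul, mul_right_comm, ← norm_mul, geom_sum_mul]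
  gcongr
  refine (norm_sub_le _ _).trans ?_
  rw [norm_pow, norm_mul, hb, norm_nat_I (hS p hp).pos]; norm_num

lemma choose_t {R : ℝ} (hR : 0 < R) (hR4 : R < 1 / 4) (η δ τ : ℝ) (hη : 0 < η) (hδ : 0 < δ) (hτη : 200 * τ ≤ η)
    (S : Finset ℕ) (hS : ∀ p ∈ S, p.Prime) (M : ℕ) (hM : ∀ p : ℕ, p.Prime → p ≤ M → p ∈ S)
    (hτ : ∀ F : Finset ℕ, (∀ n ∈ F, M < n) → ∑ n ∈ F, (n:ℝ) ^ (-1 - 2 * (1 / 4 - R)) ≤ τ)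
    (b : ℕ → ℂ) (hb : ∀ p, ‖b p‖ = 1) :
    ∃ t : ℝ, (∀ p ∈ S, ‖b p * (p:ℂ) ^ (-(I * (t:ℂ))) - 1‖ < δ) ∧
      ∫ θ in (0:ℝ)..2 * Real.pi, ‖zS S (3 / 4 + circleMap 0 R θ + I * t) - 1‖ ^ 2 < η := by
  set c := 1 / 4 - R with hc
  have hc0 : 0 < c := by rw [hc]; linarith
  have hc1 : c ≤ 1 := by rw [hc]; linarith
  have hτ0 : 0 ≤ τ := by simpa using hτ ∅ (by simp)
  have hadm : ∀ θ : ℝ, Adm c (3 / 4 + circleMap 0 R θ) := fun θ =>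
    adm_circle hR hR4 (by rw [norm_circleMap_zero, abs_of_pos hR])
  -- choose k
  obtain ⟨k, hk⟩ := exists_nat_gt (48 * S.card / δ ^ 2)
  have hk0 : (0:ℝ) < k := lt_of_le_of_lt (by positivity) hk
  set L : ℝ := (k:ℝ) ^ S.card with hL
  have hL0 : 0 < L := by positivity
  obtain ⟨C, hC, N0, hN0, HC⟩ := ms_S hc0 hc1 S hS 1 le_rfl
  have hNT : Tendsto (fun N : ℕ => (N:ℝ) ^ (1 + c)) atTop atTop :=
    (tendsto_rpow_atTop (by linarith)).comp tendsto_natCast_atTop_atTop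
  have hNc : Tendsto (fun N : ℕ => 16 * Real.pi * L * C * (N:ℝ) ^ (-c)) atTop (𝓝 0) := by
    rw [← mul_zero (16 * Real.pi * L * C)]
    exact ((tendsto_rpow_neg_atTop hc0).comp tendsto_natCast_atTop_atTop).const_mul _
  have hev : ∀ᶠ N : ℕ in atTop, ∀ p ∈ S, ms ((N:ℝ) ^ (1 + c)) (kap k b (S.erase p)) ≤
      ENNReal.ofReal (3 / 2 * (k:ℝ) ^ (S.erase p).card) := by
    rw [Filter.eventually_all_finset]
    intro p hp
    exact (hNT.eventually (kap_ms k b hb (S.erase p) fun q hq => hS q (Finset.mem_of_mem_erase hq))).mono fun N h => h.2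
  obtain ⟨N, h1, h2, h3, h4, h5, h6⟩ := ((hNT.eventually (kap_ms k b hb S hS)).and (hev.and
    ((kap_RS hc0 k b hb S hS M hM τ hτ).and ((hNc.eventually (gt_mem_nhds hη)).and
    ((eventually_ge_atTop N0).and (eventually_ge_atTop 1)))))).exists
  have hN1 : (1:ℝ) ≤ N := by exact_mod_cast h6
  set T : ℝ := (N:ℝ) ^ (1 + c) with hT
  have hTN : (N:ℝ) ≤ T := by
    rw [hT]; conv_lhs => rw [← Real.rpow_one (N:ℝ)]
    exact Real.rpow_le_rpow_of_exponent_le hN1 (by linarith)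
  have h7 := HC N h5 T hTN (by rw [one_mul])
  set D : ℝ := C * (N:ℝ) ^ (-c) with hD
  have hD0 : 0 ≤ D := by positivity
  have h4' : 16 * Real.pi * L * D < η := by rw [hD]; linarith
  -- joint continuity
  have hjc : Continuous fun q : ℝ × ℝ => kap k b S q.1 * (zS S (3 / 4 + circleMap 0 R q.2 + I * q.1) - 1) := by
    refine ((kap_cont hS).comp continuous_fst).mul (Continuous.sub ?_ continuous_const)
    rw [continuous_iff_continuousAt]
    intro q
    have g1 : Continuous (fun q : ℝ × ℝ => 3 / 4 + circleMap 0 R q.2 + I * (q.1:ℂ)) := by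
      have := (continuous_circleMap (0:ℂ) R).comp (continuous_snd (X := ℝ) (Y := ℝ))
      simp only [Function.comp_def] at this
      fun_prop
    exact ContinuousAt.comp (f := fun q : ℝ × ℝ => 3 / 4 + circleMap 0 R q.2 + I * (q.1:ℂ)) (g := zS S)
      (zS_contAt hS (adm_ne hc0 (hadm q.2) q.1)) g1.continuousAt
  have hzc : ∀ t : ℝ, Continuous fun θ : ℝ => zS S (3 / 4 + circleMap 0 R θ + I * t) := by
    intro t
    rw [continuous_iff_continuousAt]
    intro θ
    have g1 : Continuous (fun θ : ℝ => 3 / 4 + circleMap 0 R θ + I * (t:ℂ)) := by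
      have := (continuous_circleMap (0:ℂ) R)
      fun_prop
    exact ContinuousAt.comp (f := fun θ : ℝ => 3 / 4 + circleMap 0 R θ + I * (t:ℂ)) (g := zS S)
      (zS_contAt hS (adm_ne hc0 (hadm θ) t)) g1.continuousAt
  by_contra hcon
  push Not at hcon
  let G : ℝ → ENNReal := fun t => ∫⁻ θ in Ioc 0 (2 * Real.pi), ENNReal.ofReal (‖zS S (3 / 4 + circleMap 0 R θ + I * t) - 1‖ ^ 2)
  have hW : ∀ t : ℝ, 1 ≤ ∑ p ∈ S, ENNReal.ofReal (‖b p * (p:ℂ) ^ (-(I * (t:ℂ))) - 1‖ ^ 2 / δ ^ 2) + G t * ENNReal.ofReal (1 / η) := by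
    intro t
    by_cases hp : ∀ p ∈ S, ‖b p * (p:ℂ) ^ (-(I * (t:ℂ))) - 1‖ < δ
    · have h := hcon t hp
      refine le_trans ?_ le_add_self
      have hG : G t = ENNReal.ofReal (∫ θ in (0:ℝ)..2 * Real.pi, ‖zS S (3 / 4 + circleMap 0 R θ + I * t) - 1‖ ^ 2) := by
        rw [intervalIntegral.integral_of_le (by positivity), ofReal_integral_eq_lintegral_ofReal]
        · have : Continuous fun θ : ℝ => ‖zS S (3 / 4 + circleMap 0 R θ + I * t) - 1‖ ^ 2 :=
            (((hzc t).sub continuous_const).norm.pow 2)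
          exact this.integrableOn_Ioc
        · exact Eventually.of_forall fun θ => by positivity
      rw [hG, ← ENNReal.ofReal_mul (le_trans hη.le h)]
      rw [ENNReal.one_le_ofReal, mul_one_div, le_div_iff₀ hη]; linarith
    · push Not at hp
      obtain ⟨p, hp, hpd⟩ := hp
      refine le_trans ?_ le_self_add
      refine le_trans ?_ (Finset.single_le_sum (f := fun p => ENNReal.ofReal (‖b p * (p:ℂ) ^ (-(I * (t:ℂ))) - 1‖ ^ 2 / δ ^ 2)) (fun _ _ => zero_le) hp)
      rw [ENNReal.one_le_ofReal, le_div_iff₀ (by positivity), one_mul]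
      gcongr
  have hkm : Measurable fun t : ℝ => ENNReal.ofReal (‖kap k b S t‖ ^ 2) := by
    have := (kap_cont (k := k) (b := b) hS).measurable
    fun_prop
  have hpm : ∀ p ∈ S, Measurable fun t : ℝ => ENNReal.ofReal (‖b p * (p:ℂ) ^ (-(I * (t:ℂ))) - 1‖ ^ 2 / δ ^ 2) := by
    intro p hp
    have : Measurable fun t : ℝ => (p:ℂ) ^ (-(I * (t:ℂ))) := 
      ((natpow_cont (hS p hp).ne_zero).comp (by fun_prop : Continuous fun t : ℝ => I * (t:ℂ))).measurable
    fun_prop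
  -- bound for each prime
  have hP : ∀ p ∈ S, ∫⁻ t, ENNReal.ofReal (‖kap k b S t‖ ^ 2) * ENNReal.ofReal (‖b p * (p:ℂ) ^ (-(I * (t:ℂ))) - 1‖ ^ 2 / δ ^ 2) ∂(gT T) ≤
      ENNReal.ofReal (6 * L / (k * δ ^ 2)) := by
    intro p hp
    calc _ ≤ ∫⁻ t, ENNReal.ofReal (4 / δ ^ 2) * ENNReal.ofReal (‖kap k b (S.erase p) t‖ ^ 2) ∂(gT T) := by
          refine lintegral_mono fun t => ?_
          simp only
          rw [← ENNReal.ofReal_mul (by positivity), ← ENNReal.ofReal_mul (by positivity)]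
          refine ENNReal.ofReal_le_ofReal ?_
          have := pow_le_pow_left₀ (by positivity) (kap_erase (k := k) hS hb hp t) 2
          rw [← mul_div_assoc, ← mul_pow, div_mul_eq_mul_div]
          gcongr
          linarith
      _ = ENNReal.ofReal (4 / δ ^ 2) * ms T (kap k b (S.erase p)) := lintegral_const_mul' _ _ ENNReal.ofReal_ne_top
      _ ≤ ENNReal.ofReal (4 / δ ^ 2) * ENNReal.ofReal (3 / 2 * (k:ℝ) ^ (S.erase p).card) := by gcongr; exact h2 p hp
      _ = _ := by
          rw [← ENNReal.ofReal_mul (by positivity)]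
          congr 1
          have : L = k * (k:ℝ) ^ (S.erase p).card := by
            rw [hL, ← pow_succ', Finset.card_erase_add_one hp]
          rw [this]; field_simp; ring
  have hB : ∀ θ : ℝ, ms T (fun t => kap k b S t * (zS S (3 / 4 + circleMap 0 R θ + I * t) - 1)) ≤
      ENNReal.ofReal (2 * (L ^ 2 * D) + 3 * (L * τ)) := by
    intro θ
    have e : ∀ t : ℝ, kap k b S t * (zS S (3 / 4 + circleMap 0 R θ + I * t) - 1) =
        kap k b S t * (zS S (3 / 4 + circleMap 0 R θ + I * t) - RS S N (3 / 4 + circleMap 0 R θ + I * t)) -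
        (-(kap k b S t * (RS S N (3 / 4 + circleMap 0 R θ + I * t) - 1))) := by intro t; ring
    simp_rw [e]
    have hline : Continuous fun t : ℝ => 3 / 4 + circleMap 0 R θ + I * t := by fun_prop
    have hmeas : Measurable fun t : ℝ => -(kap k b S t * (RS S N (3 / 4 + circleMap 0 R θ + I * t) - 1)) :=
      (((kap_cont hS).mul (((RS_cont S N).comp hline).sub continuous_const)).neg).measurable
    refine (ms_sub hmeas).trans ?_
    have a1 : ms T (fun t => kap k b S t * (zS S (3 / 4 + circleMap 0 R θ + I * t) - RS S N (3 / 4 + circleMap 0 R θ + I * t))) ≤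
        ENNReal.ofReal (L ^ 2 * D) := by
      calc _ ≤ ∫⁻ t, ENNReal.ofReal (L ^ 2) * ENNReal.ofReal (‖zS S (3 / 4 + circleMap 0 R θ + I * t) - RS S N (3 / 4 + circleMap 0 R θ + I * t)‖ ^ 2) ∂(gT T) := by
            refine lintegral_mono fun t => ?_
            simp only
            rw [← ENNReal.ofReal_mul (by positivity), norm_mul, mul_pow]
            refine ENNReal.ofReal_le_ofReal ?_
            gcongr
            exact kap_norm hS hb t
        _ = ENNReal.ofReal (L ^ 2) * ms T (fun t => zS S (3 / 4 + circleMap 0 R θ + I * t) - RS S N (3 / 4 + circleMap 0 R θ + I * t)) :=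
            lintegral_const_mul' _ _ ENNReal.ofReal_ne_top
        _ ≤ ENNReal.ofReal (L ^ 2) * ENNReal.ofReal D := by gcongr; exact h7 _ (hadm θ)
        _ = _ := by rw [← ENNReal.ofReal_mul (by positivity)]
    have a2 : ms T (fun t => -(kap k b S t * (RS S N (3 / 4 + circleMap 0 R θ + I * t) - 1))) ≤ ENNReal.ofReal (3 / 2 * (L * τ)) :=
      (ms_mono fun t => by rw [norm_neg]).trans (h3 _ (hadm θ))
    calc _ ≤ 2 * ENNReal.ofReal (L ^ 2 * D) + 2 * ENNReal.ofReal (3 / 2 * (L * τ)) := by gcongr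
      _ = _ := by
        rw [show (2:ENNReal) = ENNReal.ofReal 2 by simp, ← ENNReal.ofReal_mul (by norm_num), ← ENNReal.ofReal_mul (by norm_num),
          ← ENNReal.ofReal_add (by positivity) (by positivity)]
        congr 1; ring
  have hGb : ∫⁻ t, ENNReal.ofReal (‖kap k b S t‖ ^ 2) * G t ∂(gT T) ≤
      ENNReal.ofReal ((2 * (L ^ 2 * D) + 3 * (L * τ)) * (2 * Real.pi)) := by
    calc _ = ∫⁻ t, (∫⁻ θ in Ioc 0 (2 * Real.pi), ENNReal.ofReal (‖kap k b S t * (zS S (3 / 4 + circleMap 0 R θ + I * t) - 1)‖ ^ 2)) ∂(gT T) := by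
          refine lintegral_congr fun t => ?_
          simp only [G]
          rw [← lintegral_const_mul' _ _ ENNReal.ofReal_ne_top]
          refine lintegral_congr fun θ => ?_
          rw [← ENNReal.ofReal_mul (by positivity), norm_mul, mul_pow]
      _ = ∫⁻ θ in Ioc 0 (2 * Real.pi), ms T (fun t => kap k b S t * (zS S (3 / 4 + circleMap 0 R θ + I * t) - 1)) := by
          rw [lintegral_lintegral_swap]
          · rfl
          · refine Measurable.aemeasurable ?_
            exact ENNReal.measurable_ofReal.comp (hjc.norm.pow 2).measurable
      _ ≤ ∫⁻ θ in Ioc 0 (2 * Real.pi), ENNReal.ofReal (2 * (L ^ 2 * D) + 3 * (L * τ)) := lintegral_mono hB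
      _ = _ := by
          rw [setLIntegral_const, Real.volume_Ioc, sub_zero, ← ENNReal.ofReal_mul (by positivity)]
  have hfin : ENNReal.ofReal (1 / 2 * L) ≤ ENNReal.ofReal (S.card * (6 * L / (k * δ ^ 2)) + ((2 * (L ^ 2 * D) + 3 * (L * τ)) * (2 * Real.pi)) * (1 / η)) := by
    calc ENNReal.ofReal (1 / 2 * L) ≤ ms T (kap k b S) := h1.1
      _ ≤ ∫⁻ t, (∑ p ∈ S, ENNReal.ofReal (‖kap k b S t‖ ^ 2) * ENNReal.ofReal (‖b p * (p:ℂ) ^ (-(I * (t:ℂ))) - 1‖ ^ 2 / δ ^ 2)) +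
            (ENNReal.ofReal (‖kap k b S t‖ ^ 2) * G t) * ENNReal.ofReal (1 / η) ∂(gT T) := by
          refine lintegral_mono fun t => ?_
          simp only
          rw [← Finset.mul_sum, mul_assoc, ← mul_add]
          exact le_mul_of_one_le_right zero_le (hW t)
      _ = ∑ p ∈ S, (∫⁻ t, ENNReal.ofReal (‖kap k b S t‖ ^ 2) * ENNReal.ofReal (‖b p * (p:ℂ) ^ (-(I * (t:ℂ))) - 1‖ ^ 2 / δ ^ 2) ∂(gT T)) +
            (∫⁻ t, ENNReal.ofReal (‖kap k b S t‖ ^ 2) * G t ∂(gT T)) * ENNReal.ofReal (1 / η) := by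
          rw [lintegral_add_left, lintegral_finsetSum, lintegral_mul_const' _ _ ENNReal.ofReal_ne_top]
          · exact fun p hp => hkm.mul (hpm p hp)
          · exact Finset.measurable_fun_sum _ fun p hp => hkm.mul (hpm p hp)
      _ ≤ ∑ p ∈ S, ENNReal.ofReal (6 * L / (k * δ ^ 2)) + ENNReal.ofReal ((2 * (L ^ 2 * D) + 3 * (L * τ)) * (2 * Real.pi)) * ENNReal.ofReal (1 / η) := by
          gcongr with p hp
          exact hP p hp
      _ = _ := by
          rw [Finset.sum_const, nsmul_eq_mul, ← ENNReal.ofReal_natCast, ← ENNReal.ofReal_mul (by positivity),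
            ← ENNReal.ofReal_mul (by positivity), ← ENNReal.ofReal_add (by positivity) (by positivity)]
  rw [ENNReal.ofReal_le_ofReal_iff (by positivity)] at hfin
  have b1 : S.card * (6 * L / (k * δ ^ 2)) < 1 / 8 * L := by
    rw [div_lt_iff₀ (by positivity)] at hk
    rw [← mul_div_assoc, div_lt_iff₀ (by positivity)]
    nlinarith
  have b2 : ((2 * (L ^ 2 * D) + 3 * (L * τ)) * (2 * Real.pi)) * (1 / η) < 3 / 8 * L := by
    rw [mul_one_div, div_lt_iff₀ hη]
    have q1 : L * (16 * Real.pi * L * D) < L * η := by gcongr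
    have q2 : Real.pi * τ ≤ 3.15 * τ := by gcongr; exact Real.pi_lt_d2.le
    have q3 : L * (6 * (Real.pi * τ)) ≤ L * (1 / 10 * η) := mul_le_mul_of_nonneg_left (by linarith) hL0.le
    have : 0 < L * η := by positivity
    nlinarith
  linarith

end Voronin

namespace Voronin
open MeasureTheory Set Filter Topology ProbabilityTheory

/-- primes below `M` -/
def PB (M : ℕ) : Finset ℕ := (Finset.range M).filter Nat.Prime

lemma PB_prime {M p : ℕ} (h : p ∈ PB M) : p.Prime := (Finset.mem_filter.1 h).2

lemma tail_small {σ : ℝ} (hσ : 1 < σ) {τ : ℝ} (hτ : 0 < τ) :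
    ∃ M0 : ℕ, ∀ F : Finset ℕ, (∀ n ∈ F, M0 ≤ n) → ∑ n ∈ F, (n:ℝ) ^ (-σ) ≤ τ := by
  have hs : Summable fun n : ℕ => (n:ℝ) ^ (-σ) := Real.summable_nat_rpow.2 (by linarith)
  obtain ⟨s, hs⟩ := summable_iff_vanishing_norm.1 hs τ hτ
  refine ⟨s.sup id + 1, fun F hF => ?_⟩
  have := hs F (by
    rw [Finset.disjoint_left]
    intro n hn hns
    have := Finset.le_sup (f := id) hns
    have := hF n hn
    simp only [id] at *
    omega)
  exact (le_abs_self _).trans this.le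

lemma natpow_diff {n : ℕ} (hn : n ≠ 0) : Differentiable ℂ fun s : ℂ => (n:ℂ) ^ (-s) := by
  have : (n:ℂ) ≠ 0 := by exact_mod_cast hn
  intro s
  exact (differentiable_id.neg.differentiableAt).const_cpow (Or.inl this)

lemma zS_diffAt {S : Finset ℕ} (hS : ∀ p ∈ S, p.Prime) {s : ℂ} (hs : s ≠ 1) : DifferentiableAt ℂ (zS S) s := by
  unfold zS
  refine (differentiableAt_riemannZeta hs).mul ?_
  refine DifferentiableAt.fun_finsetProd fun p hp => ?_
  exact (differentiableAt_const _).sub (natpow_diff (hS p hp).ne_zero s)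

lemma step2 {r R : ℝ} (hr : 0 < r) (hrR : r < R) (hR4 : R < 1 / 4) {ε : ℝ} (hε : 0 < ε) :
    ∃ M0 : ℕ, ∀ M, M0 ≤ M → ∀ b : ℕ → ℂ, (∀ p, ‖b p‖ = 1) → ∀ δ > 0, ∃ T : ℝ,
      (∀ p ∈ PB M, ‖(p:ℂ) ^ (-(I * (T:ℂ))) - b p‖ < δ) ∧ ∀ s : ℂ, ‖s‖ ≤ r → ‖zS (PB M) (s + (3 / 4 + I * T)) - 1‖ < ε := by
  have hR : 0 < R := by linarith
  set η : ℝ := ε ^ 2 * ((R - r) / R) with hη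
  have hη0 : 0 < η := by
    have : 0 < R - r := by linarith
    positivity
  obtain ⟨M0, hM0⟩ := tail_small (σ := 1 + 2 * (1 / 4 - R)) (by linarith) (τ := η / 200) (by positivity)
  refine ⟨M0, fun M hM b hb δ hδ => ?_⟩
  obtain ⟨T, h1, h2⟩ := choose_t hR hR4 η δ (η / 200) hη0 hδ (by linarith) (PB M) (fun p => PB_prime) (M - 1)
    (fun p hp hpM => by
      simp only [PB, Finset.mem_filter, Finset.mem_range]
      have := hp.pos
      exact ⟨by omega, hp⟩)
    (fun F hF => by
      have := hM0 F (fun n hn => by have := hF n hn; omega)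
      convert this using 3; ring) (fun p => (starRingEnd ℂ) (b p)) (fun p => by simp [hb])
  refine ⟨T, fun p hp => ?_, fun s hs => ?_⟩
  · have := h1 p hp
    have e : (p:ℂ) ^ (-(I * (T:ℂ))) - b p = b p * ((starRingEnd ℂ) (b p) * (p:ℂ) ^ (-(I * (T:ℂ))) - 1) := by
      have : b p * (starRingEnd ℂ) (b p) = 1 := by rw [Complex.mul_conj', hb]; simp
      linear_combination -(p:ℂ) ^ (-(I * (T:ℂ))) * this
    rw [e, norm_mul, hb, one_mul]; exact this
  · set f : ℂ → ℂ := fun z => zS (PB M) (3 / 4 + z + I * T) - 1 with hf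
    have hd : DiffContOnCl ℂ f (ball 0 R) := by
      refine DifferentiableOn.diffContOnCl fun z hz => ?_
      rw [closure_ball _ hR.ne'] at hz
      have hz' : ‖z‖ ≤ R := by simpa using hz
      have hne := adm_ne (by linarith) (adm_circle hR hR4 hz') T
      refine DifferentiableAt.differentiableWithinAt ?_
      refine DifferentiableAt.sub_const ?_ _
      have h3 : DifferentiableAt ℂ (fun z : ℂ => 3 / 4 + z + I * T) z := by fun_prop
      exact DifferentiableAt.comp (g := zS (PB M)) z (zS_diffAt (fun p => PB_prime) hne) h3
    have h3 := sup_of_L2 hr.le hrR f hd hs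
    have h4 : ‖f s‖ ^ 2 < ε ^ 2 := by
      refine h3.trans_lt ?_
      have h5 : 0 < R - r := by linarith
      calc _ < R / (R - r) * η := by gcongr
        _ = ε ^ 2 := by rw [hη]; field_simp
    have h5 := lt_of_pow_lt_pow_left₀ 2 hε.le h4
    rw [show s + (3 / 4 + I * (T:ℂ)) = 3 / 4 + s + I * T by ring]
    exact h5

end Voronin

namespace Voronin
open MeasureTheory Set Filter Topology ProbabilityTheory

lemma abs_dense {H : Type*} [NormedAddCommGroup H] [NormedSpace ℂ H] (x : ℕ → H) (v : H)
    (h : ∀ φ : StrongDual ℂ H, Summable (fun n => ‖φ (x n)‖) → φ v = 0) {ε : ℝ} (hε : 0 < ε) (M0 : ℕ) :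
    ∃ M, M0 ≤ M ∧ ∃ a : ℕ → ℂ, (∀ n, ‖a n‖ ≤ 1) ∧ ‖v - ∑ n ∈ Finset.range M, a n • x n‖ < ε := by
  set A : Set (ℕ →₀ ℂ) := {a | ∀ n, ‖a n‖ ≤ 1} with hA
  have hAc : Convex ℝ A := by
    intro a ha b hb s t hs ht hst n
    simp only [Finsupp.add_apply, Finsupp.smul_apply]
    calc _ ≤ ‖s • a n‖ + ‖t • b n‖ := norm_add_le _ _
      _ = s * ‖a n‖ + t * ‖b n‖ := by rw [norm_smul, norm_smul, Real.norm_of_nonneg hs, Real.norm_of_nonneg ht]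
      _ ≤ s * 1 + t * 1 := by gcongr; exacts [ha n, hb n]
      _ = 1 := by linarith
  set L := Finsupp.linearCombination ℂ x with hL
  have hC : Convex ℝ (L '' A) := hAc.is_linear_image (f := L) ⟨fun a b => map_add L a b, fun c a => by
    rw [← Complex.coe_smul, ← Complex.coe_smul, map_smul]⟩
  have hv : v ∈ closure (L '' A) := by
    by_contra hv
    obtain ⟨φ, u, h1, h2⟩ := RCLike.geometric_hahn_banach_closed_point (𝕜 := ℂ) hC.closure isClosed_closure hv
    have hsum : ∀ M, ∑ n ∈ Finset.range M, ‖φ (x n)‖ ≤ u := by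
      intro M
      set a : ℕ →₀ ℂ := Finsupp.onFinset (Finset.range M) (fun n => if n ∈ Finset.range M then exp (-(arg (φ (x n)) * I)) else 0)
        (by intro n hn; by_contra h; simp [h] at hn) with ha
      have haA : a ∈ A := by
        intro n
        simp only [ha, Finsupp.onFinset_apply]
        split_ifs
        · rw [show -((arg (φ (x n)):ℂ) * I) = ((-arg (φ (x n)) : ℝ) : ℂ) * I by push_cast; ring, norm_exp_ofReal_mul_I]
        · simp
      have := h1 _ (subset_closure ⟨a, haA, rfl⟩)
      have e : L a = ∑ n ∈ Finset.range M, exp (-(arg (φ (x n)) * I)) • x n := by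
        rw [hL, Finsupp.linearCombination_apply, Finsupp.onFinset_sum _ (by simp)]
        exact Finset.sum_congr rfl fun n hn => by rw [if_pos hn]
      rw [e, map_sum] at this
      have e2 : ∑ n ∈ Finset.range M, φ (exp (-(arg (φ (x n)) * I)) • x n) = ((∑ n ∈ Finset.range M, ‖φ (x n)‖ : ℝ) : ℂ) := by
        push_cast
        refine Finset.sum_congr rfl fun n hn => ?_
        rw [map_smul, smul_eq_mul]
        have e3 := Complex.norm_mul_exp_arg_mul_I (φ (x n))
        have e4 : exp (-(arg (φ (x n)) * I)) * exp (arg (φ (x n)) * I) = 1 := by rw [← Complex.exp_add]; simp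
        linear_combination (-exp (-(arg (φ (x n)) * I))) * e3 + (‖φ (x n)‖:ℂ) * e4
      rw [e2] at this
      have h3 : RCLike.re ((∑ n ∈ Finset.range M, ‖φ (x n)‖ : ℝ) : ℂ) = ∑ n ∈ Finset.range M, ‖φ (x n)‖ := Complex.ofReal_re _
      rw [h3] at this
      exact this.le
    have h3 := h φ (summable_of_sum_range_le (fun n => norm_nonneg _) hsum)
    have h4 := hsum 0
    rw [h3] at h2
    simp at h2 h4
    linarith
  obtain ⟨y, ⟨a, ha, rfl⟩, hy⟩ := Metric.mem_closure_iff.1 hv ε hε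
  refine ⟨max M0 (a.support.sup id + 1), le_max_left _ _, a, ha, ?_⟩
  rw [dist_eq_norm] at hy
  refine lt_of_eq_of_lt ?_ hy
  congr 2
  rw [hL, Finsupp.linearCombination_apply, Finsupp.sum]
  symm
  refine Finset.sum_subset (fun n hn => ?_) (fun n _ hn => ?_)
  · have : n ≤ a.support.sup id := Finset.le_sup (f := id) hn
    simp; right; omega
  · simp at hn; simp [hn]

lemma half_unit {a : ℂ} (ha : ‖a‖ ≤ 1) : ∃ d : ℂ, ‖d‖ ≤ 1 ∧ ‖a + d‖ = 1 ∧ ‖a - d‖ = 1 := by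
  set u := exp (arg a * I) with hu
  have hu1 : ‖u‖ = 1 := norm_exp_ofReal_mul_I _
  set q := Real.sqrt (1 - ‖a‖ ^ 2) with hq
  have hq2 : q ^ 2 = 1 - ‖a‖ ^ 2 := Real.sq_sqrt (by nlinarith [norm_nonneg a])
  have hq0 : 0 ≤ q := Real.sqrt_nonneg _
  have key : ∀ t : ℝ, t ^ 2 = q ^ 2 → ‖u * (‖a‖ + t * I)‖ = 1 := by
    intro t ht
    rw [norm_mul, hu1, one_mul]
    have := Complex.normSq_add_mul_I ‖a‖ t
    rw [Complex.normSq_eq_norm_sq, ht, hq2] at this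
    rw [← pow_left_inj₀ (norm_nonneg _) zero_le_one two_ne_zero, this]; ring
  have ea : a = ‖a‖ * u := (Complex.norm_mul_exp_arg_mul_I a).symm
  refine ⟨u * (q * I), ?_, ?_, ?_⟩
  · rw [norm_mul, hu1, one_mul, norm_mul, norm_I, mul_one, Complex.norm_of_nonneg hq0]
    nlinarith [norm_nonneg a]
  · rw [← key q rfl]; congr 1; nth_rw 1 [ea]; ring
  · rw [← key (-q) (by ring)]; congr 1; nth_rw 1 [ea]; push_cast; ring

lemma rounding {H : Type*} [NormedAddCommGroup H] [InnerProductSpace ℂ H] (x : ℕ → H) (a : ℕ → ℂ) (ha : ∀ n, ‖a n‖ ≤ 1)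
    (M : ℕ) : ∀ v : H, ∃ b : ℕ → ℂ, (∀ n, ‖b n‖ = 1) ∧
      ‖v - ∑ n ∈ Finset.range M, b n • x n‖ ^ 2 ≤ ‖v - ∑ n ∈ Finset.range M, a n • x n‖ ^ 2 + ∑ n ∈ Finset.range M, ‖x n‖ ^ 2 := by
  induction M with
  | zero => intro v; exact ⟨fun _ => 1, by simp, by simp⟩
  | succ M ih =>
    intro v
    obtain ⟨b, hb, h⟩ := ih (v - a M • x M)
    obtain ⟨d, hd, h1, h2⟩ := half_unit (ha M)
    set e := v - a M • x M - ∑ n ∈ Finset.range M, b n • x n with he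
    have hp := parallelogram_law_with_norm ℂ e (d • x M)
    have hdx : ‖d • x M‖ ^ 2 ≤ ‖x M‖ ^ 2 := by
      rw [norm_smul]
      have : ‖d‖ * ‖x M‖ ≤ ‖x M‖ := mul_le_of_le_one_left (norm_nonneg _) hd
      gcongr
    have hs : ∀ w : ℂ, ∑ n ∈ Finset.range (M+1), (Function.update b M w) n • x n = ∑ n ∈ Finset.range M, b n • x n + w • x M := by
      intro w
      rw [Finset.sum_range_succ, Function.update_self]
      congr 1
      refine Finset.sum_congr rfl fun n hn => ?_
      rw [Function.update_of_ne]; simp at hn; omega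
    have hu : ∀ w : ℂ, ‖w‖ = 1 → ∀ n, ‖(Function.update b M w) n‖ = 1 := by
      intro w hw n
      rcases eq_or_ne n M with rfl | hn
      · simpa using hw
      · rw [Function.update_of_ne hn]; exact hb n
    have hr : ‖v - ∑ n ∈ Finset.range (M+1), a n • x n‖ = ‖v - a M • x M - ∑ n ∈ Finset.range M, a n • x n‖ := by
      rw [Finset.sum_range_succ]; congr 1; abel
    rw [hr, Finset.sum_range_succ (fun n => ‖x n‖ ^ 2)]
    by_cases hc : ‖e + d • x M‖ ≤ ‖e - d • x M‖
    · refine ⟨Function.update b M (a M - d), hu _ h2, ?_⟩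
      rw [hs]
      have : v - (∑ n ∈ Finset.range M, b n • x n + (a M - d) • x M) = e + d • x M := by
        rw [he, sub_smul]; abel
      rw [this]
      nlinarith [norm_nonneg (e + d • x M)]
    · refine ⟨Function.update b M (a M + d), hu _ h1, ?_⟩
      rw [hs]
      have : v - (∑ n ∈ Finset.range M, b n • x n + (a M + d) • x M) = e - d • x M := by
        rw [he, add_smul]; abel
      rw [this]
      nlinarith [norm_nonneg (e - d • x M)]

end Voronin

namespace Voronin
open MeasureTheory Set Filter Topology ProbabilityTheory

noncomputable def mc : Measure ℝ := volume.restrict (Ioc 0 (2 * Real.pi))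

instance : IsFiniteMeasure mc := by unfold mc; infer_instance

lemma param_diff {k : ℝ → ℂ} (hk : Integrable k mc) (R : ℝ) {h : ℂ → ℂ} {V U : Set ℂ} (hV : IsOpen V)
    (hh : DifferentiableOn ℂ h V) (hU : IsOpen U) (hUV : ∀ a ∈ U, ∀ θ, circleMap 0 R θ - a ∈ V) :
    DifferentiableOn ℂ (fun a => ∫ θ, k θ * h (circleMap 0 R θ - a) ∂mc) U := by
  intro a0 ha0
  obtain ⟨δ, hδ, hδU⟩ := Metric.isOpen_iff.1 hU a0 ha0
  have hd : DifferentiableOn ℂ (deriv h) V := hh.deriv hV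
  have hcpt : IsCompact ((fun q : ℂ × ℂ => q.1 - q.2) '' (sphere (0:ℂ) |R| ×ˢ closedBall a0 (δ / 2))) :=
    ((isCompact_sphere _ _).prod (isCompact_closedBall _ _)).image (by fun_prop)
  have hsub : ((fun q : ℂ × ℂ => q.1 - q.2) '' (sphere (0:ℂ) |R| ×ˢ closedBall a0 (δ / 2))) ⊆ V := by
    rintro _ ⟨⟨z, a⟩, ⟨hz, ha⟩, rfl⟩
    rw [← range_circleMap] at hz
    obtain ⟨θ, rfl⟩ := hz
    exact hUV a (hδU (closedBall_subset_ball (by linarith) ha)) θ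
  obtain ⟨C, hC⟩ := hcpt.exists_bound_of_continuousOn (hd.continuousOn.mono hsub)
  have hcc : Continuous (fun θ => circleMap 0 R θ) := continuous_circleMap 0 R
  have hmeas : ∀ a ∈ U, ∀ g : ℂ → ℂ, ContinuousOn g V → Continuous (fun θ => g (circleMap 0 R θ - a)) := by
    intro a ha g hg
    exact hg.comp_continuous (by fun_prop) (hUV a ha)
  have hint : Integrable (fun θ => k θ * h (circleMap 0 R θ - a0)) mc := by
    have hc := hmeas a0 ha0 h hh.continuousOn
    obtain ⟨C', hC'⟩ := (isCompact_Icc (a := (0:ℝ)) (b := 2 * Real.pi)).exists_bound_of_continuousOn hc.continuousOn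
    refine hk.mul_bdd (c := C') hc.aestronglyMeasurable ?_
    unfold mc
    refine (ae_restrict_iff' measurableSet_Ioc).2 (ae_of_all _ fun θ hθ => hC' θ (Ioc_subset_Icc_self hθ))
  have := hasDerivAt_integral_of_dominated_loc_of_deriv_le (μ := mc) (𝕜 := ℂ) (x₀ := a0) (s := ball a0 (δ/2))
    (F := fun a θ => k θ * h (circleMap 0 R θ - a)) (F' := fun a θ => k θ * (-deriv h (circleMap 0 R θ - a)))
    (bound := fun θ => ‖k θ‖ * C) (ball_mem_nhds _ (by positivity))
    (by
      filter_upwards [hU.mem_nhds ha0] with a ha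
      exact hk.1.mul (hmeas a ha h hh.continuousOn).aestronglyMeasurable)
    hint (hk.1.mul (hmeas a0 ha0 _ hd.continuousOn).neg.aestronglyMeasurable)
    (ae_of_all _ fun θ a ha => by
      rw [norm_mul, norm_neg]
      gcongr
      refine hC _ ⟨(circleMap 0 R θ, a), ⟨?_, ball_subset_closedBall ha⟩, rfl⟩
      rw [← range_circleMap]; exact mem_range_self θ)
    (hk.norm.mul_const C)
    (ae_of_all _ fun θ a ha => by
      have haU := hUV a (hδU (ball_subset_ball (by linarith) ha)) θ
      have h1 := ((hh.differentiableAt (hV.mem_nhds haU)).hasDerivAt).comp a ((hasDerivAt_id a).const_sub (circleMap 0 R θ))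
      refine HasDerivAt.const_mul (k θ) ?_
      rw [mul_neg_one] at h1
      exact h1)
  exact this.2.differentiableAt.differentiableWithinAt

lemma summable_pp {β : ℝ} (hβ : 1 / 2 < β) :
    Summable fun n : ℕ => if IsPrimePow n ∧ ¬ n.Prime then (n:ℝ) ^ (-β) else 0 := by
  set F : ℕ → ℝ := fun n : ℕ => if IsPrimePow n ∧ ¬ n.Prime then (n:ℝ) ^ (-β) else 0 with hF
  have hsupp : Function.support F ⊆ {n | IsPrimePow n} := by
    intro n hn
    by_contra h
    simp only [mem_ofPred_eq] at h
    simp [hF, h] at hn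
  have hind : F = Set.indicator {n | IsPrimePow n} F := (Set.indicator_eq_self.2 hsupp).symm
  rw [hind, ← summable_subtype_iff_indicator]
  refine (Nat.Primes.prodNatEquiv.summable_iff (f := (F ∘ Subtype.val : {n : ℕ // IsPrimePow n} → ℝ))).1 ?_
  have hb : ∀ q : Nat.Primes × ℕ, ((F ∘ Subtype.val) ∘ Nat.Primes.prodNatEquiv) q ≤ ((q.1:ℕ):ℝ) ^ (-(2*β)) * ((2:ℝ) ^ (-β)) ^ ((q.2:ℝ) - 1) := by
    rintro ⟨p, k⟩
    simp only [Function.comp, Nat.Primes.prodNatEquiv_apply, hF]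
    have hp := p.2
    have hp0 : (0:ℝ) < (p:ℕ) := by exact_mod_cast hp.pos
    have hp2 : (2:ℝ) ≤ (p:ℕ) := by exact_mod_cast hp.two_le
    split_ifs with hk
    · have hk1 : 1 ≤ k := by
        by_contra hk0
        have : k = 0 := by omega
        subst this
        simp [hp] at hk
      have hk1' : (1:ℝ) ≤ k := by exact_mod_cast hk1
      push_cast
      rw [← Real.rpow_natCast, ← Real.rpow_mul hp0.le, ← Real.rpow_mul (by norm_num)]
      calc ((p:ℕ):ℝ) ^ (((k+1:ℕ):ℝ) * -β) = ((p:ℕ):ℝ) ^ (-(2*β)) * ((p:ℕ):ℝ) ^ (-(β * (k - 1))) := by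
            rw [← Real.rpow_add hp0]; congr 1; push_cast; ring
        _ ≤ ((p:ℕ):ℝ) ^ (-(2*β)) * (2:ℝ) ^ (-(β * (k - 1))) := by
            have : 0 ≤ β * (k - 1) := mul_nonneg (by linarith) (by linarith)
            gcongr ?_ * ?_
            exact Real.rpow_le_rpow_of_nonpos (by norm_num) hp2 (by linarith)
        _ = _ := by congr 2; ring
    · positivity
  refine Summable.of_nonneg_of_le (fun q => ?_) hb ?_
  · simp only [Function.comp, hF]; split_ifs <;> positivity
  · have h1 : Summable fun p : Nat.Primes => ((p:ℕ):ℝ) ^ (-(2*β)) :=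
      (Real.summable_nat_rpow.2 (by linarith)).comp_injective Nat.Primes.coe_nat_injective
    have h2 : Summable fun k : ℕ => ((2:ℝ) ^ (-β)) ^ ((k:ℝ) - 1) := by
      have h3 : Summable fun k : ℕ => ((2:ℝ) ^ (-β)) ^ k :=
        summable_geometric_of_lt_one (by positivity) (Real.rpow_lt_one_of_one_lt_of_neg (by norm_num) (by linarith))
      refine (h3.mul_left (((2:ℝ) ^ (-β))⁻¹)).congr fun k => ?_
      rw [Real.rpow_sub_one (by positivity), Real.rpow_natCast]; ring
    exact h1.mul_of_nonneg h2 (fun _ => by positivity) (fun _ => by positivity)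

lemma annulus_preconnected {R ρ : ℝ} (hR : 0 < R) (hρ : 0 < ρ) : IsPreconnected {a : ℂ | R < ‖a‖ ∧ ‖a‖ < ρ} := by
  have : {a : ℂ | R < ‖a‖ ∧ ‖a‖ < ρ} = exp '' (re ⁻¹' (Ioo (Real.log R) (Real.log ρ))) := by
    ext a
    simp only [mem_ofPred_eq, mem_image, mem_preimage, mem_Ioo]
    constructor
    · rintro ⟨h1, h2⟩
      have h0 : a ≠ 0 := by rintro rfl; simp at h1; linarith
      refine ⟨log a, ?_, exp_log h0⟩
      rw [log_re]
      exact ⟨Real.log_lt_log hR h1, Real.log_lt_log (by linarith) h2⟩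
    · rintro ⟨z, ⟨h1, h2⟩, rfl⟩
      rw [norm_exp]
      exact ⟨(Real.log_lt_iff_lt_exp hR).1 h1, (Real.lt_log_iff_exp_lt hρ).1 h2⟩
  rw [this]
  refine IsPreconnected.image ?_ _ continuous_exp.continuousOn
  exact ((convex_Ioo _ _).linear_preimage (Complex.reLm)).isPreconnected

end Voronin

namespace Voronin
open MeasureTheory Set Filter Topology ProbabilityTheory

noncomputable def fc (k : ℝ → ℂ) (R : ℝ) (n : ℕ) : ℂ := ∫ θ, k θ * (n:ℂ) ^ (-(3 / 4 + circleMap 0 R θ)) ∂mc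

lemma circ_re {R : ℝ} (hR : 0 < R) (θ : ℝ) : -R ≤ (circleMap 0 R θ).re := by
  have h1 := Complex.abs_re_le_norm (circleMap 0 R θ)
  rw [norm_circleMap_zero, abs_of_pos hR] at h1
  exact (abs_le.1 h1).1

lemma pw_bound {R : ℝ} (hR : 0 < R) {n : ℕ} (hn : n ≠ 0) (θ : ℝ) :
    ‖(n:ℂ) ^ (-(3 / 4 + circleMap 0 R θ))‖ ≤ (n:ℝ) ^ (-(3 / 4 - R)) := by
  rw [Complex.norm_natCast_cpow_of_pos (Nat.pos_of_ne_zero hn)]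
  refine Real.rpow_le_rpow_of_exponent_le (by exact_mod_cast Nat.one_le_iff_ne_zero.2 hn) ?_
  have := circ_re hR θ
  have e : (3 / 4 : ℂ).re = 3 / 4 := by norm_num
  simp only [neg_re, add_re, e]
  linarith

lemma fc_bound {k : ℝ → ℂ} (hk : Integrable k mc) {R : ℝ} (hR : 0 < R) {n : ℕ} (hn : n ≠ 0) :
    ‖fc k R n‖ ≤ (∫ θ, ‖k θ‖ ∂mc) * (n:ℝ) ^ (-(3 / 4 - R)) := by
  unfold fc
  refine (norm_integral_le_of_norm_le (hk.norm.mul_const _) (ae_of_all _ fun θ => ?_)).trans (integral_mul_const _ _).le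
  rw [norm_mul]
  gcongr
  exact pw_bound hR hn θ

lemma lsum {k : ℝ → ℂ} (hk : Integrable k mc) {R : ℝ} (hR : 0 < R) (hR4 : R < 1 / 4)
    (hs : Summable fun n : ℕ => if n.Prime then ‖fc k R n‖ else 0) {y : ℝ} (hy : 0 < y) :
    LSeriesSummable (fun n => (ArithmeticFunction.vonMangoldt n : ℂ) * fc k R n) (y:ℂ) := by
  have h2 := ((summable_pp (β := 3 / 4 - R) (by linarith)).mul_left (∫ θ, ‖k θ‖ ∂mc))
  refine Summable.of_norm_bounded ((hs.add h2).mul_left (1 / y)) fun n => ?_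
  have hk0 : 0 ≤ ∫ θ, ‖k θ‖ ∂mc := integral_nonneg fun _ => norm_nonneg _
  rcases eq_or_ne n 0 with rfl | hn
  · simp [Nat.not_prime_zero, not_isPrimePow_zero]
  rw [LSeries.term_of_ne_zero hn]
  have hn0 : (0:ℝ) < n := by exact_mod_cast Nat.pos_of_ne_zero hn
  rw [norm_div, norm_mul, Complex.norm_natCast_cpow_of_pos (Nat.pos_of_ne_zero hn), ofReal_re,
    Complex.norm_of_nonneg ArithmeticFunction.vonMangoldt_nonneg]
  by_cases hp : IsPrimePow n
  · have h3 : ArithmeticFunction.vonMangoldt n ≤ (n:ℝ) ^ y / y :=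
      ArithmeticFunction.vonMangoldt_le_log.trans (Real.log_natCast_le_rpow_div n hy)
    calc _ ≤ (n:ℝ) ^ y / y * ‖fc k R n‖ / (n:ℝ) ^ y := by gcongr
      _ = 1 / y * ‖fc k R n‖ := by
        have : (n:ℝ) ^ y ≠ 0 := (Real.rpow_pos_of_pos hn0 y).ne'
        field_simp
      _ ≤ _ := by
        gcongr
        by_cases hpr : n.Prime
        · simp [hpr]
        · simp only [hpr, hp, if_false, zero_add, not_false_eq_true, and_self, if_true]
          exact fc_bound hk hR hn
  · have : ArithmeticFunction.vonMangoldt n = 0 := ArithmeticFunction.vonMangoldt_eq_zero_iff.2 hp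
    rw [this]
    have : 0 ≤ ∫ θ, ‖k θ‖ ∂mc := hk0
    simp only [zero_mul, zero_div]
    have h5 : 0 ≤ (if n.Prime then ‖fc k R n‖ else 0) := by split_ifs <;> positivity
    have h6 : (0:ℝ) ≤ (if IsPrimePow n ∧ ¬ n.Prime then (n:ℝ) ^ (-(3 / 4 - R)) else 0) := by split_ifs <;> positivity
    positivity

lemma bdd_int {k : ℝ → ℂ} (hk : Integrable k mc) {g : ℝ → ℂ} (hg : Continuous g) :
    Integrable (fun θ => k θ * g θ) mc := by
  obtain ⟨C', hC'⟩ := (isCompact_Icc (a := (0:ℝ)) (b := 2 * Real.pi)).exists_bound_of_continuousOn hg.continuousOn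
  refine hk.mul_bdd (c := C') hg.aestronglyMeasurable ?_
  unfold mc
  exact (ae_restrict_iff' measurableSet_Ioc).2 (ae_of_all _ fun θ hθ => hC' θ (Ioc_subset_Icc_self hθ))

lemma D_eq {k : ℝ → ℂ} (hk : Integrable k mc) {R : ℝ} (hR : 0 < R) {w : ℂ} (hw : 1 / 4 + R < w.re) :
    LSeries (fun n => (ArithmeticFunction.vonMangoldt n : ℂ) * fc k R n) w =
      ∫ θ, k θ * (-deriv riemannZeta (3 / 4 + circleMap 0 R θ + w) / riemannZeta (3 / 4 + circleMap 0 R θ + w)) ∂mc := by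
  set Λ : ℕ → ℂ := fun n => (ArithmeticFunction.vonMangoldt n : ℂ) with hΛ
  set F : ℕ → ℝ → ℂ := fun n θ => k θ * LSeries.term Λ (3 / 4 + circleMap 0 R θ + w) n with hF
  have e : (3 / 4 : ℂ).re = 3 / 4 := by norm_num
  have hterm : ∀ n ≠ 0, ∀ θ, LSeries.term Λ (3 / 4 + circleMap 0 R θ + w) n = (n:ℂ) ^ (-(3 / 4 + circleMap 0 R θ)) * (Λ n * (n:ℂ) ^ (-w)) := by
    intro n hn θ
    have hn' : (n:ℂ) ≠ 0 := by exact_mod_cast hn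
    rw [LSeries.term_of_ne_zero hn, div_eq_mul_inv, ← Complex.cpow_neg, neg_add, Complex.cpow_add _ _ hn']; ring
  have hcont : ∀ n : ℕ, n ≠ 0 → Continuous fun θ => (n:ℂ) ^ (-(3 / 4 + circleMap 0 R θ)) := fun n hn =>
    (natpow_cont hn).comp (by fun_prop : Continuous fun θ => 3 / 4 + circleMap 0 R θ)
  have hFi : ∀ n, Integrable (F n) mc := by
    intro n
    rcases eq_or_ne n 0 with rfl | hn
    · simp [hF]
    · refine bdd_int hk ?_
      simp_rw [hterm n hn]
      exact (hcont n hn).mul continuous_const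
  have hFs : Summable fun n => ∫ θ, ‖F n θ‖ ∂mc := by
    have h1 := (ArithmeticFunction.LSeriesSummable_vonMangoldt (s := ((3 / 4 - R + w.re : ℝ) : ℂ)) (by rw [ofReal_re]; linarith)).norm.mul_left (∫ θ, ‖k θ‖ ∂mc)
    refine Summable.of_nonneg_of_le (fun n => integral_nonneg fun _ => norm_nonneg _) (fun n => ?_) h1
    rw [← integral_mul_const]
    refine integral_mono (hFi n).norm (hk.norm.mul_const _) fun θ => ?_
    simp only [hF, norm_mul]
    gcongr
    refine LSeries.norm_term_le_of_re_le_re _ ?_ _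
    have := circ_re hR θ
    simp only [add_re, e, ofReal_re]
    linarith
  have h := (hasSum_integral_of_summable_integral_norm hFi hFs).tsum_eq
  have h2 : ∀ n, ∫ θ, F n θ ∂mc = LSeries.term (fun n => Λ n * fc k R n) w n := by
    intro n
    rcases eq_or_ne n 0 with rfl | hn
    · simp [hF]
    · simp only [hF, hterm n hn]
      rw [LSeries.term_of_ne_zero hn, div_eq_mul_inv (Λ n * _), ← Complex.cpow_neg]
      unfold fc
      simp_rw [← mul_assoc]
      rw [integral_mul_const, integral_mul_const]; ring
  simp_rw [h2] at h
  rw [LSeries, h]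
  refine integral_congr_ae (ae_of_all _ fun θ => ?_)
  simp only [hF]
  rw [tsum_mul_left]
  congr 1
  refine ArithmeticFunction.LSeries_vonMangoldt_eq_deriv_riemannZeta_div (s := 3 / 4 + circleMap 0 R θ + w) ?_
  have := circ_re hR θ
  simp only [add_re, e]
  linarith

noncomputable def hE (z : ℂ) : ℂ := -deriv riemannZeta₁ (1 + z) / riemannZeta₁ (1 + z)

lemma hE_diff : DifferentiableOn ℂ hE (ball 0 (1 / 2)) := by
  intro z hz
  have hz' : ‖(1 + z) - 1‖ < 1 / 2 := by simpa using hz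
  have h0 := zeta1_ne_zero hz'
  have hd : Differentiable ℂ (deriv riemannZeta₁) := by
    have := (differentiable_riemannZeta₁.differentiableOn (s := univ)).deriv isOpen_univ
    exact differentiableOn_univ.1 this
  have h1 : DifferentiableAt ℂ (fun z : ℂ => 1 + z) z := by fun_prop
  refine DifferentiableAt.differentiableWithinAt ?_
  unfold hE
  exact ((hd _).comp z h1).neg.fun_div ((differentiable_riemannZeta₁ _).comp z h1) h0

lemma hE_eq {z : ℂ} (hz0 : z ≠ 0) (hz : ‖z‖ < 1 / 2) :
    -deriv riemannZeta (1 + z) / riemannZeta (1 + z) = z⁻¹ + hE z := by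
  have h0 : riemannZeta₁ (1 + z) ≠ 0 := zeta1_ne_zero (by simpa using hz)
  have hne : 1 + z ≠ 1 := by simpa using hz0
  have hev : riemannZeta =ᶠ[𝓝 (1 + z)] fun s => (s - 1)⁻¹ * riemannZeta₁ s := by
    filter_upwards [isOpen_ne.mem_nhds hne] with s hs
    exact riemannZeta_eq_inv_sub_mul hs
  have hd : HasDerivAt (fun s : ℂ => (s - 1)⁻¹ * riemannZeta₁ s)
      (-1 / (1 + z - 1) ^ 2 * riemannZeta₁ (1 + z) + (1 + z - 1)⁻¹ * deriv riemannZeta₁ (1 + z)) (1 + z) := by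
    have h1 : HasDerivAt (fun s : ℂ => s - 1) 1 (1 + z) := (hasDerivAt_id _).sub_const 1
    exact (h1.inv (by simpa using hz0)).mul (differentiable_riemannZeta₁ _).hasDerivAt
  rw [hev.deriv_eq, hd.deriv, riemannZeta_eq_inv_sub_mul hne]
  simp only [hE, add_sub_cancel_left]
  field_simp
  ring

end Voronin

namespace Voronin
open MeasureTheory Set Filter Topology ProbabilityTheory

lemma circ_mc (f : ℂ → ℂ) (R : ℝ) : circleIntegral f 0 R = ∫ t, deriv (circleMap 0 R) t * f (circleMap 0 R t) ∂mc := by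
  unfold circleIntegral mc
  rw [intervalIntegral.integral_of_le (by positivity)]; rfl

lemma cauchy_swap {k : ℝ → ℂ} (hk : Integrable k mc) {R R' : ℝ} (hR : 0 < R) (hRR : R < R') {v : ℂ → ℂ}
    (hv : DiffContOnCl ℂ v (ball 0 R')) :
    circleIntegral (fun a => v a * ∫ θ, k θ * (circleMap 0 R θ - a)⁻¹ ∂mc) 0 R' =
      -(2 * Real.pi * I) * ∫ θ, k θ * v (circleMap 0 R θ) ∂mc := by
  have hR' : 0 < R' := by linarith
  have hvc : ContinuousOn v (closedBall 0 R') := hv.continuousOn_ball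
  have hsph : ∀ t, circleMap 0 R' t ∈ closedBall (0:ℂ) R' := fun t => by
    simp [abs_of_pos hR']
  have hvt : Continuous fun t => v (circleMap 0 R' t) := hvc.comp_continuous (continuous_circleMap 0 R') hsph
  have hdist : ∀ t θ, R' - R ≤ ‖circleMap 0 R θ - circleMap 0 R' t‖ := fun t θ => by
    have := norm_sub_norm_le (circleMap 0 R' t) (circleMap 0 R θ)
    rw [norm_sub_rev] at this
    simpa [abs_of_pos hR, abs_of_pos hR'] using this
  have hne : ∀ t θ, circleMap 0 R θ - circleMap 0 R' t ≠ 0 := fun t θ => by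
    rw [← norm_pos_iff]; linarith [hdist t θ]
  obtain ⟨C, hC⟩ := (isCompact_closedBall (0:ℂ) R').exists_bound_of_continuousOn hvc
  rw [circ_mc]
  have hint : Integrable (Function.uncurry fun t θ : ℝ => k θ * (deriv (circleMap 0 R') t * v (circleMap 0 R' t) * (circleMap 0 R θ - circleMap 0 R' t)⁻¹)) (mc.prod mc) := by
    refine (hk.comp_snd mc).mul_bdd (c := R' * C * (R' - R)⁻¹) (g := fun q : ℝ × ℝ => deriv (circleMap 0 R') q.1 * v (circleMap 0 R' q.1) * (circleMap 0 R q.2 - circleMap 0 R' q.1)⁻¹) ?_ (ae_of_all _ fun q => ?_)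
    · refine Continuous.aestronglyMeasurable ?_
      refine Continuous.mul (Continuous.mul ?_ (hvt.comp continuous_fst)) (Continuous.inv₀ (by fun_prop) fun q => hne q.1 q.2)
      simp only [deriv_circleMap]
      fun_prop
    · rw [norm_mul, norm_mul, norm_inv, deriv_circleMap, norm_mul, norm_I, norm_circleMap_zero, abs_of_pos hR', mul_one]
      have h1 := hC _ (hsph q.1)
      have h2 := hdist q.1 q.2
      have h3 : 0 < R' - R := by linarith
      have h4 : 0 ≤ R' * C := mul_nonneg hR'.le ((norm_nonneg _).trans h1)
      gcongr
  have h1 : ∀ t, deriv (circleMap 0 R') t * (v (circleMap 0 R' t) * ∫ θ, k θ * (circleMap 0 R θ - circleMap 0 R' t)⁻¹ ∂mc) =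
      ∫ θ, k θ * (deriv (circleMap 0 R') t * v (circleMap 0 R' t) * (circleMap 0 R θ - circleMap 0 R' t)⁻¹) ∂mc := by
    intro t
    rw [← mul_assoc, ← integral_const_mul]
    refine integral_congr_ae (ae_of_all _ fun θ => ?_)
    simp only; ring
  simp_rw [h1]
  rw [integral_integral_swap hint, ← integral_const_mul]
  refine integral_congr_ae (ae_of_all _ fun θ => ?_)
  simp only
  rw [integral_const_mul]
  have h2 := hv.circleIntegral_sub_inv_smul (w := circleMap 0 R θ) (by simp [abs_of_pos hR, hRR])
  rw [circ_mc, smul_eq_mul] at h2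
  have h3 : ∫ t, deriv (circleMap 0 R') t * v (circleMap 0 R' t) * (circleMap 0 R θ - circleMap 0 R' t)⁻¹ ∂mc = -(2 * Real.pi * I * v (circleMap 0 R θ)) := by
    rw [← h2, ← integral_neg]
    refine integral_congr_ae (ae_of_all _ fun t => ?_)
    simp only [smul_eq_mul]
    rw [← neg_sub (circleMap 0 R θ), inv_neg]; ring
  rw [h3]; ring

lemma key {k : ℝ → ℂ} (hk : Integrable k mc) {R : ℝ} (hR : 0 < R) (hR4 : R < 1 / 4)
    (hs : Summable fun n : ℕ => if n.Prime then ‖fc k R n‖ else 0) {ρ : ℝ} (hρ : R < ρ) {v : ℂ → ℂ}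
    (hv : DifferentiableOn ℂ v (ball 0 ρ)) : ∫ θ, k θ * v (circleMap 0 R θ) ∂mc = 0 := by
  set g : ℕ → ℂ := fun n => (ArithmeticFunction.vonMangoldt n : ℂ) * fc k R n with hg
  set J : ℂ → ℂ := fun a => LSeries g (1 / 4 - a) - ∫ θ, k θ * hE (circleMap 0 R θ - a) ∂mc with hJ
  set B : ℂ → ℂ := fun a => ∫ θ, k θ * (circleMap 0 R θ - a)⁻¹ ∂mc with hB
  have e : (1 / 4 : ℂ).re = 1 / 4 := by norm_num
  have hcn : ∀ θ, ‖circleMap 0 R θ‖ = R := fun θ => by rw [norm_circleMap_zero, abs_of_pos hR]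
  have habs : LSeries.abscissaOfAbsConv g ≤ (0:ℝ) :=
    LSeries.abscissaOfAbsConv_le_of_forall_lt_LSeriesSummable fun y hy => lsum hk hR hR4 hs hy
  have hball : ∀ a ∈ ball (0:ℂ) (1 / 4), ∀ θ, circleMap 0 R θ - a ∈ ball (0:ℂ) (1 / 2) := by
    intro a ha θ
    simp only [mem_ball_zero_iff] at ha ⊢
    have := norm_sub_le (circleMap 0 R θ) a
    rw [hcn] at this; linarith
  have hJd : DifferentiableOn ℂ J (ball 0 (1 / 4)) := by
    refine DifferentiableOn.sub ?_ (param_diff hk R isOpen_ball hE_diff isOpen_ball hball)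
    refine (LSeries_differentiableOn g).comp (by fun_prop) fun a ha => ?_
    have ha' : ‖a‖ < 1 / 4 := by simpa using ha
    refine habs.trans_lt ?_
    have := (abs_le.1 (Complex.abs_re_le_norm a)).2
    rw [sub_re, e]
    exact_mod_cast (by linarith : (0:ℝ) < 1 / 4 - a.re)
  have hUo : IsOpen {a : ℂ | R < ‖a‖} := isOpen_lt continuous_const continuous_norm
  have hBd : DifferentiableOn ℂ B {a | R < ‖a‖} := by
    refine param_diff hk R (h := fun z => z⁻¹) (V := {z | z ≠ 0}) isOpen_ne (fun z hz => (differentiableAt_inv hz).differentiableWithinAt) hUo ?_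
    intro a ha θ h0
    rw [sub_eq_zero] at h0
    have : R < ‖a‖ := ha
    rw [← h0, hcn] at this; exact lt_irrefl _ this
  have hJB : ∀ a : ℂ, ‖a‖ < 1 / 4 → a.re < -R → J a = B a := by
    intro a ha hra
    have hab := hball a (by simpa using ha)
    have hn0 : ∀ θ, circleMap 0 R θ - a ≠ 0 := fun θ h0 => by
      rw [sub_eq_zero] at h0
      have := circ_re hR θ
      rw [h0] at this; linarith
    simp only [hJ, hB]
    rw [sub_eq_iff_eq_add, hg, D_eq hk hR (by rw [sub_re, e]; linarith), ← integral_add]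
    · refine integral_congr_ae (ae_of_all _ fun θ => ?_)
      simp only
      rw [show 3 / 4 + circleMap 0 R θ + (1 / 4 - a) = 1 + (circleMap 0 R θ - a) by ring, hE_eq (hn0 θ) (by simpa using hab θ)]
      ring
    · exact bdd_int hk (Continuous.inv₀ (by fun_prop) hn0)
    · exact bdd_int hk (hE_diff.continuousOn.comp_continuous (by fun_prop) hab)
  set W : Set ℂ := {a : ℂ | R < ‖a‖ ∧ ‖a‖ < 1 / 4} with hW
  have hWo : IsOpen W := hUo.inter (isOpen_lt continuous_norm continuous_const)
  have hEq : EqOn J B W := by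
    have hJa : AnalyticOnNhd ℂ J W := (hJd.mono fun a ha => by simpa using ha.2).analyticOnNhd hWo
    have hBa : AnalyticOnNhd ℂ B W := (hBd.mono fun a ha => ha.1).analyticOnNhd hWo
    set a0 : ℂ := ((-((R + 1 / 4) / 2) : ℝ) : ℂ) with ha0
    have hn : ‖a0‖ = (R + 1 / 4) / 2 := by
      rw [ha0, Complex.norm_real, norm_neg, Real.norm_of_nonneg (by linarith)]
    have hre : a0.re = -((R + 1 / 4) / 2) := ofReal_re _
    refine hJa.eqOn_of_preconnected_of_eventuallyEq hBa (annulus_preconnected hR (by norm_num)) (z₀ := a0) ⟨by rw [hn]; linarith, by rw [hn]; linarith⟩ ?_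
    filter_upwards [(isOpen_lt continuous_norm continuous_const).mem_nhds (show a0 ∈ {a : ℂ | ‖a‖ < 1 / 4} by change ‖a0‖ < _; rw [hn]; linarith),
      (isOpen_lt continuous_re continuous_const).mem_nhds (show a0 ∈ {a : ℂ | a.re < -R} by change a0.re < _; rw [hre]; linarith)] with a h1 h2
    exact hJB a h1 h2
  obtain ⟨R', h1, h2⟩ := exists_between (lt_min hR4 hρ)
  rw [lt_min_iff] at h2
  have hR' : 0 < R' := by linarith
  have hsub : closedBall (0:ℂ) R' ⊆ ball 0 ρ := closedBall_subset_ball h2.2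
  have hsub' : closedBall (0:ℂ) R' ⊆ ball 0 (1 / 4) := closedBall_subset_ball h2.1
  have hvd : DiffContOnCl ℂ v (ball 0 R') := by
    refine DifferentiableOn.diffContOnCl ?_
    rw [closure_ball _ hR'.ne']; exact hv.mono hsub
  have hvJ : DiffContOnCl ℂ (fun a => v a * J a) (ball 0 R') := by
    refine DifferentiableOn.diffContOnCl ?_
    rw [closure_ball _ hR'.ne']; exact (hv.mono hsub).mul (hJd.mono hsub')
  have h0 := hvJ.circleIntegral_eq_zero hR'.le
  have h3 := cauchy_swap hk hR h1 hvd
  have h4 : circleIntegral (fun a => v a * J a) 0 R' = circleIntegral (fun a => v a * B a) 0 R' := by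
    refine circleIntegral.integral_congr hR'.le fun a ha => ?_
    have : ‖a‖ = R' := by simpa using ha
    rw [hEq (show a ∈ W from ⟨by rw [this]; exact h1, by rw [this]; exact h2.1⟩)]
  rw [← h4, h0] at h3
  have h5 : -(2 * (Real.pi:ℂ) * I) ≠ 0 := by
    rw [neg_ne_zero]; exact Complex.two_pi_I_ne_zero
  exact (mul_eq_zero.1 h3.symm).resolve_left h5

end Voronin

namespace Voronin
open MeasureTheory Set Filter Topology ProbabilityTheory

lemma cont_memLp (g : C(ℝ, ℂ)) : MemLp (fun θ => g θ) 2 mc := by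
  obtain ⟨C, hC⟩ := (isCompact_Icc (a := (0:ℝ)) (b := 2 * Real.pi)).exists_bound_of_continuousOn g.continuous.continuousOn
  refine MemLp.of_bound g.continuous.aestronglyMeasurable C ?_
  unfold mc
  exact (ae_restrict_iff' measurableSet_Ioc).2 (ae_of_all _ fun θ hθ => hC θ (Ioc_subset_Icc_self hθ))

noncomputable def toH : C(ℝ, ℂ) →ₗ[ℂ] Lp ℂ 2 mc where
  toFun g := (cont_memLp g).toLp _
  map_add' f g := MemLp.toLp_add (cont_memLp f) (cont_memLp g)
  map_smul' c f := MemLp.toLp_const_smul c (cont_memLp f)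

lemma toH_coe (g : C(ℝ, ℂ)) : toH g =ᵐ[mc] fun θ => g θ := MemLp.coeFn_toLp (cont_memLp g)

lemma toH_norm (g : C(ℝ, ℂ)) : ‖toH g‖ ^ 2 = ∫ θ, ‖g θ‖ ^ 2 ∂mc := by
  have h := inner_self_eq_norm_sq_to_K (𝕜 := ℂ) (toH g)
  rw [L2.inner_def] at h
  have h2 : ∫ θ, inner ℂ ((toH g) θ) ((toH g) θ) ∂mc = ((∫ θ, ‖g θ‖ ^ 2 ∂mc : ℝ) : ℂ) := by
    rw [← integral_complex_ofReal]
    refine integral_congr_ae ?_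
    filter_upwards [toH_coe g] with θ hθ
    rw [hθ, inner_self_eq_norm_sq_to_K]; push_cast; rfl
  rw [h2] at h
  refine Complex.ofReal_injective ?_
  rw [h]; push_cast; rfl

lemma dual_repr (φ : StrongDual ℂ (Lp ℂ 2 mc)) : ∃ k : ℝ → ℂ, Integrable k mc ∧ ∀ g : C(ℝ, ℂ), φ (toH g) = ∫ θ, k θ * g θ ∂mc := by
  set k0 := (InnerProductSpace.toDual ℂ (Lp ℂ 2 mc)).symm φ with hk0
  refine ⟨fun θ => (starRingEnd ℂ) (k0 θ), ?_, fun g => ?_⟩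
  · have h1 : Integrable (fun θ => k0 θ) mc := (Lp.memLp k0).integrable one_le_two
    exact (Complex.conjCLE : ℂ →L[ℝ] ℂ).integrable_comp h1
  · have : φ (toH g) = inner ℂ k0 (toH g) := by
      rw [hk0, InnerProductSpace.toDual_symm_apply]
    rw [this, L2.inner_def]
    refine integral_congr_ae ?_
    filter_upwards [toH_coe g] with θ hθ
    rw [hθ, RCLike.inner_apply, mul_comm]

noncomputable def pwC (R : ℝ) (n : ℕ) : C(ℝ, ℂ) :=
  if hn : n = 0 then 0 else ⟨fun θ => (n:ℂ) ^ (-(3 / 4 + circleMap 0 R θ)),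
    (natpow_cont hn).comp (by fun_prop : Continuous fun θ => 3 / 4 + circleMap 0 R θ)⟩

lemma pwC_apply (R : ℝ) {n : ℕ} (hn : n ≠ 0) (θ : ℝ) : pwC R n θ = (n:ℂ) ^ (-(3 / 4 + circleMap 0 R θ)) := by
  simp [pwC, hn]

lemma mc_univ : mc.real univ = 2 * Real.pi := by
  unfold mc
  rw [measureReal_restrict_apply_univ, Real.volume_real_Ioc, sub_zero, max_eq_left (by positivity)]

lemma dens1 {R ρ : ℝ} (hR : 0 < R) (hR4 : R < 1 / 4) (hρ : R < ρ) {v : ℂ → ℂ}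
    (hv : DifferentiableOn ℂ v (ball 0 ρ)) (N0 M0 : ℕ) {ε : ℝ} (hε : 0 < ε) :
    ∃ M, M0 ≤ M ∧ ∃ b : ℕ → ℂ, (∀ n, ‖b n‖ = 1) ∧
      ∫ θ, ‖v (circleMap 0 R θ) - ∑ n ∈ (PB M).filter (N0 ≤ ·), b n * (n:ℂ) ^ (-(3 / 4 + circleMap 0 R θ))‖ ^ 2 ∂mc
        ≤ ε + 2 * Real.pi * ∑ n ∈ (PB M).filter (N0 ≤ ·), (n:ℝ) ^ (-(3 / 2 - 2 * R)) := by
  have hvc : Continuous fun θ => v (circleMap 0 R θ) :=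
    hv.continuousOn.comp_continuous (continuous_circleMap 0 R) fun θ => by simpa [abs_of_pos hR] using hρ
  set V : C(ℝ, ℂ) := ⟨fun θ => v (circleMap 0 R θ), hvc⟩ with hV
  set x : ℕ → Lp ℂ 2 mc := fun n => if n.Prime ∧ N0 ≤ n then toH (pwC R n) else 0 with hx
  have hφ : ∀ φ : StrongDual ℂ (Lp ℂ 2 mc), Summable (fun n => ‖φ (x n)‖) → φ (toH V) = 0 := by
    intro φ hs
    obtain ⟨k, hk, hk2⟩ := dual_repr φ
    rw [hk2]
    refine key hk hR hR4 ?_ hρ hv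
    rw [← summable_nat_add_iff N0] at hs ⊢
    refine hs.congr fun n => ?_
    simp only [hx]
    by_cases hp : (n + N0).Prime
    · simp only [hp, true_and, if_true, Nat.le_add_left]
      rw [hk2]
      unfold fc
      simp_rw [pwC_apply R hp.ne_zero]
    · simp [hp]
  obtain ⟨M, hM, a, ha, h1⟩ := abs_dense x (toH V) hφ (Real.sqrt_pos.2 hε) M0
  obtain ⟨b, hb, h2⟩ := rounding x a ha M (toH V)
  refine ⟨M, hM, b, hb, ?_⟩
  have hsplit : ∀ {A : Type} [AddCommMonoid A] (f : ℕ → A), ∑ n ∈ Finset.range M, (if n.Prime ∧ N0 ≤ n then f n else 0) = ∑ n ∈ (PB M).filter (N0 ≤ ·), f n := by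
    intro A _ f
    rw [← Finset.sum_filter]
    unfold PB
    rw [Finset.filter_filter]
  have e1 : toH V - ∑ n ∈ Finset.range M, b n • x n = toH (V - ∑ n ∈ (PB M).filter (N0 ≤ ·), b n • pwC R n) := by
    rw [map_sub, map_sum, ← hsplit]
    congr 1
    refine Finset.sum_congr rfl fun n _ => ?_
    simp only [hx]
    split_ifs <;> simp
  have hne : ∀ n ∈ (PB M).filter (N0 ≤ ·), n ≠ 0 := fun n hn => (PB_prime (Finset.mem_filter.1 hn).1).ne_zero
  rw [e1, toH_norm] at h2
  have e2 : ∫ θ, ‖(V - ∑ n ∈ (PB M).filter (N0 ≤ ·), b n • pwC R n) θ‖ ^ 2 ∂mc =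
      ∫ θ, ‖v (circleMap 0 R θ) - ∑ n ∈ (PB M).filter (N0 ≤ ·), b n * (n:ℂ) ^ (-(3 / 4 + circleMap 0 R θ))‖ ^ 2 ∂mc := by
    refine integral_congr_ae (ae_of_all _ fun θ => ?_)
    simp only [ContinuousMap.sub_apply, ContinuousMap.sum_apply, ContinuousMap.smul_apply, smul_eq_mul]
    congr 3
    refine Finset.sum_congr rfl fun n hn => ?_
    rw [pwC_apply R (hne n hn)]
  rw [e2] at h2
  refine h2.trans (add_le_add ?_ ?_)
  · calc _ ≤ (Real.sqrt ε) ^ 2 := by gcongr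
      _ = ε := Real.sq_sqrt hε.le
  · have e3 : ∑ n ∈ Finset.range M, ‖x n‖ ^ 2 = ∑ n ∈ (PB M).filter (N0 ≤ ·), ‖toH (pwC R n)‖ ^ 2 := by
      rw [← hsplit]
      refine Finset.sum_congr rfl fun n _ => ?_
      simp only [hx]
      split_ifs <;> simp
    rw [e3, Finset.mul_sum]
    refine Finset.sum_le_sum fun n hn => ?_
    rw [toH_norm]
    calc ∫ θ, ‖pwC R n θ‖ ^ 2 ∂mc ≤ ∫ θ, (n:ℝ) ^ (-(3 / 2 - 2 * R)) ∂mc := by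
          refine integral_mono_of_nonneg (ae_of_all _ fun θ => by positivity) (integrable_const _) (ae_of_all _ fun θ => ?_)
          simp only
          rw [pwC_apply R (hne n hn)]
          have := pw_bound hR (hne n hn) θ
          calc _ ≤ ((n:ℝ) ^ (-(3 / 4 - R))) ^ 2 := by gcongr
            _ = _ := by rw [← Real.rpow_natCast, ← Real.rpow_mul (by positivity)]; congr 1; push_cast; ring
      _ = _ := by rw [integral_const, mc_univ, smul_eq_mul]

end Voronin

namespace Voronin
open MeasureTheory Set Filter Topology ProbabilityTheory

lemma zp_norm {R : ℝ} {s : ℂ} (hs : ‖s‖ ≤ R) {n : ℕ} (hn : n ≠ 0) :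
    ‖(n:ℂ) ^ (-(3 / 4 + s))‖ ≤ (n:ℝ) ^ (-(3 / 4 - R)) := by
  rw [Complex.norm_natCast_cpow_of_pos (Nat.pos_of_ne_zero hn)]
  refine Real.rpow_le_rpow_of_exponent_le (by exact_mod_cast Nat.one_le_iff_ne_zero.2 hn) ?_
  have := (abs_le.1 (Complex.abs_re_le_norm s)).1
  have e : (3 / 4 : ℂ).re = 3 / 4 := by norm_num
  simp only [neg_re, add_re, e]
  linarith

lemma zp_norm' {s : ℂ} (hs : ‖s‖ ≤ 1 / 4) {n : ℕ} (hn : 2 ≤ n) :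
    ‖(n:ℂ) ^ (-(3 / 4 + s))‖ ≤ 3 / 4 := by
  have hn2 : (2:ℝ) ≤ n := by exact_mod_cast hn
  have h1 := zp_norm hs (n := n) (by omega)
  have h2 : ((n:ℝ) ^ (-(3 / 4 - 1 / 4) : ℝ)) ^ 2 ≤ 1 / 2 := by
    rw [← Real.rpow_natCast, ← Real.rpow_mul (by positivity)]
    norm_num
    rw [Real.rpow_neg_one]
    rw [one_div]
    exact (inv_anti₀ (by norm_num) hn2)
  nlinarith [norm_nonneg ((n:ℂ) ^ (-(3 / 4 + s)))]

lemma log_diff {s : ℂ} (hs : ‖s‖ < 1 / 4) {n : ℕ} (hn : 2 ≤ n) :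
    DifferentiableAt ℂ (fun s : ℂ => log (1 - (n:ℂ) ^ (-(3 / 4 + s)))) s := by
  have h1 : DifferentiableAt ℂ (fun s : ℂ => 3 / 4 + s) s := by fun_prop
  have h2 := (natpow_diff (n := n) (by omega) (3 / 4 + s)).comp s h1
  refine DifferentiableAt.clog ((differentiableAt_const 1).sub h2) ?_
  rw [sub_eq_add_neg]
  refine Complex.mem_slitPlane_of_norm_lt_one ?_
  rw [norm_neg]
  exact (zp_norm' hs.le hn).trans_lt (by norm_num)

lemma dens2 {r R ρ : ℝ} (hr : 0 < r) (hrR : r < R) (hR4 : R < 1 / 4) (hρ : R < ρ) {g : ℂ → ℂ}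
    (hg : DifferentiableOn ℂ g (ball 0 ρ)) (M0 : ℕ) {ε : ℝ} (hε : 0 < ε) :
    ∃ M, M0 ≤ M ∧ ∃ b : ℕ → ℂ, (∀ n, ‖b n‖ = 1) ∧ ∀ s : ℂ, ‖s‖ ≤ r →
      ‖g s + ∑ p ∈ PB M, log (1 - b p * (p:ℂ) ^ (-(3 / 4 + s)))‖ < ε := by
  have hR : 0 < R := by linarith
  have hRr : 0 < R - r := by linarith
  set Q : ℝ := R / (R - r) * (1 + 2 * Real.pi) with hQ
  have hQ0 : 0 < Q := by positivity
  set τ : ℝ := min (ε / 8) (ε ^ 2 / (8 * Q)) with hτ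
  have hτ0 : 0 < τ := by positivity
  have hτ1 : τ ≤ ε / 8 := min_le_left _ _
  have hτ2 : Q * τ ≤ ε ^ 2 / 8 := by
    calc Q * τ ≤ Q * (ε ^ 2 / (8 * Q)) := by gcongr; exact min_le_right _ _
      _ = _ := by field_simp
  obtain ⟨N0, hN0⟩ := tail_small (σ := 3 / 2 - 2 * R) (by linarith) hτ0
  set v : ℂ → ℂ := fun s => g s + ∑ p ∈ PB N0, log (1 - (p:ℂ) ^ (-(3 / 4 + s))) with hv
  have hvd : DifferentiableOn ℂ v (ball 0 (min ρ (1 / 4))) := by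
    refine (hg.mono (ball_subset_ball (min_le_left _ _))).add ?_
    intro s hs
    refine DifferentiableAt.differentiableWithinAt ?_
    refine DifferentiableAt.fun_sum fun p hp => log_diff ?_ (PB_prime hp).two_le
    have : ‖s‖ < min ρ (1 / 4) := by simpa using hs
    exact this.trans_le (min_le_right _ _)
  obtain ⟨M, hM, b, hb, h⟩ := dens1 hR hR4 (lt_min hρ hR4) hvd N0 (max M0 N0) hτ0
  have hM0 : M0 ≤ M := (le_max_left _ _).trans hM
  have hMN : N0 ≤ M := (le_max_right _ _).trans hM
  set A := (PB M).filter (N0 ≤ ·) with hA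
  have hAp : ∀ p ∈ A, p.Prime := fun p hp => PB_prime (Finset.mem_filter.1 hp).1
  have hAN : ∀ p ∈ A, N0 ≤ p := fun p hp => (Finset.mem_filter.1 hp).2
  have htail := hN0 A hAN
  refine ⟨M, hM0, fun p => if p < N0 then 1 else b p, fun p => by simp only; split_ifs <;> simp [hb], fun s hs => ?_⟩
  set f : ℂ → ℂ := fun s => v s - ∑ n ∈ A, b n * (n:ℂ) ^ (-(3 / 4 + s)) with hf
  have hfd : DiffContOnCl ℂ f (ball 0 R) := by
    refine DifferentiableOn.diffContOnCl ?_
    rw [closure_ball _ hR.ne']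
    refine (hvd.mono (closedBall_subset_ball (lt_min hρ hR4))).sub ?_
    refine Differentiable.differentiableOn ?_
    refine Differentiable.fun_sum fun p hp => ?_
    have h1 : Differentiable ℂ (fun s : ℂ => 3 / 4 + s) := by fun_prop
    exact ((natpow_diff (hAp p hp).ne_zero).comp h1).const_mul (b p)
  have h3 := sup_of_L2 hr.le hrR f hfd hs
  have h4 : ‖f s‖ < ε / 2 := by
    refine lt_of_pow_lt_pow_left₀ 2 (by positivity) (h3.trans_lt ?_)
    rw [intervalIntegral.integral_of_le (by positivity)]
    change R / (R - r) * ∫ θ, ‖f (circleMap 0 R θ)‖ ^ 2 ∂mc < _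
    calc _ ≤ R / (R - r) * (τ + 2 * Real.pi * τ) := by
          gcongr
          refine h.trans ?_
          gcongr
      _ = Q * τ := by rw [hQ]; ring
      _ ≤ _ := hτ2
      _ < _ := by nlinarith
  have h5 : ‖∑ p ∈ A, (b p * (p:ℂ) ^ (-(3 / 4 + s)) + log (1 - b p * (p:ℂ) ^ (-(3 / 4 + s))))‖ ≤ 2 * τ := by
    refine (norm_sum_le _ _).trans ?_
    calc _ ≤ ∑ p ∈ A, 2 * (p:ℝ) ^ (-(3 / 2 - 2 * R)) := by
          refine Finset.sum_le_sum fun p hp => ?_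
          set z := b p * (p:ℂ) ^ (-(3 / 4 + s)) with hz
          have hz1 : ‖z‖ ≤ 3 / 4 := by
            rw [hz, norm_mul, hb, one_mul]
            exact zp_norm' (by linarith) (hAp p hp).two_le
          have hz2 : ‖z‖ ≤ (p:ℝ) ^ (-(3 / 4 - R)) := by
            rw [hz, norm_mul, hb, one_mul]
            exact zp_norm (by linarith) (hAp p hp).ne_zero
          have h6 := Complex.norm_log_one_add_sub_self_le (z := -z) (by rw [norm_neg]; linarith)
          rw [norm_neg, sub_neg_eq_add, ← sub_eq_add_neg, add_comm] at h6
          refine h6.trans ?_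
          have h8 : 0 ≤ (1 - ‖z‖)⁻¹ := inv_nonneg.2 (by linarith)
          have h7 : (1 - ‖z‖)⁻¹ ≤ 4 := by
            rw [inv_le_comm₀ (by linarith) (by norm_num)]; linarith
          calc _ ≤ ((p:ℝ) ^ (-(3 / 4 - R))) ^ 2 * 4 / 2 := by gcongr
            _ = 2 * ((p:ℝ) ^ (-(3 / 4 - R))) ^ 2 := by ring
            _ = _ := by rw [← Real.rpow_natCast, ← Real.rpow_mul (by positivity)]; congr 2; push_cast; ring
      _ = 2 * ∑ p ∈ A, (p:ℝ) ^ (-(3 / 2 - 2 * R)) := by rw [Finset.mul_sum]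
      _ ≤ _ := by gcongr
  have h6 : ∑ p ∈ PB M, log (1 - (if p < N0 then 1 else b p) * (p:ℂ) ^ (-(3 / 4 + s))) =
      ∑ p ∈ PB N0, log (1 - (p:ℂ) ^ (-(3 / 4 + s))) + ∑ p ∈ A, log (1 - b p * (p:ℂ) ^ (-(3 / 4 + s))) := by
    rw [← Finset.sum_filter_add_sum_filter_not (PB M) (· < N0)]
    congr 1
    · have : (PB M).filter (· < N0) = PB N0 := by
        ext p; simp only [PB, Finset.mem_filter, Finset.mem_range]
        constructor
        · rintro ⟨⟨_, h2⟩, h3⟩; exact ⟨h3, h2⟩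
        · rintro ⟨h1, h2⟩; exact ⟨⟨by omega, h2⟩, h1⟩
      rw [this]
      refine Finset.sum_congr rfl fun p hp => ?_
      have : p < N0 := by simp only [PB, Finset.mem_filter, Finset.mem_range] at hp; exact hp.1
      rw [if_pos this, one_mul]
    · simp_rw [not_lt]
      refine Finset.sum_congr rfl fun p hp => ?_
      rw [if_neg (not_lt.2 (hAN p hp))]
  have h7 : g s + ∑ p ∈ PB M, log (1 - (if p < N0 then 1 else b p) * (p:ℂ) ^ (-(3 / 4 + s))) =
      f s + ∑ p ∈ A, (b p * (p:ℂ) ^ (-(3 / 4 + s)) + log (1 - b p * (p:ℂ) ^ (-(3 / 4 + s)))) := by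
    rw [h6, Finset.sum_add_distrib]
    simp only [hf, hv]; ring
  rw [h7]
  calc _ ≤ ‖f s‖ + _ := norm_add_le _ _
    _ < ε / 2 + 2 * τ := add_lt_add_of_lt_of_le h4 h5
    _ ≤ ε := by linarith

end Voronin

namespace Voronin
open MeasureTheory Set Filter Topology ProbabilityTheory

lemma exists_log {ρ : ℝ} (hρ : 0 < ρ) {G : ℂ → ℂ} (hG : DifferentiableOn ℂ G (ball 0 ρ)) (h0 : ∀ s ∈ ball (0:ℂ) ρ, G s ≠ 0) :
    ∃ g : ℂ → ℂ, DifferentiableOn ℂ g (ball 0 ρ) ∧ ∀ s ∈ ball (0:ℂ) ρ, G s = exp (g s) := by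
  have hq : DifferentiableOn ℂ (fun s => deriv G s / G s) (ball 0 ρ) := (hG.deriv isOpen_ball).div hG h0
  obtain ⟨g, hg⟩ := hq.isExactOn_ball
  have hgd : DifferentiableOn ℂ g (ball 0 ρ) := fun s hs => (hg s hs).differentiableAt.differentiableWithinAt
  have hd : ∀ s ∈ ball (0:ℂ) ρ, HasDerivAt (fun s => G s * exp (-g s)) 0 s := by
    intro s hs
    have h1 := (hG.differentiableAt (isOpen_ball.mem_nhds hs)).hasDerivAt.mul (hg s hs).neg.cexp
    refine h1.congr_deriv ?_
    have h2 := h0 s hs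
    field_simp
    ring
  have h00 : (0:ℂ) ∈ ball (0:ℂ) ρ := by simpa using hρ
  have hc : ∀ s ∈ ball (0:ℂ) ρ, G s * exp (-g s) = G 0 * exp (-g 0) := by
    intro s hs
    refine (convex_ball (0:ℂ) ρ).is_const_of_fderivWithin_eq_zero (𝕜 := ℂ) (f := fun s => G s * exp (-g s))
      (fun z hz => (hd z hz).differentiableAt.differentiableWithinAt) (fun z hz => ?_) hs h00
    rw [fderivWithin_of_isOpen isOpen_ball hz]
    have := (hd z hz).hasFDerivAt.fderiv
    rw [this]; ext; simp
  have hc0 : G 0 * exp (-g 0) ≠ 0 := mul_ne_zero (h0 0 h00) (exp_ne_zero _)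
  refine ⟨fun s => g s + log (G 0 * exp (-g 0)), hgd.add_const _, fun s hs => ?_⟩
  simp only
  rw [exp_add, exp_log hc0, ← hc s hs, mul_left_comm, ← exp_add]; simp

lemma prod_sub_le {S : Finset ℕ} {a b : ℕ → ℂ} {δ : ℝ} (hδ : 0 ≤ δ) (ha : ∀ p ∈ S, ‖a p‖ ≤ 2) (hb : ∀ p ∈ S, ‖b p‖ ≤ 2)
    (hab : ∀ p ∈ S, ‖a p - b p‖ ≤ δ) : ‖∏ p ∈ S, a p - ∏ p ∈ S, b p‖ ≤ S.card * 2 ^ S.card * δ := by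
  induction S using Finset.induction_on with
  | empty => simp
  | insert q S hq ih =>
    rw [Finset.prod_insert hq, Finset.prod_insert hq, Finset.card_insert_of_notMem hq]
    have ih' := ih (fun p hp => ha p (Finset.mem_insert_of_mem hp)) (fun p hp => hb p (Finset.mem_insert_of_mem hp))
      (fun p hp => hab p (Finset.mem_insert_of_mem hp))
    have h1 : ‖∏ p ∈ S, a p‖ ≤ 2 ^ S.card := by
      rw [norm_prod]
      refine (Finset.prod_le_prod (fun p _ => norm_nonneg (a p)) fun p hp => ha p (Finset.mem_insert_of_mem hp)).trans ?_
      rw [Finset.prod_const]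
    have h2 := hab q (Finset.mem_insert_self _ _)
    have h3 := hb q (Finset.mem_insert_self _ _)
    calc _ = ‖(a q - b q) * ∏ p ∈ S, a p + b q * (∏ p ∈ S, a p - ∏ p ∈ S, b p)‖ := by congr 1; ring
      _ ≤ ‖a q - b q‖ * ‖∏ p ∈ S, a p‖ + ‖b q‖ * ‖∏ p ∈ S, a p - ∏ p ∈ S, b p‖ := by
        refine (norm_add_le _ _).trans ?_
        rw [norm_mul, norm_mul]
      _ ≤ δ * 2 ^ S.card + 2 * (S.card * 2 ^ S.card * δ) := by gcongr
      _ ≤ _ := by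
        push_cast
        rw [pow_succ]
        have : 0 ≤ δ * 2 ^ S.card := by positivity
        nlinarith

lemma exp_approx {r ρ : ℝ} (hr0 : 0 < r) (hr : r < 1 / 4) (hρ : r < ρ) {g : ℂ → ℂ}
    (hg : DifferentiableOn ℂ g (ball 0 ρ)) {ε : ℝ} (hε : 0 < ε) :
    ∃ T : ℝ, ∀ s : ℂ, ‖s‖ ≤ r → ‖exp (g s) - riemannZeta (s + (3 / 4 + I * T))‖ < ε := by
  obtain ⟨R, hrR, hR⟩ := exists_between (lt_min hr hρ)
  rw [lt_min_iff] at hR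
  obtain ⟨K0, hK0⟩ := (isCompact_closedBall (0:ℂ) r).exists_bound_of_continuousOn
    (f := fun s => exp (g s)) ((hg.continuousOn.mono (closedBall_subset_ball hρ)).cexp)
  set K := max K0 1 with hK
  have hK1 : 1 ≤ K := le_max_right _ _
  have hKb : ∀ s : ℂ, ‖s‖ ≤ r → ‖exp (g s)‖ ≤ K := fun s hs => (hK0 s (by simpa using hs)).trans (le_max_left _ _)
  set e := min (1 / 10) (ε / (9 * K)) with he
  have he0 : 0 < e := by positivity
  have he1 : e ≤ 1 / 10 := min_le_left _ _
  have he2 : K * e ≤ ε / 9 := by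
    calc K * e ≤ K * (ε / (9 * K)) := by gcongr; exact min_le_right _ _
      _ = _ := by field_simp
  obtain ⟨M0, hM0⟩ := step2 hr0 hrR hR.1 he0
  obtain ⟨M, hM, b, hb, hd⟩ := dens2 hr0 hrR hR.1 hR.2 hg M0 he0
  set c : ℝ := (PB M).card * 2 ^ (PB M).card with hc
  have hc0 : 0 ≤ c := by positivity
  set δ : ℝ := e / (K * (c + 1)) with hδ
  have hδ0 : 0 < δ := by positivity
  obtain ⟨T, h1, h2⟩ := hM0 M hM b hb δ hδ0
  refine ⟨T, fun s hs => ?_⟩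
  have h2s := h2 s hs
  have hds := hd s hs
  have hKs := hKb s hs
  set Q : ℂ := ∏ p ∈ PB M, (1 - (p:ℂ) ^ (-(s + (3 / 4 + I * T)))) with hQ
  set P : ℂ := ∏ p ∈ PB M, (1 - b p * (p:ℂ) ^ (-(3 / 4 + s))) with hP
  have hz : ∀ p ∈ PB M, ‖(p:ℂ) ^ (-(3 / 4 + s))‖ ≤ 3 / 4 := fun p hp => zp_norm' (by linarith) (PB_prime hp).two_le
  have hsplit : ∀ p ∈ PB M, (p:ℂ) ^ (-(s + (3 / 4 + I * T))) = (p:ℂ) ^ (-(I * (T:ℂ))) * (p:ℂ) ^ (-(3 / 4 + s)) := by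
    intro p hp
    have : (p:ℂ) ≠ 0 := by exact_mod_cast (PB_prime hp).ne_zero
    rw [← Complex.cpow_add _ _ this]; congr 1; ring
  have hQP : ‖Q - P‖ ≤ c * δ := by
    refine prod_sub_le hδ0.le (fun p hp => ?_) (fun p hp => ?_) (fun p hp => ?_)
    · refine (norm_sub_le _ _).trans ?_
      rw [hsplit p hp, norm_mul, norm_nat_I (PB_prime hp).pos, norm_one]
      linarith [hz p hp]
    · refine (norm_sub_le _ _).trans ?_
      rw [norm_mul, hb, norm_one]
      linarith [hz p hp]
    · rw [hsplit p hp]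
      have h3 := h1 p hp
      calc _ = ‖((p:ℂ) ^ (-(I * (T:ℂ))) - b p) * (p:ℂ) ^ (-(3 / 4 + s))‖ := by rw [← norm_neg]; congr 1; ring
        _ ≤ δ * 1 := by rw [norm_mul]; gcongr; linarith [hz p hp]
        _ = δ := mul_one _
  have hPe : P = exp (∑ p ∈ PB M, log (1 - b p * (p:ℂ) ^ (-(3 / 4 + s)))) := by
    rw [exp_sum]
    refine Finset.prod_congr rfl fun p hp => ?_
    rw [exp_log]
    intro h0
    have h3 : ‖b p * (p:ℂ) ^ (-(3 / 4 + s))‖ = 1 := by rw [← sub_eq_zero.1 h0, norm_one]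
    rw [norm_mul, hb] at h3
    linarith [hz p hp]
  have hgP : ‖exp (g s) * P - 1‖ ≤ 2 * e := by
    rw [hPe, ← exp_add]
    exact (Complex.norm_exp_sub_one_le (by linarith)).trans (by linarith)
  have hKQ : ‖exp (g s) * (Q - P)‖ ≤ e := by
    rw [norm_mul]
    calc _ ≤ K * (c * δ) := by gcongr
      _ = e * (c / (c + 1)) := by rw [hδ]; field_simp
      _ ≤ e * 1 := by gcongr; rw [div_le_one (by positivity)]; linarith
      _ = e := mul_one _
  have hgQ : ‖exp (g s) * Q - 1‖ ≤ 3 * e := by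
    calc _ = ‖(exp (g s) * P - 1) + exp (g s) * (Q - P)‖ := by congr 1; ring
      _ ≤ _ := (norm_add_le _ _).trans (by linarith)
  have hlow : 1 / 2 ≤ ‖exp (g s) * Q‖ := by
    have := norm_sub_norm_le (1:ℂ) (exp (g s) * Q)
    rw [norm_one, norm_sub_rev] at this
    linarith
  have hlow2 : 1 / 2 ≤ K * ‖Q‖ := by
    rw [norm_mul] at hlow
    exact hlow.trans (by gcongr)
  have hfin : ‖(exp (g s) - riemannZeta (s + (3 / 4 + I * T))) * Q‖ ≤ 4 * e := by
    have hzS : zS (PB M) (s + (3 / 4 + I * T)) = riemannZeta (s + (3 / 4 + I * T)) * Q := rfl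
    rw [hzS] at h2s
    calc _ = ‖(exp (g s) * Q - 1) - (riemannZeta (s + (3 / 4 + I * T)) * Q - 1)‖ := by congr 1; ring
      _ ≤ _ := (norm_sub_le _ _).trans (by linarith)
  rw [norm_mul] at hfin
  have h5 := norm_nonneg (exp (g s) - riemannZeta (s + (3 / 4 + I * T)))
  have h6 : ‖exp (g s) - riemannZeta (s + (3 / 4 + I * T))‖ * (1 / 2) ≤ 4 * (K * e) := by
    calc _ ≤ ‖exp (g s) - riemannZeta (s + (3 / 4 + I * T))‖ * (K * ‖Q‖) := by gcongr
      _ = K * (‖exp (g s) - riemannZeta (s + (3 / 4 + I * T))‖ * ‖Q‖) := by ring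
      _ ≤ K * (4 * e) := by gcongr
      _ = _ := by ring
  linarith

end Voronin

theorem voronin_universality (r : ℝ) (hr0 : 0 < r) (hr : r < 1 / 4) (F : ℂ → ℂ)
    (hF_anal : AnalyticOn ℂ F (ball (0 : ℂ) r))
    (hF_cont : ContinuousOn F (closedBall (0 : ℂ) r))
    (hF_ne : ∀ s ∈ ball (0 : ℂ) r, F s ≠ 0) :
    ∀ ε > (0 : ℝ), ∃ T : ℝ, ∀ s ∈ closedBall (0 : ℂ) r,
        ‖F s - riemannZeta (s + (3 / 4 + I * T))‖ < ε := by
  intro ε hε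
  have huc := (isCompact_closedBall (0:ℂ) r).uniformContinuousOn_of_continuous hF_cont
  obtain ⟨δ, hδ, hu⟩ := Metric.uniformContinuousOn_iff.1 huc (ε / 2) (by positivity)
  set l : ℝ := 1 - min (1 / 2) (δ / (2 * r)) with hl
  have hm0 : 0 < min (1 / 2) (δ / (2 * r)) := by positivity
  have hl0 : 1 / 2 ≤ l := by linarith [min_le_left (1 / 2) (δ / (2 * r))]
  have hl1 : l < 1 := by linarith
  have hlp : 0 < l := by linarith
  have hlr : (1 - l) * r < δ := by
    have : 1 - l ≤ δ / (2 * r) := by linarith [min_le_right (1 / 2) (δ / (2 * r))]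
    calc _ ≤ δ / (2 * r) * r := by gcongr
      _ = δ / 2 := by field_simp
      _ < δ := by linarith
  have hρ : r < r / l := by rw [lt_div_iff₀ hlp]; nlinarith
  have hmap : ∀ s ∈ ball (0:ℂ) (r / l), (l:ℂ) * s ∈ ball (0:ℂ) r := by
    intro s hs
    simp only [mem_ball_zero_iff] at hs ⊢
    rw [norm_mul, Complex.norm_of_nonneg hlp.le]
    rw [lt_div_iff₀ hlp] at hs; linarith
  have hG : DifferentiableOn ℂ (fun s => F (l * s)) (ball 0 (r / l)) :=
    hF_anal.differentiableOn.comp (by fun_prop) hmap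
  obtain ⟨g, hg, hGg⟩ := Voronin.exists_log (by linarith) hG fun s hs => hF_ne _ (hmap s hs)
  obtain ⟨T, hT⟩ := Voronin.exp_approx hr0 hr hρ hg (half_pos hε)
  refine ⟨T, fun s hs => ?_⟩
  have hs' : ‖s‖ ≤ r := by simpa using hs
  have hsb : s ∈ ball (0:ℂ) (r / l) := by simpa using hs'.trans_lt hρ
  have h1 := hT s hs'
  rw [← hGg s hsb] at h1
  have h2 := hu s hs (l * s) (ball_subset_closedBall (hmap s hsb)) (by
    rw [dist_eq_norm, show s - l * s = ((1 - l : ℝ) : ℂ) * s by push_cast; ring, norm_mul,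
      Complex.norm_of_nonneg (by linarith)]
    refine lt_of_le_of_lt ?_ hlr
    have : 0 ≤ 1 - l := by linarith
    gcongr)
  rw [dist_eq_norm] at h2
  calc _ = ‖(F s - F (l * s)) + (F (l * s) - riemannZeta (s + (3 / 4 + I * T)))‖ := by congr 1; ring
    _ ≤ _ := norm_add_le _ _
    _ < ε / 2 + ε / 2 := add_lt_add h2 h1
    _ = ε := by ring
end

section
/- Let 1/2 < α < β < 1. Define for σ ∈ {α, β} and T > 0 the vertical integral I(σ,T) = ∫_{−T}^{T} (Γ'/Γ)((σ+it)/2 + 1)·i dt of the logarithmic derivative of the Gamma function. Then (1/2)·(I(β,T) − I(α,T)) → (β−α)·(π/2)·i as T → +∞. -/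
open Complex Filter intervalIntegral Real

theorem aux_GammaSeq_bound (s : ℂ) (hs : 0 < s.re) (n : ℕ) (hn : n ≠ 0) :
    ‖Complex.GammaSeq s n‖ ≤ Real.Gamma s.re := by
  rw [Complex.GammaSeq_eq_approx_Gamma_integral hs hn, Real.Gamma_eq_integral hs,
    intervalIntegral.integral_of_le (by positivity : (0:ℝ) ≤ n)]
  refine (MeasureTheory.norm_integral_le_integral_norm _).trans ?_
  have hI := Real.GammaIntegral_convergent hs
  have hsub : Set.Ioc (0:ℝ) n ⊆ Set.Ioi 0 := Set.Ioc_subset_Ioi_self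
  refine le_trans (MeasureTheory.integral_mono_of_nonneg (Eventually.of_forall fun x => norm_nonneg _)
    (hI.mono_set hsub) ?_) (MeasureTheory.setIntegral_mono_set hI ?_ hsub.eventuallyLE)
  · rw [EventuallyLE, MeasureTheory.ae_restrict_iff' measurableSet_Ioc]
    filter_upwards with x hx
    have hxn := hx.2
    have hx0 : 0 < x := hx.1
    rw [norm_mul, Complex.norm_of_nonneg
          (pow_nonneg (sub_nonneg.mpr <| div_le_one_of_le₀ hxn <| by positivity) _),
          norm_cpow_eq_rpow_re_of_pos hx0, sub_re, one_re]
    gcongr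
    exact Real.one_sub_div_pow_le_exp_neg hxn
  · rw [EventuallyLE, MeasureTheory.ae_restrict_iff' measurableSet_Ioi]
    filter_upwards with x hx
    have : 0 < x := hx
    simp only [Pi.zero_apply]
    positivity

theorem aux_add_ne (s : ℂ) (hs : 0 < s.re) (j : ℕ) : s + j ≠ 0 := by
  intro h
  have := congrArg Complex.re h
  simp at this
  have : (0:ℝ) ≤ j := by positivity
  linarith

theorem aux_ne (s : ℂ) (hs : 0 < s.re) (m : ℕ) : s ≠ -m := by
  intro h
  apply aux_add_ne s hs m
  rw [h]; ring

theorem aux_diff (s : ℂ) (hs : 0 < s.re) (n : ℕ) (hn : n ≠ 0) :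
    DifferentiableAt ℂ (fun z => Complex.GammaSeq z n) s := by
  unfold Complex.GammaSeq
  have hn' : (n:ℂ) ≠ 0 := by exact_mod_cast hn
  apply DifferentiableAt.div
  · apply DifferentiableAt.mul_const
    exact (differentiableAt_id).const_cpow (Or.inl hn')
  · fun_prop
  · rw [Finset.prod_ne_zero_iff]
    exact fun j _ => aux_add_ne s hs j

theorem aux_open : IsOpen {z : ℂ | 0 < z.re} := isOpen_lt continuous_const Complex.continuous_re

theorem aux_diffG (s : ℂ) (hs : 0 < s.re) : DifferentiableAt ℂ Complex.Gamma s :=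
  Complex.differentiableAt_Gamma s (aux_ne s hs)

theorem aux_logDeriv (s : ℂ) (hs : 0 < s.re) (n : ℕ) (hn : n ≠ 0) :
    logDeriv (fun z => Complex.GammaSeq z n) s
      = Complex.log n - ∑ j ∈ Finset.range (n + 1), 1 / (s + j) := by
  unfold Complex.GammaSeq
  have hn' : (n:ℂ) ≠ 0 := by exact_mod_cast hn
  have hd : DifferentiableAt ℂ (fun z : ℂ => (n:ℂ) ^ z) s :=
    (differentiableAt_id).const_cpow (Or.inl hn')
  rw [logDeriv_div, logDeriv_mul_const, logDeriv_prod]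
  · congr 1
    · rw [logDeriv_apply]
      have : HasDerivAt (fun z : ℂ => (n:ℂ) ^ z) ((n:ℂ) ^ s * Complex.log n * 1) s :=
        (hasDerivAt_id s).const_cpow (Or.inl hn')
      rw [this.deriv]
      have : (n:ℂ)^s ≠ 0 := by simp [Complex.cpow_eq_zero_iff, hn']
      field_simp
    · refine Finset.sum_congr rfl fun j _ => ?_
      simp [logDeriv_apply]
  · exact fun j _ => aux_add_ne s hs j
  · intros; fun_prop
  · exact_mod_cast Nat.factorial_ne_zero n
  · refine mul_ne_zero ?_ (by exact_mod_cast Nat.factorial_ne_zero n)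
    simp [Complex.cpow_eq_zero_iff, hn']
  · rw [Finset.prod_ne_zero_iff]
    exact fun j _ => aux_add_ne s hs j
  · fun_prop
  · fun_prop

theorem aux_deriv_tendsto (s : ℂ) (hs : 0 < s.re) :
    Tendsto (fun n => deriv (fun z => Complex.GammaSeq z n) s) atTop
      (nhds (deriv Complex.Gamma s)) := by
  have hr : 0 < s.re / 2 := by positivity
  have hball : Metric.closedBall s (s.re / 2) ⊆ {z : ℂ | 0 < z.re} := by
    intro z hz
    rw [Metric.mem_closedBall, dist_eq_norm] at hz
    have := (Complex.abs_re_le_norm (z - s)).trans hz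
    rw [abs_le, Complex.sub_re] at this
    simp only [Set.mem_ofPred_eq]
    linarith [this.1]
  have hcm : ∀ θ, 0 < (circleMap s (s.re/2) θ).re := fun θ =>
    hball (circleMap_mem_closedBall s hr.le θ)
  rw [← Complex.cderiv_eq_deriv aux_open (fun z hz => (aux_diffG z hz).differentiableWithinAt)
    hr hball]
  have hev : ∀ᶠ n : ℕ in atTop, Complex.cderiv (s.re/2) (fun z => Complex.GammaSeq z n) s =
      deriv (fun z => Complex.GammaSeq z n) s := by
    filter_upwards [eventually_ne_atTop 0] with n hn
    exact Complex.cderiv_eq_deriv aux_open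
      (fun z hz => (aux_diff z hz n hn).differentiableWithinAt) hr hball
  refine Tendsto.congr' hev ?_
  unfold Complex.cderiv circleIntegral
  refine Tendsto.const_smul ?_ _
  have hcirc : Continuous (circleMap s (s.re/2)) := continuous_circleMap _ _
  have hinv : Continuous fun θ => ((circleMap s (s.re/2) θ - s)^2)⁻¹ := by
    refine Continuous.inv₀ (by fun_prop) fun θ => ?_
    have := circleMap_ne_center (c := s) hr.ne' (θ := θ)
    exact pow_ne_zero _ (sub_ne_zero.2 this)
  have hder : Continuous (deriv (circleMap s (s.re/2))) := by
    have : deriv (circleMap s (s.re/2)) = fun θ => circleMap 0 (s.re/2) θ * I := by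
      ext θ; simp
    rw [this]
    fun_prop
  have hGc : Continuous fun θ => Real.Gamma (circleMap s (s.re/2) θ).re := by
    rw [continuous_iff_continuousAt]
    intro θ
    have h1 : ContinuousAt Real.Gamma (circleMap s (s.re/2) θ).re := by
      refine (Real.differentiableAt_Gamma fun m => ?_).continuousAt
      have h0 := hcm θ
      have : (0:ℝ) ≤ m := by positivity
      intro h; linarith
    exact h1.comp (f := fun θ => (circleMap s (s.re/2) θ).re)
      (Complex.continuous_re.comp hcirc).continuousAt
  refine intervalIntegral.tendsto_integral_filter_of_dominated_convergence
    (fun θ => ‖deriv (circleMap s (s.re/2)) θ‖ *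
      (‖((circleMap s (s.re/2) θ - s)^2)⁻¹‖ * Real.Gamma (circleMap s (s.re/2) θ).re)) ?_ ?_ ?_ ?_
  · filter_upwards [eventually_ne_atTop 0] with n hn
    have : Continuous fun θ => Complex.GammaSeq (circleMap s (s.re/2) θ) n := by
      rw [continuous_iff_continuousAt]
      intro θ
      exact ((aux_diff _ (hcm θ) n hn).continuousAt).comp (f := circleMap s (s.re/2))
        hcirc.continuousAt
    exact (hder.smul (hinv.smul this)).aestronglyMeasurable
  · filter_upwards [eventually_ne_atTop 0] with n hn
    filter_upwards with θ _
    rw [norm_smul, norm_smul]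
    gcongr
    exact aux_GammaSeq_bound _ (hcm θ) n hn
  · exact (hder.norm.mul (hinv.norm.mul hGc)).intervalIntegrable _ _
  · filter_upwards with θ _
    exact ((Complex.GammaSeq_tendsto_Gamma _).const_smul _).const_smul _

theorem aux_psi_tendsto (s : ℂ) (hs : 0 < s.re) :
    Tendsto (fun n : ℕ => Complex.log n - ∑ j ∈ Finset.range (n + 1), 1 / (s + j)) atTop
      (nhds (logDeriv Complex.Gamma s)) := by
  have h := (aux_deriv_tendsto s hs).div (Complex.GammaSeq_tendsto_Gamma s)
    (Complex.Gamma_ne_zero_of_re_pos hs)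
  refine Tendsto.congr' ?_ h
  filter_upwards [eventually_ne_atTop 0] with n hn
  rw [← aux_logDeriv s hs n hn]
  rfl

theorem aux_sum_bound (y : ℝ) (hy : 1 < y) (n : ℕ) :
    ∑ j ∈ Finset.range n, 2 / ((j + y) * (j + y - 1)) ≤ 2 / (y - 1) - 2 / (n + y - 1) := by
  induction n with
  | zero => simp
  | succ n ih =>
    rw [Finset.sum_range_succ]
    have hn : (0:ℝ) ≤ n := by positivity
    have h1 : 0 < n + y - 1 := by linarith
    have h2 : 0 < n + y := by linarith
    have : 2 / ((n + y) * (n + y - 1)) = 2 / (n + y - 1) - 2 / (((n+1:ℕ):ℝ) + y - 1) := by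
      push_cast
      have : (n:ℝ) + 1 + y - 1 = n + y := by ring
      rw [this]
      field_simp
      ring
    linarith

theorem aux_norm_lower (s : ℂ) (hs : 0 < s.re) (hy : 1 < |s.im|) (j : ℕ) :
    (j + |s.im|) * (j + |s.im| - 1) / 2 ≤ ‖s + j‖ ^ 2 := by
  rw [Complex.sq_norm, Complex.normSq_apply]
  simp only [add_re, natCast_re, add_im, natCast_im, add_zero]
  have hj : (0:ℝ) ≤ j := by positivity
  have := abs_mul_abs_self s.im
  nlinarith [sq_nonneg ((j:ℝ) - |s.im|), mul_nonneg hs.le hj]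

theorem aux_psi_bound (s w : ℂ) (hs : 0 < s.re) (hw : 0 < w.re) (him : s.im = w.im)
    (hy : 1 < |s.im|) :
    ‖logDeriv Complex.Gamma s - logDeriv Complex.Gamma w‖ ≤ ‖s - w‖ * (2 / (|s.im| - 1)) := by
  have h := (aux_psi_tendsto s hs).sub (aux_psi_tendsto w hw)
  refine le_of_tendsto h.norm (Eventually.of_forall fun n => ?_)
  have : (Complex.log n - ∑ j ∈ Finset.range (n + 1), 1 / (s + j)) -
      (Complex.log n - ∑ j ∈ Finset.range (n + 1), 1 / (w + j)) =
      ∑ j ∈ Finset.range (n + 1), (s - w) * (1 / ((s + j) * (w + j))) := by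
    rw [sub_sub_sub_cancel_left, ← Finset.sum_sub_distrib]
    refine Finset.sum_congr rfl fun j _ => ?_
    have h1 := aux_add_ne s hs j
    have h2 := aux_add_ne w hw j
    field_simp
    ring
  rw [this, ← Finset.mul_sum, norm_mul]
  gcongr
  refine (norm_sum_le _ _).trans ?_
  have hb := aux_sum_bound |s.im| hy (n+1)
  have hpos : 0 ≤ 2 / (((n+1:ℕ):ℝ) + |s.im| - 1) := by
    apply div_nonneg (by norm_num)
    have : (0:ℝ) ≤ ((n+1:ℕ):ℝ) := by positivity
    linarith
  refine le_trans (Finset.sum_le_sum fun j _ => ?_) (hb.trans (by linarith))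
  have l1 := aux_norm_lower s hs hy j
  have l2 := aux_norm_lower w hw (him ▸ hy) j
  rw [← him] at l2
  have hj : (0:ℝ) ≤ j := by positivity
  have hA : 0 < (j + |s.im|) * (j + |s.im| - 1) := by
    apply mul_pos <;> linarith
  rw [norm_div, norm_one, norm_mul]
  have hm : (j + |s.im|) * (j + |s.im| - 1) / 2 ≤ ‖s + j‖ * ‖w + j‖ := by
    refine abs_le_of_sq_le_sq' ?_ (by positivity) |>.2
    rw [mul_pow, sq]
    exact mul_le_mul l1 l2 (by positivity) (by positivity)
  calc 1 / (‖s + j‖ * ‖w + j‖) ≤ 1 / ((j + |s.im|) * (j + |s.im| - 1) / 2) := by gcongr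
    _ = _ := by field_simp

theorem aux_reflection (y : ℝ) :
    logDeriv Complex.Gamma (1/2 + y * I) - logDeriv Complex.Gamma (1/2 - y * I)
      = π * Real.tanh (π * y) * I := by
  set z : ℂ := 1/2 + y * I with hz
  have hz' : (1/2 - y * I : ℂ) = 1 - z := by rw [hz]; ring
  have hzre : 0 < z.re := by simp [hz]
  have hzre' : 0 < (1 - z).re := by simp [hz]; norm_num
  have hsin : Complex.sin (π * z) = Complex.cosh (π * y) := by
    rw [hz, show (π:ℂ) * (1/2 + y * I) = (π * y) * I + π / 2 by ring,
      Complex.sin_add_pi_div_two, Complex.cos_mul_I]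
  have hcos : Complex.cos (π * z) = - (Complex.sinh (π * y) * I) := by
    rw [hz, show (π:ℂ) * (1/2 + y * I) = (π * y) * I + π / 2 by ring,
      Complex.cos_add_pi_div_two, Complex.sin_mul_I]
  have hch : Complex.cosh (π * y) ≠ 0 := by
    rw [← Complex.ofReal_mul, ← Complex.ofReal_cosh]
    exact_mod_cast (Real.cosh_pos _).ne'
  have hG1 := Complex.Gamma_ne_zero_of_re_pos hzre
  have hG2 := Complex.Gamma_ne_zero_of_re_pos hzre'
  have d1 := (aux_diffG z hzre).hasDerivAt
  have d2 : HasDerivAt (fun w => Complex.Gamma (1 - w)) (-deriv Complex.Gamma (1 - z)) z := by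
    have := (aux_diffG (1 - z) hzre').hasDerivAt.comp_const_sub (1:ℂ) z
    exact this
  have d3 : HasDerivAt (fun w : ℂ => Complex.sin (π * w)) (Complex.cos (π * z) * π) z := by
    have := ((hasDerivAt_id z).const_mul (π:ℂ)).csin
    simpa using this
  have d4 := (d3.inv (by rw [hsin]; exact hch)).const_mul (π:ℂ)
  have d5 := d1.mul d2
  have heq : (fun w => Complex.Gamma w * Complex.Gamma (1 - w)) =
      fun w : ℂ => (π:ℂ) * (Complex.sin (π * w))⁻¹ := by
    ext w; rw [Complex.Gamma_mul_Gamma_one_sub, div_eq_mul_inv]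
  have d5' : HasDerivAt (fun w => Complex.Gamma w * Complex.Gamma (1 - w)) _ z := d5
  rw [heq] at d5'
  have key := d5'.unique d4
  have hv := Complex.Gamma_mul_Gamma_one_sub z
  rw [hsin] at hv
  rw [hcos, hsin] at key
  rw [hz', logDeriv_apply, logDeriv_apply, div_sub_div _ _ hG1 hG2, hv, Complex.ofReal_tanh,
    Complex.tanh_eq_sinh_div_cosh]
  have hpi : (π:ℂ) ≠ 0 := by exact_mod_cast Real.pi_ne_zero
  push_cast
  rw [show deriv Complex.Gamma z * Complex.Gamma (1 - z) - Complex.Gamma z * deriv Complex.Gamma (1 - z)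
    = deriv Complex.Gamma z * Complex.Gamma (1 - z) + Complex.Gamma z * -deriv Complex.Gamma (1 - z) by ring, key]
  field_simp

theorem aux_tanh : Tendsto (fun T : ℝ => Real.tanh (π * (T / 2))) atTop (nhds 1) := by
  have h1 : Tendsto (fun T : ℝ => Real.exp (-(π * T))) atTop (nhds 0) :=
    Real.tendsto_exp_neg_atTop_nhds_zero.comp (tendsto_id.const_mul_atTop Real.pi_pos)
  have h2 : Tendsto (fun T : ℝ => (1 - Real.exp (-(π * T))) / (1 + Real.exp (-(π * T)))) atTop
      (nhds ((1 - 0) / (1 + 0))) := (h1.const_sub 1).div (h1.const_add 1) (by norm_num)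
  simp only [sub_zero, add_zero, div_one] at h2
  refine h2.congr fun T => ?_
  rw [Real.tanh_eq_sinh_div_cosh, Real.sinh_eq, Real.cosh_eq]
  have : Real.exp (-(π * T)) = Real.exp (-(π * (T / 2))) * Real.exp (-(π * (T / 2))) := by
    rw [← Real.exp_add]; ring_nf
  rw [this]
  have h3 : Real.exp (-(π * (T / 2))) * Real.exp (π * (T / 2)) = 1 := by
    rw [← Real.exp_add]; simp
  set a := Real.exp (-(π * (T / 2))) with ha
  set b := Real.exp (π * (T / 2)) with hb
  have ha0 : 0 < a := Real.exp_pos _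
  have hb0 : 0 < b := Real.exp_pos _
  rw [div_div_div_cancel_right₀ (by norm_num), div_eq_div_iff (by positivity) (by positivity)]
  linear_combination (-2 * a) * h3

theorem aux_f_diff (z : ℂ) (hz : 0 < z.re) :
    DifferentiableAt ℂ (fun z : ℂ => logDeriv Complex.Gamma (z / 2 + 1)) z := by
  have hre : 0 < (z / 2 + 1).re := by
    have : (z / 2 + 1).re = z.re / 2 + 1 := by simp
    rw [this]; positivity
  have h1 : DifferentiableAt ℂ (logDeriv Complex.Gamma) (z / 2 + 1) := by
    have hd : DifferentiableOn ℂ Complex.Gamma {z : ℂ | 0 < z.re} :=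
      fun w hw => (aux_diffG w hw).differentiableWithinAt
    have hd' := (hd.deriv aux_open).differentiableAt (aux_open.mem_nhds hre)
    exact hd'.div (aux_diffG _ hre) (Complex.Gamma_ne_zero_of_re_pos hre)
  exact h1.comp (f := fun z : ℂ => z / 2 + 1) z (by fun_prop)

theorem aux_pointwise (x T : ℝ) (hx : 0 < x) (hx1 : x < 1) (hT : 2 < T) :
    ‖logDeriv Complex.Gamma ((x + T * I) / 2 + 1) - logDeriv Complex.Gamma ((x + (-T : ℝ) * I) / 2 + 1)
      - π * Real.tanh (π * (T / 2)) * I‖ ≤ 4 / (T / 2 - 1) := by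
  have hre : ∀ t : ℝ, ((x + t * I : ℂ) / 2 + 1).re = x / 2 + 1 := by intro t; simp
  have him : ∀ t : ℝ, ((x + t * I : ℂ) / 2 + 1).im = t / 2 := by intro t; simp
  have hre' : ∀ t : ℝ, ((1:ℂ)/2 + (t / 2 : ℝ) * I).re = 1 / 2 := by intro t; simp
  have him' : ∀ t : ℝ, ((1:ℂ)/2 + (t / 2 : ℝ) * I).im = t / 2 := by intro t; simp
  have hb : ∀ t : ℝ, |t| = T → ‖logDeriv Complex.Gamma ((x + t * I) / 2 + 1) -
      logDeriv Complex.Gamma (1/2 + (t / 2 : ℝ) * I)‖ ≤ 2 / (T / 2 - 1) := by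
    intro t ht
    have habs : |t / 2| = T / 2 := by rw [abs_div, ht]; norm_num
    have := aux_psi_bound ((x + t * I) / 2 + 1) (1/2 + (t / 2 : ℝ) * I)
      (by rw [hre]; positivity) (by rw [hre']; norm_num) (by rw [him, him'])
      (by rw [him, habs]; linarith)
    rw [him, habs] at this
    refine this.trans ?_
    have hp : 0 ≤ 2 / (T / 2 - 1) := div_nonneg (by norm_num) (by linarith)
    have hn : ‖((x + t * I : ℂ) / 2 + 1) - (1/2 + (t / 2 : ℝ) * I)‖ ≤ 1 := by
      have : ((x + t * I : ℂ) / 2 + 1) - (1/2 + (t / 2 : ℝ) * I) = ((x / 2 + 1 / 2 : ℝ) : ℂ) := by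
        push_cast; ring
      rw [this, Complex.norm_of_nonneg (by positivity)]
      linarith
    nlinarith
  have h1 := hb T (abs_of_pos (by linarith))
  have h2 := hb (-T) (by rw [abs_neg, abs_of_pos (by linarith)])
  have h3 := aux_reflection (T / 2)
  have e : (1/2 + (-T / 2 : ℝ) * I : ℂ) = 1/2 - (T / 2 : ℝ) * I := by push_cast; ring
  rw [e] at h2
  rw [← h3]
  refine le_trans (le_of_eq ?_) ((norm_sub_le _ _).trans ((add_le_add h1 h2).trans (le_of_eq ?_)))
  · congr 1; ring
  · ring

theorem digamma_vertical_integrals_limit (α β : ℝ)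
    (hα : 1 / 2 < α) (hαβ : α < β) (hβ : β < 1) :
    Tendsto (fun T : ℝ =>
        (1 / 2 : ℂ) *
          ((∫ t in (-T)..T,
              deriv Complex.Gamma ((β + t * I) / 2 + 1) / Complex.Gamma ((β + t * I) / 2 + 1) * I)
            - ∫ t in (-T)..T,
              deriv Complex.Gamma ((α + t * I) / 2 + 1) / Complex.Gamma ((α + t * I) / 2 + 1) * I))
      atTop (nhds ((β - α) * (π / 2) * I)) := by
  set f : ℂ → ℂ := fun z => logDeriv Complex.Gamma (z / 2 + 1) with hf
  have hfd : ∀ z : ℂ, 0 < z.re → DifferentiableAt ℂ f z := aux_f_diff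
  have hcont : ∀ T : ℝ, ContinuousOn (fun x : ℝ => f (x + T * I)) (Set.uIcc α β) := by
    intro T x hx
    rw [Set.uIcc_of_le hαβ.le] at hx
    have h0 : 0 < ((x:ℂ) + T * I).re := by simp; linarith [hx.1]
    exact ((hfd _ h0).continuousAt.comp (f := fun x : ℝ => (x:ℂ) + T * I)
      (by fun_prop)).continuousWithinAt
  have hint : ∀ T : ℝ, IntervalIntegrable (fun x : ℝ => f (x + T * I)) MeasureTheory.volume α β :=
    fun T => (hcont T).intervalIntegrable
  have hC : ∀ T : ℝ,
      (∫ t in (-T)..T, deriv Complex.Gamma ((β + t * I) / 2 + 1) /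
          Complex.Gamma ((β + t * I) / 2 + 1) * I)
        - (∫ t in (-T)..T, deriv Complex.Gamma ((α + t * I) / 2 + 1) /
          Complex.Gamma ((α + t * I) / 2 + 1) * I)
      = ∫ x in α..β, (f (x + T * I) - f (x + (-T : ℝ) * I)) := by
    intro T
    have hrect : DifferentiableOn ℂ f (Set.uIcc α β ×ℂ Set.uIcc (-T) T) := by
      intro z hz
      have h1 : z.re ∈ Set.uIcc α β := hz.1
      rw [Set.uIcc_of_le hαβ.le] at h1
      exact (hfd z (by linarith [h1.1])).differentiableWithinAt
    have := Complex.integral_boundary_rect_eq_zero_of_differentiableOn f ⟨α, -T⟩ ⟨β, T⟩ hrect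
    simp only [smul_eq_mul] at this
    rw [intervalIntegral.integral_sub (hint T) (hint (-T)),
      intervalIntegral.integral_mul_const, intervalIntegral.integral_mul_const]
    simp only [hf, logDeriv_apply] at this ⊢
    linear_combination this
  have hlim : Tendsto (fun T : ℝ => ∫ x in α..β, (f (x + T * I) - f (x + (-T : ℝ) * I))) atTop
      (nhds ((β - α) * π * I)) := by
    have hmain : Tendsto (fun T : ℝ => ((β:ℂ) - α) * (π * (Real.tanh (π * (T / 2)) : ℝ) * I)) atTop
        (nhds ((β - α) * (π * (1:ℝ) * I))) :=
      ((((Complex.continuous_ofReal.tendsto 1).comp aux_tanh).const_mul (π:ℂ)).mul_const I).const_mul _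
    have hdiff : Tendsto (fun T : ℝ => (∫ x in α..β, (f (x + T * I) - f (x + (-T : ℝ) * I)))
        - ((β:ℂ) - α) * (π * (Real.tanh (π * (T / 2)) : ℝ) * I)) atTop (nhds 0) := by
      have hb : Tendsto (fun T : ℝ => 4 / (T / 2 - 1) * |β - α|) atTop (nhds 0) := by
        have : Tendsto (fun T : ℝ => T / 2 - 1) atTop atTop :=
          tendsto_atTop_add_const_right _ (-1) (tendsto_id.atTop_div_const (by norm_num))
        simpa using (this.const_div_atTop 4).mul_const |β - α|
      refine squeeze_zero_norm' ?_ hb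
      filter_upwards [eventually_gt_atTop 2] with T hT
      have e : ((β:ℂ) - α) * (π * (Real.tanh (π * (T / 2)) : ℝ) * I) =
          ∫ x in α..β, (π * (Real.tanh (π * (T / 2)) : ℝ) * I : ℂ) := by
        rw [intervalIntegral.integral_const, Complex.real_smul]; push_cast; ring
      rw [e, ← intervalIntegral.integral_sub ((hint T).sub (hint (-T))) (by simp)]
      refine intervalIntegral.norm_integral_le_of_norm_le_const fun x hx => ?_
      rw [Set.uIoc_of_le hαβ.le] at hx
      exact aux_pointwise x T (by linarith [hx.1]) (by linarith [hx.2]) hT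
    have := hdiff.add hmain
    simp only [sub_add_cancel] at this
    convert this using 2
    push_cast; ring
  simp only [hC]
  have := hlim.const_mul (1/2 : ℂ)
  convert this using 2
  ring
end
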